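/- Let Ω be an n-connected quadrature domain of finite area with no degenerate boundary components, and let K be its Bergman kernel. Then for each fixed w ∈ Ω the function z ↦ K(z, w) is algebraic: there exists a nonzero polynomial P ∈ ℂ[X,Y] (depending on w) such that P(z, K(z, w)) = 0 for all z ∈ Ω. -/

import Mathlib

open MeasureTheory Complex ComplexConjugate Metric Set

noncomputable section

/-- `f` belongs to the Bergman space `A²(Ω)`. -/
def BergmanFun (Ω : Set ℂ) (f : ℂ → ℂ) : Prop :=
  DifferentiableOn ℂ f Ω ∧ IntegrableOn (fun z => ‖f z‖ ^ 2) Ω volume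

/-- `Ω` is a finitely connected domain none of whose complementary components is a point. -/
def IsFinConnDomain (Ω : Set ℂ) : Prop :=
  IsOpen Ω ∧ IsConnected Ω ∧
  {C : Set ℂ | ∃ x ∈ Ωᶜ, C = connectedComponentIn Ωᶜ x}.Finite ∧
  ∀ x ∈ Ωᶜ, ¬ (connectedComponentIn Ωᶜ x).Subsingleton

/-- `Ω` is a quadrature domain. -/
def IsQuadratureDomain (Ω : Set ℂ) : Prop :=
  ∃ N : ℕ, 0 < N ∧ ∃ (w : Fin N → ℂ) (n : Fin N → ℕ) (c : Fin N → ℕ → ℂ),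
    (∀ j, w j ∈ Ω) ∧
    ∀ f : ℂ → ℂ, BergmanFun Ω f →
      (∫ z in Ω, f z) =
        ∑ j, ∑ k ∈ Finset.range (n j + 1), c j k * iteratedDerivWithin k f Ω (w j)

/-- `fa` is an Ahlfors map of `Ω` at `a`. -/
def IsAhlforsMap (Ω : Set ℂ) (a : ℂ) (fa : ℂ → ℂ) : Prop :=
  DifferentiableOn ℂ fa Ω ∧ (∀ z ∈ Ω, ‖fa z‖ < 1) ∧
  (deriv fa a).im = 0 ∧ 0 < (deriv fa a).re ∧
  ∀ g : ℂ → ℂ, DifferentiableOn ℂ g Ω → (∀ z ∈ Ω, ‖g z‖ < 1) →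
    ‖deriv g a‖ ≤ (deriv fa a).re

/-- `Ω` is bounded with `C^∞` smooth boundary consisting of finitely many disjoint
simple closed curves. -/
def HasSmoothBoundary (Ω : Set ℂ) : Prop :=
  Bornology.IsBounded Ω ∧
  ∃ (n : ℕ) (γ : Fin n → ℝ → ℂ),
    (∀ i, ContDiff ℝ (⊤ : ℕ∞) (γ i)) ∧
    (∀ i, Function.Periodic (γ i) (2 * Real.pi)) ∧
    (∀ i, InjOn (γ i) (Ico 0 (2 * Real.pi))) ∧
    (∀ i t, deriv (γ i) t ≠ 0) ∧
    (Pairwise fun i j => Disjoint (range (γ i)) (range (γ j))) ∧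
    frontier Ω = ⋃ i, range (γ i)

/-- Partial derivative in the `x`-direction of a real-valued function on `ℂ`. -/
def pdx (u : ℂ → ℝ) (z : ℂ) : ℝ := deriv (fun t : ℝ => u (z + (t : ℂ))) 0

/-- Partial derivative in the `y`-direction of a real-valued function on `ℂ`. -/
def pdy (u : ℂ → ℝ) (z : ℂ) : ℝ := deriv (fun t : ℝ => u (z + (t : ℂ) * Complex.I)) 0

/-- `f` is a proper holomorphic map of `Ω` onto the open unit disc. -/
def IsProperOntoDisc (Ω : Set ℂ) (f : ℂ → ℂ) : Prop :=
  DifferentiableOn ℂ f Ω ∧ f '' Ω = ball (0 : ℂ) 1 ∧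
  ∀ L : Set ℂ, L ⊆ ball (0 : ℂ) 1 → IsCompact L → IsCompact (Ω ∩ f ⁻¹' L)

/-- `g` is `(m, δ)`-close to the identity on `closure Ω`. -/
def CloseToId (Ω : Set ℂ) (m : ℕ) (δ : ℝ) (g : ℂ → ℂ) : Prop :=
  ∀ k ≤ m, ∀ z ∈ closure Ω, ‖iteratedFDeriv ℝ k (fun w => g w - w) z‖ ≤ δ

/-- `σ : [0,1] → ℂ` is a piecewise continuously differentiable curve. -/
def PiecewiseC1On01 (σ : ℝ → ℂ) : Prop :=
  ContinuousOn σ (Icc 0 1) ∧ ∃ s : Finset ℝ, ContDiffOn ℝ 1 σ (Icc (0 : ℝ) 1 \ s)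

/-- `Ω` is a generalized quadrature domain. -/
def IsGenQuadratureDomain (Ω : Set ℂ) : Prop :=
  ∃ (N M : ℕ) (w : Fin N → ℂ) (n : Fin N → ℕ) (c : Fin N → ℕ → ℂ)
    (b : Fin M → ℂ) (σ : Fin M → ℝ → ℂ),
    (∀ j, w j ∈ Ω) ∧
    (∀ m, PiecewiseC1On01 (σ m)) ∧
    (∀ m, ∀ t ∈ Icc (0 : ℝ) 1, σ m t ∈ Ω) ∧
    ∀ f : ℂ → ℂ, BergmanFun Ω f →
      (∫ z in Ω, f z) =
        (∑ j, ∑ k ∈ Finset.range (n j + 1), c j k * iteratedDerivWithin k f Ω (w j)) +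
        ∑ m, b m * ∫ t in (0 : ℝ)..1, f (σ m t) * deriv (σ m) t

section Auxiliary

open scoped ContDiff Topology Convolution ENNReal NNReal

/-- The Wirtinger derivative `∂/∂z̄`. -/
def dbar (u : ℂ → ℂ) (z : ℂ) : ℂ := (fderiv ℝ u z 1 + I * fderiv ℝ u z I) / 2

/-- The Wirtinger derivative `∂/∂z`. -/
def dd (u : ℂ → ℂ) (z : ℂ) : ℂ := (fderiv ℝ u z 1 - I * fderiv ℝ u z I) / 2

/-- Smooth functions with compact support in `Ω`. -/
structure TestFn (Ω : Set ℂ) (χ : ℂ → ℂ) : Prop where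
  smooth : ContDiff ℝ ∞ χ
  cpt : HasCompactSupport χ
  sub : tsupport χ ⊆ Ω

section Wirtinger

variable {u v : ℂ → ℂ} {z : ℂ}

theorem fderiv_eq_dd_dbar (u : ℂ → ℂ) (z h : ℂ) :
    fderiv ℝ u z h = dd u z * h + dbar u z * conj h := by
  have h1 : h = h.re • (1 : ℂ) + h.im • I := by
    simp [Complex.re_add_im]
  conv_lhs => rw [h1]
  have h2 : conj h = h.re - h.im * I := by
    apply Complex.ext <;> simp
  have h3 : h = h.re + h.im * I := (Complex.re_add_im h).symm
  rw [map_add, map_smul, map_smul, h2]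
  conv_rhs => rw [h3]
  simp only [dd, dbar, Complex.real_smul]
  simp only [add_re, ofReal_re, mul_re, I_re, mul_zero, ofReal_im, I_im, mul_one, sub_self,
    add_zero, add_im, mul_im, zero_add]
  linear_combination ((h.im : ℂ) * fderiv ℝ u z I) * I_sq

theorem dbar_add (hu : DifferentiableAt ℝ u z) (hv : DifferentiableAt ℝ v z) :
    dbar (fun z => u z + v z) z = dbar u z + dbar v z := by
  simp only [dbar, fderiv_fun_add hu hv, add_apply, _root_.add_apply]
  ring

theorem dbar_mul (hu : DifferentiableAt ℝ u z) (hv : DifferentiableAt ℝ v z) :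
    dbar (fun z => u z * v z) z = u z * dbar v z + v z * dbar u z := by
  simp only [dbar, fderiv_fun_mul hu hv, _root_.add_apply, _root_.smul_apply, smul_eq_mul]
  ring

theorem dd_mul (hu : DifferentiableAt ℝ u z) (hv : DifferentiableAt ℝ v z) :
    dd (fun z => u z * v z) z = u z * dd v z + v z * dd u z := by
  simp only [dd, fderiv_fun_mul hu hv, _root_.add_apply, _root_.smul_apply, smul_eq_mul]
  ring

theorem dd_add (hu : DifferentiableAt ℝ u z) (hv : DifferentiableAt ℝ v z) :
    dd (fun z => u z + v z) z = dd u z + dd v z := by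
  simp only [dd, fderiv_fun_add hu hv, _root_.add_apply]
  ring

theorem dbar_const_mul (c : ℂ) (hu : DifferentiableAt ℝ u z) :
    dbar (fun z => c * u z) z = c * dbar u z := by
  simp only [dbar, fderiv_const_mul hu, _root_.smul_apply, smul_eq_mul]
  ring

theorem fderiv_conj_apply (hu : DifferentiableAt ℝ u z) (h : ℂ) :
    fderiv ℝ (fun z => conj (u z)) z h = conj (fderiv ℝ u z h) := by
  have := (conjCLE.toContinuousLinearMap.hasFDerivAt.comp z hu.hasFDerivAt).fderiv
  have h2 : (fun z => conj (u z)) = ⇑conjCLE.toContinuousLinearMap ∘ u := by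
    ext; simp
  rw [h2, this]; simp

theorem dbar_conj (hu : DifferentiableAt ℝ u z) :
    dbar (fun z => conj (u z)) z = conj (dd u z) := by
  simp only [dbar, dd, fderiv_conj_apply hu]
  simp [Complex.conj_ofNat]

theorem dd_conj (hu : DifferentiableAt ℝ u z) :
    dd (fun z => conj (u z)) z = conj (dbar u z) := by
  simp only [dbar, dd, fderiv_conj_apply hu]
  simp [Complex.conj_ofNat, sub_eq_add_neg]

theorem fderiv_real_apply (hu : DifferentiableAt ℂ u z) (h : ℂ) :
    fderiv ℝ u z h = h * deriv u z := by
  have := hu.hasFDerivAt.restrictScalars ℝ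
  rw [this.fderiv]
  have h1 : (fderiv ℂ u z) h = (fderiv ℂ u z) (h • 1) := by simp
  simp only [ContinuousLinearMap.coe_restrictScalars']
  rw [h1, map_smul]
  simp

theorem dbar_holo (hu : DifferentiableAt ℂ u z) : dbar u z = 0 := by
  simp only [dbar, fderiv_real_apply hu]
  linear_combination (deriv u z) / 2 * I_sq

theorem dd_holo (hu : DifferentiableAt ℂ u z) : dd u z = deriv u z := by
  simp only [dd, fderiv_real_apply hu]
  linear_combination (-deriv u z) / 2 * I_sq

theorem norm_dbar_le (u : ℂ → ℂ) (z : ℂ) : ‖dbar u z‖ ≤ ‖fderiv ℝ u z‖ := by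
  have h1 := (fderiv ℝ u z).le_opNorm 1
  have h2 := (fderiv ℝ u z).le_opNorm I
  simp only [norm_one, mul_one, norm_I] at h1 h2
  have h3 := norm_add_le (fderiv ℝ u z 1) (I * fderiv ℝ u z I)
  rw [norm_mul, norm_I, one_mul] at h3
  rw [dbar, norm_div, RCLike.norm_ofNat]
  linarith

theorem norm_fderiv_le_dd_dbar (u : ℂ → ℂ) (z : ℂ) :
    ‖fderiv ℝ u z‖ ≤ ‖dd u z‖ + ‖dbar u z‖ := by
  refine ContinuousLinearMap.opNorm_le_bound _ (by positivity) fun h => ?_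
  rw [fderiv_eq_dd_dbar]
  refine (norm_add_le _ _).trans ?_
  simp [add_mul]

end Wirtinger

section Integrals

theorem integral_fderiv_eq_zero {u : ℂ → ℂ} (hu : ContDiff ℝ 1 u) (hc : HasCompactSupport u)
    (v : ℂ) : ∫ z, fderiv ℝ u z v = 0 := by
  have h1 : Continuous (fun z => fderiv ℝ u z v) :=
    (hu.continuous_fderiv (by simp)).clm_apply continuous_const
  have h2 : HasCompactSupport (fun z => fderiv ℝ u z v) := hc.fderiv_apply (𝕜 := ℝ) v
  have := integral_mul_fderiv_eq_neg_fderiv_mul_of_integrable (μ := (volume : Measure ℂ))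
    (f := fun _ : ℂ => (1 : ℂ)) (g := u) (v := v) (by simp)
    (by simpa using h1.integrable_of_hasCompactSupport h2)
    (by simpa using hu.continuous.integrable_of_hasCompactSupport hc)
    (fun x _ => by fun_prop) (fun x _ => hu.differentiable (by simp) x)
  simpa using this

theorem continuous_dbar {u : ℂ → ℂ} (hu : ContDiff ℝ 1 u) : Continuous (dbar u) := by
  have h : ∀ v : ℂ, Continuous (fun z => fderiv ℝ u z v) := fun v =>
    (hu.continuous_fderiv (by simp)).clm_apply continuous_const
  have h1 := h 1
  have h2 := h I
  unfold dbar; fun_prop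

theorem continuous_dd {u : ℂ → ℂ} (hu : ContDiff ℝ 1 u) : Continuous (dd u) := by
  have h : ∀ v : ℂ, Continuous (fun z => fderiv ℝ u z v) := fun v =>
    (hu.continuous_fderiv (by simp)).clm_apply continuous_const
  have h1 := h 1
  have h2 := h I
  unfold dd; fun_prop

theorem support_dbar (u : ℂ → ℂ) : Function.support (dbar u) ⊆ tsupport u := by
  intro z hz
  by_contra h
  have : fderiv ℝ u z = 0 := image_eq_zero_of_notMem_tsupport
    (fun h' => h (tsupport_fderiv_subset ℝ h'))
  simp [dbar, this] at hz

theorem support_dd (u : ℂ → ℂ) : Function.support (dd u) ⊆ tsupport u := by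
  intro z hz
  by_contra h
  have : fderiv ℝ u z = 0 := image_eq_zero_of_notMem_tsupport
    (fun h' => h (tsupport_fderiv_subset ℝ h'))
  simp [dd, this] at hz

theorem hasCompactSupport_dbar {u : ℂ → ℂ} (hc : HasCompactSupport u) :
    HasCompactSupport (dbar u) :=
  hc.mono' (support_dbar u)

theorem hasCompactSupport_dd {u : ℂ → ℂ} (hc : HasCompactSupport u) :
    HasCompactSupport (dd u) :=
  hc.mono' (support_dd u)

theorem integrable_fderiv_apply {u : ℂ → ℂ} (hu : ContDiff ℝ 1 u) (hc : HasCompactSupport u)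
    (v : ℂ) : Integrable (fun z => fderiv ℝ u z v) :=
  ((hu.continuous_fderiv (by simp)).clm_apply continuous_const).integrable_of_hasCompactSupport
    (hc.fderiv_apply (𝕜 := ℝ) v)

theorem integral_dbar_eq_zero {u : ℂ → ℂ} (hu : ContDiff ℝ 1 u) (hc : HasCompactSupport u) :
    ∫ z, dbar u z = 0 := by
  simp only [dbar]
  rw [integral_div, integral_add (integrable_fderiv_apply hu hc 1)
    ((integrable_fderiv_apply hu hc I).const_mul I), integral_const_mul,
    integral_fderiv_eq_zero hu hc, integral_fderiv_eq_zero hu hc]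
  simp

theorem integral_dd_eq_zero {u : ℂ → ℂ} (hu : ContDiff ℝ 1 u) (hc : HasCompactSupport u) :
    ∫ z, dd u z = 0 := by
  simp only [dd]
  rw [integral_div, integral_sub (integrable_fderiv_apply hu hc 1)
    ((integrable_fderiv_apply hu hc I).const_mul I), integral_const_mul,
    integral_fderiv_eq_zero hu hc, integral_fderiv_eq_zero hu hc]
  simp

theorem one_of_smooth {u : ℂ → ℂ} (hu : ContDiff ℝ ∞ u) : ContDiff ℝ 1 u :=
  hu.of_le (by exact_mod_cast le_top)

theorem integrable_norm_sq {u : ℂ → ℂ} (hu : Continuous u) (hc : HasCompactSupport u) :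
    Integrable (fun z => ‖u z‖ ^ 2) :=
  (hu.norm.pow 2).integrable_of_hasCompactSupport
    (hc.mono' (fun z hz => subset_tsupport _ (fun h => hz (by simp [h]))))

theorem contDiff_fderiv_apply {u : ℂ → ℂ} (hu : ContDiff ℝ ∞ u) (v : ℂ) :
    ContDiff ℝ ∞ (fun z => fderiv ℝ u z v) :=
  (hu.fderiv_right (m := ∞) (by simp)).clm_apply contDiff_const

theorem contDiff_dbar {u : ℂ → ℂ} (hu : ContDiff ℝ ∞ u) : ContDiff ℝ ∞ (dbar u) := by
  have h1 := contDiff_fderiv_apply hu 1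
  have h2 := contDiff_fderiv_apply hu I
  unfold dbar; fun_prop

theorem contDiff_dd {u : ℂ → ℂ} (hu : ContDiff ℝ ∞ u) : ContDiff ℝ ∞ (dd u) := by
  have h1 := contDiff_fderiv_apply hu 1
  have h2 := contDiff_fderiv_apply hu I
  unfold dd; fun_prop

theorem fderiv_fderiv_comm {u : ℂ → ℂ} (hu : ContDiff ℝ ∞ u) (v w z : ℂ) :
    fderiv ℝ (fun z => fderiv ℝ u z v) z w = fderiv ℝ (fun z => fderiv ℝ u z w) z v := by
  have hd : DifferentiableAt ℝ (fderiv ℝ u) z :=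
    (hu.fderiv_right (m := ∞) (by simp)).differentiable (by simp) z
  have hs := (hu.contDiffAt (x := z)).isSymmSndFDerivAt (by
    simp only [minSmoothness_of_isRCLikeNormedField]
    exact WithTop.coe_le_coe.2 (le_top : (2 : ℕ∞) ≤ ⊤))
  have h1 : ∀ v w, fderiv ℝ (fun z => fderiv ℝ u z v) z w = fderiv ℝ (fderiv ℝ u) z w v := by
    intro v w
    rw [fderiv_clm_apply hd (by fun_prop)]
    simp
  rw [h1, h1]
  exact hs w v

theorem dd_dbar_comm {u : ℂ → ℂ} (hu : ContDiff ℝ ∞ u) (z : ℂ) :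
    dd (dbar u) z = dbar (dd u) z := by
  have h1 : ∀ v, DifferentiableAt ℝ (fun z => fderiv ℝ u z v) z := fun v =>
    (contDiff_fderiv_apply hu v).differentiable (by simp) z
  have e1 : ∀ w, fderiv ℝ (dbar u) z w = (fderiv ℝ (fun z => fderiv ℝ u z 1) z w
      + I * fderiv ℝ (fun z => fderiv ℝ u z I) z w) * (2⁻¹ : ℂ) := by
    intro w
    unfold dbar
    simp only [div_eq_mul_inv]
    rw [fderiv_mul_const (by have := h1 1; have := h1 I; fun_prop),
      fderiv_fun_add (h1 1) (by have := h1 I; fun_prop), fderiv_const_mul (h1 I)]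
    simp
    ring
  have e2 : ∀ w, fderiv ℝ (dd u) z w = (fderiv ℝ (fun z => fderiv ℝ u z 1) z w
      - I * fderiv ℝ (fun z => fderiv ℝ u z I) z w) * (2⁻¹ : ℂ) := by
    intro w
    unfold dd
    simp only [div_eq_mul_inv]
    rw [fderiv_mul_const (by have := h1 1; have := h1 I; fun_prop),
      fderiv_fun_sub (h1 1) (by have := h1 I; fun_prop), fderiv_const_mul (h1 I)]
    simp
    ring
  have e3 := fderiv_fderiv_comm hu 1 I z
  rw [dd, dbar, e1, e1, e2, e2, e3]
  ring

/-- Integration by parts: `dd` and `dbar` of a test function have the same `L²` norm. -/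
theorem integral_norm_dd_sq {u : ℂ → ℂ} (hu : ContDiff ℝ ∞ u) (hc : HasCompactSupport u) :
    ∫ z, ‖dd u z‖ ^ 2 = ∫ z, ‖dbar u z‖ ^ 2 := by
  have hu1 := one_of_smooth hu
  have c1 : ContDiff ℝ ∞ (fun z => conj (dd u z)) :=
    conjCLE.contDiff.comp (contDiff_dd hu)
  have c2 : ContDiff ℝ ∞ (fun z => conj (dbar u z)) :=
    conjCLE.contDiff.comp (contDiff_dbar hu)
  have k1 : ∫ z, dd (fun z => u z * conj (dd u z)) z = 0 :=
    integral_dd_eq_zero (one_of_smooth (hu.mul c1)) hc.mul_right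
  have k2 : ∫ z, dbar (fun z => u z * conj (dbar u z)) z = 0 :=
    integral_dbar_eq_zero (one_of_smooth (hu.mul c2)) hc.mul_right
  have key : ∀ z, dd (fun z => u z * conj (dd u z)) z - dbar (fun z => u z * conj (dbar u z)) z
      = ((‖dd u z‖ ^ 2 : ℝ) : ℂ) - ((‖dbar u z‖ ^ 2 : ℝ) : ℂ) := by
    intro z
    have d0 : DifferentiableAt ℝ u z := hu.differentiable (by simp) z
    have d1 := (contDiff_dd hu).differentiable (by simp) z
    have d2 := (contDiff_dbar hu).differentiable (by simp) z
    rw [dd_mul d0 (c1.differentiable (by simp) z), dbar_mul d0 (c2.differentiable (by simp) z),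
      dd_conj d1, dbar_conj d2, dd_dbar_comm hu]
    have n1 := Complex.mul_conj' (dd u z)
    have n2 := Complex.mul_conj' (dbar u z)
    push_cast
    linear_combination n1 - n2
  have i1 : Integrable (dd (fun z => u z * conj (dd u z))) :=
    (continuous_dd (one_of_smooth (hu.mul c1))).integrable_of_hasCompactSupport
      (hasCompactSupport_dd hc.mul_right)
  have i2 : Integrable (dbar (fun z => u z * conj (dbar u z))) :=
    (continuous_dbar (one_of_smooth (hu.mul c2))).integrable_of_hasCompactSupport
      (hasCompactSupport_dbar hc.mul_right)
  have j1 := integrable_norm_sq (continuous_dd hu1) (hasCompactSupport_dd hc)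
  have j2 := integrable_norm_sq (continuous_dbar hu1) (hasCompactSupport_dbar hc)
  have e : (∫ z, (((‖dd u z‖ ^ 2 : ℝ) : ℂ) - ((‖dbar u z‖ ^ 2 : ℝ) : ℂ))) = 0 := by
    simp_rw [← key]
    rw [integral_sub i1 i2, k1, k2, sub_zero]
  rw [integral_sub j1.ofReal j2.ofReal, integral_complex_ofReal, integral_complex_ofReal,
      sub_eq_zero] at e
  exact_mod_cast e

end Integrals

section Pompeiu

theorem locallyIntegrable_norm_inv : LocallyIntegrable (fun z : ℂ => ‖z‖⁻¹) := by
  have hball : ∀ R : ℝ, IntegrableOn (fun z : ℂ => ‖z‖⁻¹) (ball 0 R) := by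
    intro R
    have := (integrableOn_fun_norm_addHaar (E := ℂ) volume (f := fun r : ℝ => r⁻¹) (r := R)).2
      (by
        have : IntegrableOn (fun _ : ℝ => (1 : ℝ)) (Ioo 0 R) := by simp
        refine this.congr_fun (fun y hy => ?_) measurableSet_Ioo
        simp [Complex.finrank_real_complex, hy.1.ne'])
    exact this
  intro z
  exact ⟨ball 0 (‖z‖ + 1), isOpen_ball.mem_nhds (by simp), hball _⟩

/-- The fundamental solution of `∂/∂z̄`. -/
def cauchyKer (z : ℂ) : ℂ := (Real.pi : ℂ)⁻¹ * z⁻¹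

theorem measurable_cauchyKer : Measurable cauchyKer := by
  unfold cauchyKer; fun_prop

theorem norm_cauchyKer (z : ℂ) : ‖cauchyKer z‖ = Real.pi⁻¹ * ‖z‖⁻¹ := by
  simp [cauchyKer, abs_of_pos Real.pi_pos]

theorem locallyIntegrable_cauchyKer : LocallyIntegrable cauchyKer := by
  have h := locallyIntegrable_norm_inv.smul (Real.pi⁻¹)
  refine h.mono measurable_cauchyKer.aestronglyMeasurable (Filter.Eventually.of_forall fun z => ?_)
  simp [norm_cauchyKer, abs_of_pos Real.pi_pos]

theorem integrable_cauchyKer_mul {u : ℂ → ℂ} (hu : Continuous u) (hc : HasCompactSupport u) :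
    Integrable (fun z => cauchyKer z * u z) := by
  simpa [mul_comm] using
    locallyIntegrable_cauchyKer.integrable_smul_right_of_hasCompactSupport hu hc

theorem integral_dbar_mul_inv {u : ℂ → ℂ} (hu : ContDiff ℝ 1 u) (hc : HasCompactSupport u) :
    ∫ z, dbar u z * z⁻¹ = -Real.pi * u 0 := by
  let e : ℝ → ℂ := fun θ => Real.cos θ + Real.sin θ * I
  have he : Continuous e := by fun_prop
  have hen : ∀ θ, ‖e θ‖ = 1 := fun θ => by
    have : e θ = exp (θ * I) := by simp [e, Complex.exp_mul_I]
    rw [this, norm_exp_ofReal_mul_I]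
  have hec : ∀ θ, e θ * conj (e θ) = 1 := fun θ => by
    rw [Complex.mul_conj', hen]; simp
  let D1 : ℝ × ℝ → ℂ := fun p => fderiv ℝ u (p.1 * e p.2) (e p.2)
  let D2 : ℝ × ℝ → ℂ := fun p => fderiv ℝ u (p.1 * e p.2) (I * e p.2)
  have hfc : Continuous (fderiv ℝ u) := hu.continuous_fderiv (by simp)
  have hD1 : Continuous D1 := (hfc.comp (by fun_prop)).clm_apply (by fun_prop)
  have hD2 : Continuous D2 := (hfc.comp (by fun_prop)).clm_apply (by fun_prop)
  obtain ⟨R, hR0, hR⟩ := hc.isCompact.isBounded.subset_ball_lt 0 0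
  have hz : ∀ z : ℂ, R ≤ ‖z‖ → fderiv ℝ u z = 0 := by
    intro z hz
    apply image_eq_zero_of_notMem_tsupport
    intro h
    have := hR (tsupport_fderiv_subset ℝ h)
    simp at this; linarith
  have hz0 : ∀ z : ℂ, R ≤ ‖z‖ → u z = 0 := by
    intro z hz
    apply image_eq_zero_of_notMem_tsupport
    intro h
    have := hR h
    simp at this; linarith
  have hnorm : ∀ p : ℝ × ℝ, 0 < p.1 → ‖(p.1 : ℂ) * e p.2‖ = p.1 := fun p hp => by
    rw [norm_mul, hen, mul_one, norm_real, Real.norm_of_nonneg hp.le]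
  have h_intg : ∀ D : ℝ × ℝ → ℂ, Continuous D → (∀ p : ℝ × ℝ, R ≤ p.1 → D p = 0) →
      IntegrableOn D (Ioi (0 : ℝ) ×ˢ Ioo (-Real.pi) Real.pi) := by
    intro D hD hD0
    have h1 : IntegrableOn D (Icc 0 R ×ˢ Icc (-Real.pi) Real.pi) :=
      hD.continuousOn.integrableOn_compact (isCompact_Icc.prod isCompact_Icc)
    refine h1.of_forall_sdiff_eq_zero (measurableSet_Ioi.prod measurableSet_Ioo) ?_
    rintro ⟨r, θ⟩ ⟨⟨h1, h2⟩, h3⟩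
    apply hD0
    by_contra h4
    exact h3 ⟨⟨(le_of_lt h1), (not_le.1 h4).le⟩, ⟨h2.1.le, h2.2.le⟩⟩
  have hz1 : ∀ p : ℝ × ℝ, R ≤ p.1 → D1 p = 0 := fun p hp => by
    simp only [D1]; rw [hz _ (by rw [hnorm p (hR0.trans_le hp)]; exact hp)]; rfl
  have hz2 : ∀ p : ℝ × ℝ, R ≤ p.1 → D2 p = 0 := fun p hp => by
    simp only [D2]; rw [hz _ (by rw [hnorm p (hR0.trans_le hp)]; exact hp)]; rfl
  have hi1 := h_intg D1 hD1 hz1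
  have hi2 := h_intg D2 hD2 hz2
  rw [← Complex.integral_comp_polarCoord_symm]
  have step : ∀ p ∈ (Ioi (0 : ℝ) ×ˢ Ioo (-Real.pi) Real.pi),
      p.1 • (dbar u (Complex.polarCoord.symm p) * (Complex.polarCoord.symm p)⁻¹)
      = (D1 p + I * D2 p) / 2 := by
    rintro ⟨r, θ⟩ ⟨h1, h2⟩
    have hr : (r : ℂ) ≠ 0 := by exact_mod_cast (ne_of_gt h1)
    have he0 : e θ ≠ 0 := fun h => by simpa [h] using hen θ
    have hei : (e θ)⁻¹ = conj (e θ) := inv_eq_of_mul_eq_one_right (hec θ)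
    simp only [Complex.polarCoord_symm_apply, D1, D2, fderiv_eq_dd_dbar]
    change r • (dbar u (r * e θ) * (r * e θ)⁻¹) = _
    rw [mul_inv, hei, Complex.real_smul]
    simp only [map_mul, conj_I]
    field_simp
    linear_combination (-dd u (r * e θ) * e θ + dbar u (r * e θ) * conj (e θ)) * I_sq
  change (∫ p in (Ioi (0 : ℝ) ×ˢ Ioo (-Real.pi) Real.pi), _) = _
  rw [setIntegral_congr_fun (measurableSet_Ioi.prod measurableSet_Ioo) step, integral_div,
    integral_add hi1 (hi2.const_mul I), integral_const_mul]
  have hv : (volume : Measure (ℝ × ℝ)) = (volume : Measure ℝ).prod volume := rfl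
  have J1 : ∫ p in (Ioi (0 : ℝ) ×ˢ Ioo (-Real.pi) Real.pi), D1 p = -(2 * Real.pi) * u 0 := by
    rw [hv] at hi1 ⊢
    have hsw : ∫ p in (Ioi (0 : ℝ) ×ˢ Ioo (-Real.pi) Real.pi), D1 p ∂(volume.prod volume) =
        ∫ θ in Ioo (-Real.pi) Real.pi, ∫ r in Ioi (0 : ℝ), D1 (r, θ) := by
      rw [← Measure.prod_restrict, integral_prod_symm]
      rw [Measure.prod_restrict]; exact hi1
    rw [hsw]
    have : ∀ θ, ∫ r in Ioi (0 : ℝ), D1 (r, θ) = - u 0 := by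
      intro θ
      have hd : ∀ r ∈ Ici (0 : ℝ), HasDerivAt (fun r : ℝ => u (r * e θ)) (D1 (r, θ)) r := by
        intro r _
        have h1 : HasDerivAt (fun r : ℝ => (r : ℂ) * e θ) (1 * e θ) r :=
          (ofRealCLM.hasDerivAt (x := r)).mul_const (e θ)
        have h2 := ((hu.differentiable (by simp) (r * e θ)).hasFDerivAt).comp_hasDerivAt r h1
        exact h2.congr_deriv (by simp [D1])
      have hiI : IntegrableOn (fun r => D1 (r, θ)) (Ioi 0) := by
        have h1 : IntegrableOn (fun r => D1 (r, θ)) (Icc 0 R) :=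
          (hD1.comp (by fun_prop : Continuous fun r : ℝ => (r,
              θ))).continuousOn.integrableOn_compact
            isCompact_Icc
        refine h1.of_forall_sdiff_eq_zero measurableSet_Ioi ?_
        rintro r ⟨h1, h3⟩
        apply hz1
        by_contra h4
        exact h3 ⟨(le_of_lt h1), (not_le.1 h4).le⟩
      have := integral_Ioi_of_hasDerivAt_of_tendsto' hd hiI (m := 0) (by
        refine tendsto_const_nhds.congr' ?_
        filter_upwards [Filter.eventually_ge_atTop R] with r hr
        rw [hz0 _ (by rw [hnorm (r, θ) (hR0.trans_le hr)]; exact hr)])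
      simpa using this
    simp_rw [this]
    rw [setIntegral_const, Measure.real, Real.volume_Ioo,
      ENNReal.toReal_ofReal (by linarith [Real.pi_pos]), Complex.real_smul]
    push_cast
    ring
  have J2 : ∫ p in (Ioi (0 : ℝ) ×ˢ Ioo (-Real.pi) Real.pi), D2 p = 0 := by
    rw [hv] at hi2 ⊢
    rw [setIntegral_prod _ hi2]
    have : ∀ r ∈ Ioi (0 : ℝ), ∫ θ in Ioo (-Real.pi) Real.pi, D2 (r, θ) = 0 := by
      intro r hr
      have hd : ∀ θ ∈ uIcc (-Real.pi) Real.pi,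
          HasDerivAt (fun θ : ℝ => u (r * e θ)) (r * D2 (r, θ)) θ := by
        intro θ _
        have h0 : HasDerivAt e (I * e θ) θ := by
          have hc := (Real.hasDerivAt_cos θ).ofReal_comp
          have hs := ((Real.hasDerivAt_sin θ).ofReal_comp).mul_const I
          refine (hc.add hs).congr_deriv ?_
          simp only [e]; push_cast
          linear_combination (-Complex.sin θ) * I_sq
        have h1 := h0.const_mul (r : ℂ)
        have h2 := ((hu.differentiable (by simp) (r * e θ)).hasFDerivAt).comp_hasDerivAt θ h1
        refine h2.congr_deriv ?_
        simp only [D2]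
        rw [show (r : ℂ) * (I * e θ) = r • (I * e θ) from (Complex.real_smul).symm, map_smul,
          Complex.real_smul]
      have hcont : Continuous (fun θ => (r : ℂ) * D2 (r, θ)) :=
        continuous_const.mul (hD2.comp (by fun_prop))
      have h3 := intervalIntegral.integral_eq_sub_of_hasDerivAt hd
        (hcont.intervalIntegrable _ _)
      have h4 : e Real.pi = e (-Real.pi) := by simp [e]
      rw [h4, sub_self, intervalIntegral.integral_of_le (by linarith [Real.pi_pos]),
        integral_const_mul, integral_Ioc_eq_integral_Ioo] at h3
      exact (mul_eq_zero.1 h3).resolve_left (by exact_mod_cast (ne_of_gt hr))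
    rw [setIntegral_congr_fun measurableSet_Ioi this]
    simp
  rw [J1, J2]
  ring

/-- The Cauchy transform. -/
def cauchyT (ρ : ℂ → ℂ) (z : ℂ) : ℂ := ∫ t, cauchyKer t * ρ (z - t)

theorem dbar_comp_sub (u : ℂ → ℂ) (z a : ℂ) : dbar (fun z => u (z - a)) z = dbar u (z - a) := by
  simp [dbar, fderiv_comp_sub]

/-- The Cauchy–Pompeiu formula for compactly supported functions. -/
theorem cauchyT_dbar {u : ℂ → ℂ} (hu : ContDiff ℝ 1 u) (hc : HasCompactSupport u) (z : ℂ) :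
    cauchyT (dbar u) z = u z := by
  have h1 : ContDiff ℝ 1 (fun t => u (t - (-z))) := by fun_prop
  have h2 : HasCompactSupport (fun t => u (t - (-z))) :=
    hc.comp_homeomorph (Homeomorph.subRight (-z))
  have h3 := integral_dbar_mul_inv h1 h2
  have hpi : (Real.pi : ℂ) ≠ 0 := by exact_mod_cast Real.pi_ne_zero
  rw [cauchyT, ← integral_neg_eq_self]
  have : (fun t => cauchyKer (-t) * dbar u (z - -t)) = fun t =>
      -(Real.pi : ℂ)⁻¹ * (dbar (fun t => u (t - (-z))) t * t⁻¹) := by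
    ext t
    rw [dbar_comp_sub, cauchyKer, inv_neg, sub_neg_eq_add, sub_neg_eq_add, add_comm z t]
    ring
  rw [this, integral_const_mul, h3]
  field_simp
  simp

theorem cauchyT_eq_conv (ρ : ℂ → ℂ) :
    cauchyT ρ = convolution cauchyKer ρ (ContinuousLinearMap.mul ℝ ℂ) volume := by
  ext z; simp [cauchyT, convolution]

theorem contDiff_cauchyT {ρ : ℂ → ℂ} (hu : ContDiff ℝ ∞ ρ) (hc : HasCompactSupport ρ) :
    ContDiff ℝ ∞ (cauchyT ρ) := by
  rw [cauchyT_eq_conv]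
  exact hc.contDiff_convolution_right _ locallyIntegrable_cauchyKer hu

theorem fderiv_cauchyT {ρ : ℂ → ℂ} (hu : ContDiff ℝ 1 ρ) (hc : HasCompactSupport ρ) (z v : ℂ) :
    fderiv ℝ (cauchyT ρ) z v = ∫ t, cauchyKer t * fderiv ℝ ρ (z - t) v := by
  rw [cauchyT_eq_conv, (hc.hasFDerivAt_convolution_right _ locallyIntegrable_cauchyKer hu z).fderiv,
    convolution_precompR_apply _ locallyIntegrable_cauchyKer (hc.fderiv ℝ)
      (hu.continuous_fderiv (by simp))]
  simp [convolution]

theorem integrable_cauchyKer_mul_sub {u : ℂ → ℂ} (hu : Continuous u) (hc : HasCompactSupport u)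
    (z : ℂ) : Integrable (fun t => cauchyKer t * u (z - t)) :=
  integrable_cauchyKer_mul (by fun_prop) (hc.comp_homeomorph (Homeomorph.subLeft z))

theorem dbar_cauchyT {ρ : ℂ → ℂ} (hu : ContDiff ℝ 1 ρ) (hc : HasCompactSupport ρ) (z : ℂ) :
    dbar (cauchyT ρ) z = ρ z := by
  have hi : ∀ v : ℂ, Integrable (fun t => cauchyKer t * fderiv ℝ ρ (z - t) v) := fun v =>
    integrable_cauchyKer_mul_sub (u := fun z => fderiv ℝ ρ z v)
      ((hu.continuous_fderiv (by simp)).clm_apply continuous_const) (hc.fderiv_apply (𝕜 := ℝ) v) z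
  rw [← cauchyT_dbar hu hc z, dbar, fderiv_cauchyT hu hc, fderiv_cauchyT hu hc,
    ← integral_const_mul, ← integral_add (hi 1) ((hi I).const_mul I), ← integral_div, cauchyT]
  congr 1
  ext t
  rw [dbar]; ring

theorem cauchyT_eq_integral_sub (ρ : ℂ → ℂ) (z : ℂ) :
    cauchyT ρ z = ∫ ζ, cauchyKer (z - ζ) * ρ ζ := by
  rw [cauchyT, ← integral_sub_left_eq_self _ volume z]
  simp

end Pompeiu

section Weyl

theorem exists_bump {Ω : Set ℂ} (hΩ : IsOpen Ω) {z₀ : ℂ} (hz : z₀ ∈ Ω) :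
    ∃ r > 0, ball z₀ r ⊆ Ω ∧ ∃ η : ℂ → ℂ, TestFn Ω η ∧ ∀ z ∈ ball z₀ r, η z = 1 := by
  obtain ⟨R, hR, hR'⟩ := Metric.isOpen_iff.1 hΩ z₀ hz
  let b : ContDiffBump z₀ := ⟨R / 4, R / 2, by positivity, by linarith⟩
  refine ⟨R / 4, by positivity, (ball_subset_ball (by linarith)).trans hR',
    fun z => (b z : ℂ), ⟨?_, ?_, ?_⟩, ?_⟩
  · exact ofRealCLM.contDiff.comp b.contDiff
  · exact b.hasCompactSupport.comp_left (g := fun x : ℝ => (x : ℂ)) (by simp)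
  · have h1 : tsupport (fun z => (b z : ℂ)) ⊆ tsupport b :=
      closure_mono (fun z hz h => hz (by simp [h]))
    refine h1.trans ?_
    rw [b.tsupport_eq]
    exact (closedBall_subset_ball (by simp only [b]; linarith)).trans hR'
  · intro z hz
    have := b.one_of_mem_closedBall (ball_subset_closedBall hz)
    simp [this]

theorem TestFn.mono {Ω Ω' : Set ℂ} {χ : ℂ → ℂ} (h : TestFn Ω χ) (hs : Ω ⊆ Ω') : TestFn Ω' χ :=
  ⟨h.smooth, h.cpt, h.sub.trans hs⟩

theorem TestFn.zero_of_notMem {Ω : Set ℂ} {χ : ℂ → ℂ} (h : TestFn Ω χ) {z : ℂ} (hz : z ∉ Ω) :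
    χ z = 0 := image_eq_zero_of_notMem_tsupport (fun h' => hz (h.sub h'))

/-- Multiplying a test function by a function smooth on `Ω` gives a test function. -/
theorem TestFn.mul_smooth {Ω : Set ℂ} (hΩ : IsOpen Ω) {χ v : ℂ → ℂ} (h : TestFn Ω χ)
    (hv : ContDiffOn ℝ ∞ v Ω) : TestFn Ω (fun z => χ z * v z) := by
  refine ⟨?_, h.cpt.mul_right, (tsupport_mul_subset_left (f := χ)).trans h.sub⟩
  rw [contDiff_iff_contDiffAt]
  intro z
  by_cases hz : z ∈ tsupport χ
  · exact h.smooth.contDiffAt.mul (hv.contDiffAt (hΩ.mem_nhds (h.sub hz)))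
  · have h1 : (fun z => χ z * v z) =ᶠ[𝓝 z] fun _ => 0 := by
      filter_upwards [notMem_tsupport_iff_eventuallyEq.1 hz] with y hy
      simp [hy]
    exact contDiffAt_const.congr_of_eventuallyEq h1

theorem TestFn.dbar {Ω : Set ℂ} {χ : ℂ → ℂ} (h : TestFn Ω χ) : TestFn Ω (dbar χ) :=
  ⟨contDiff_dbar h.smooth, hasCompactSupport_dbar h.cpt,
    (closure_minimal (support_dbar χ) (isClosed_tsupport _)).trans h.sub⟩

theorem TestFn.dd {Ω : Set ℂ} {χ : ℂ → ℂ} (h : TestFn Ω χ) : TestFn Ω (dd χ) :=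
  ⟨contDiff_dd h.smooth, hasCompactSupport_dd h.cpt,
    (closure_minimal (support_dd χ) (isClosed_tsupport _)).trans h.sub⟩

theorem TestFn.differentiable {Ω : Set ℂ} {χ : ℂ → ℂ} (h : TestFn Ω χ) : Differentiable ℝ χ :=
  h.smooth.differentiable (by simp)

/-- The mass of the Cauchy kernel on the unit disc. -/
def kerMass : ℝ := ∫ t in ball (0 : ℂ) 1, ‖cauchyKer t‖

theorem integrableOn_norm_cauchyKer : IntegrableOn (fun t => ‖cauchyKer t‖) (ball (0 : ℂ) 1) :=
  ((locallyIntegrable_cauchyKer.integrableOn_isCompact (isCompact_closedBall 0 1)).mono_set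
    ball_subset_closedBall).norm

theorem cauchyKer_mul_bound {h : ℂ → ℂ} {B : ℝ} (hi : Integrable h) (hb : ∀ z, ‖h z‖ ≤ B)
    (ζ : ℂ) : Integrable (fun z => cauchyKer (ζ - z) * h z) ∧
      ∫ z, ‖cauchyKer (ζ - z) * h z‖ ≤ B * kerMass + ∫ z, ‖h z‖ := by
  let k₁ : ℂ → ℝ := (ball (0 : ℂ) 1).indicator fun t => ‖cauchyKer t‖
  have hk₁ : Integrable k₁ := (integrable_indicator_iff measurableSet_ball).2
    integrableOn_norm_cauchyKer
  have hk₁' : Integrable (fun z => B * k₁ (ζ - z)) := (hk₁.comp_sub_left ζ).const_mul B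
  have hbd : ∀ z, ‖cauchyKer (ζ - z) * h z‖ ≤ B * k₁ (ζ - z) + ‖h z‖ := by
    intro z
    rw [norm_mul]
    by_cases hz : ζ - z ∈ ball (0 : ℂ) 1
    · simp only [k₁, indicator_of_mem hz]
      have := mul_le_mul_of_nonneg_left (hb z) (norm_nonneg (cauchyKer (ζ - z)))
      nlinarith [norm_nonneg (h z)]
    · simp only [k₁, indicator_of_notMem hz]
      have h1 : ‖cauchyKer (ζ - z)‖ ≤ 1 := by
        rw [norm_cauchyKer, ← mul_inv]
        apply inv_le_one_of_one_le₀
        have h2 : 1 ≤ ‖ζ - z‖ := by simpa using hz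
        nlinarith [Real.pi_gt_three]
      have := mul_le_mul_of_nonneg_right h1 (norm_nonneg (h z))
      linarith
  have h_intg : Integrable (fun z => cauchyKer (ζ - z) * h z) := by
    refine (hk₁'.add hi.norm).mono' ?_ (Filter.Eventually.of_forall hbd)
    exact ((measurable_cauchyKer.comp (by fun_prop)).aestronglyMeasurable).mul
      hi.aestronglyMeasurable
  refine ⟨h_intg, ?_⟩
  calc ∫ z, ‖cauchyKer (ζ - z) * h z‖ ≤ ∫ z, (B * k₁ (ζ - z) + ‖h z‖) :=
        integral_mono h_intg.norm (hk₁'.add hi.norm) hbd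
    _ = B * kerMass + ∫ z, ‖h z‖ := by
        rw [integral_add hk₁' hi.norm, integral_const_mul, integral_sub_left_eq_self k₁ volume ζ,
          integral_indicator measurableSet_ball]
        rfl

theorem cauchyKer_fubini {g h : ℂ → ℂ} {B : ℝ} (hg : Integrable g) (hi : Integrable h)
    (hb : ∀ z, ‖h z‖ ≤ B) :
    ∫ ζ, g ζ * ∫ z, cauchyKer (ζ - z) * h z = ∫ z, (∫ ζ, g ζ * cauchyKer (ζ - z)) * h z := by
  have hm : AEStronglyMeasurable (fun p : ℂ × ℂ => g p.1 * (cauchyKer (p.1 - p.2) * h p.2))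
      (volume.prod volume) :=
    (hg.aestronglyMeasurable.comp_fst).mul
      ((measurable_cauchyKer.comp (by fun_prop)).aestronglyMeasurable.mul
        hi.aestronglyMeasurable.comp_snd)
  have hp : Integrable (fun p : ℂ × ℂ => g p.1 * (cauchyKer (p.1 - p.2) * h p.2))
      (volume.prod volume) := by
    rw [integrable_prod_iff hm]
    refine ⟨Filter.Eventually.of_forall fun ζ =>
      ((cauchyKer_mul_bound hi hb ζ).1.const_mul (g ζ)), ?_⟩
    refine (hg.norm.mul_const (B * kerMass + ∫ z, ‖h z‖)).mono'
      hm.norm.integral_prod_right' (Filter.Eventually.of_forall fun ζ => ?_)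
    simp only [norm_mul (g ζ)]
    rw [integral_const_mul, norm_mul, norm_norm, Real.norm_of_nonneg (by positivity)]
    exact mul_le_mul_of_nonneg_left (cauchyKer_mul_bound hi hb ζ).2 (norm_nonneg _)
  calc ∫ ζ, g ζ * ∫ z, cauchyKer (ζ - z) * h z
      = ∫ ζ, ∫ z, g ζ * (cauchyKer (ζ - z) * h z) := by simp_rw [integral_const_mul]
    _ = ∫ z, ∫ ζ, g ζ * (cauchyKer (ζ - z) * h z) := integral_integral_swap hp
    _ = _ := by
      congr 1; ext z
      rw [← integral_mul_const]
      simp_rw [mul_assoc]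

theorem differentiableOn_cauchy_integral {g : ℂ → ℂ} (hg : Integrable g) {z₀ : ℂ} {r : ℝ}
    (h0 : ∀ z ∈ ball z₀ r, g z = 0) :
    DifferentiableOn ℂ (fun z => ∫ ζ, g ζ * cauchyKer (ζ - z)) (ball z₀ r) := by
  intro z hz
  apply DifferentiableAt.differentiableWithinAt
  obtain ⟨δ, hδ, hsub⟩ := Metric.isOpen_iff.1 isOpen_ball z hz
  have key := hasDerivAt_integral_of_dominated_loc_of_deriv_le (𝕜 := ℂ) (μ := volume)
    (F := fun z ζ => g ζ * cauchyKer (ζ - z)) (x₀ := z) (s := ball z (δ / 2))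
    (F' := fun z ζ => g ζ * ((Real.pi : ℂ)⁻¹ * (((ζ - z) ^ 2)⁻¹)))
    (bound := fun ζ => ‖g ζ‖ * (Real.pi⁻¹ * ((δ / 2) ^ 2)⁻¹)) (ball_mem_nhds z (by positivity))
  have hfar : ∀ y ∈ ball z (δ / 2), ∀ ζ, g ζ ≠ 0 → δ / 2 ≤ ‖ζ - y‖ := by
    intro y hy ζ hζ
    by_contra hlt
    apply hζ
    apply h0
    apply hsub
    rw [mem_ball, dist_eq_norm] at hy ⊢
    have := norm_sub_le_norm_sub_add_norm_sub ζ y z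
    linarith [not_le.1 hlt]
  have hmeas : ∀ y, AEStronglyMeasurable (fun ζ => g ζ * cauchyKer (ζ - y)) := fun y =>
    hg.aestronglyMeasurable.mul (measurable_cauchyKer.comp (by fun_prop)).aestronglyMeasurable
  refine (key (Filter.Eventually.of_forall hmeas) ?_ ?_ ?_
      (hg.norm.mul_const _) ?_).2.differentiableAt
  · refine (hg.norm.mul_const (Real.pi⁻¹ * (δ / 2)⁻¹)).mono' (hmeas z)
      (Filter.Eventually.of_forall fun ζ => ?_)
    by_cases hζ : g ζ = 0
    · simp [hζ]
    · rw [norm_mul, norm_cauchyKer]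
      have := hfar z (mem_ball_self (by positivity)) ζ hζ
      gcongr
  · exact hg.aestronglyMeasurable.mul (Measurable.aestronglyMeasurable (by fun_prop))
  · refine Filter.Eventually.of_forall fun ζ y hy => ?_
    by_cases hζ : g ζ = 0
    · simp [hζ]
    · rw [norm_mul, norm_mul, norm_inv, norm_inv, norm_pow, norm_real,
        Real.norm_of_nonneg Real.pi_pos.le]
      have := hfar y hy ζ hζ
      gcongr
  · refine Filter.Eventually.of_forall fun ζ y hy => ?_
    by_cases hζ : g ζ = 0
    · simpa [hζ] using hasDerivAt_const y (0 : ℂ)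
    · have h1 := hfar y hy ζ hζ
      have h2 : ζ - y ≠ 0 := fun h => by rw [h, norm_zero] at h1; linarith
      have h3 : HasDerivAt (fun y => ζ - y) (-1) y := by
        simpa using (hasDerivAt_id y).const_sub ζ
      have h4 := ((h3.inv h2).const_mul ((Real.pi : ℂ)⁻¹)).const_mul (g ζ)
      refine h4.congr_deriv ?_
      simp

theorem weyl_local {Ω : Set ℂ} (hΩ : IsOpen Ω) {f : ℂ → ℂ} (hf : LocallyIntegrable f)
    (h : ∀ χ, TestFn Ω χ → ∫ z, f z * dbar χ z = 0) {z₀ : ℂ} (hz : z₀ ∈ Ω) :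
    ∃ r > 0, ∃ F : ℂ → ℂ, ball z₀ r ⊆ Ω ∧ DifferentiableOn ℂ F (ball z₀ r) ∧
      ∀ᵐ z, z ∈ ball z₀ r → f z = F z := by
  obtain ⟨r, hr, hrΩ, η, hη, hη1⟩ := exists_bump hΩ hz
  let g : ℂ → ℂ := fun z => f z * dbar η z
  have hg : Integrable g := by
    have := hf.integrable_smul_right_of_hasCompactSupport hη.dbar.smooth.continuous hη.dbar.cpt
    simpa [g, mul_comm] using this
  have hg0 : ∀ z ∈ ball z₀ r, g z = 0 := by
    intro z hz
    have h1 : η =ᶠ[𝓝 z] fun _ => 1 := by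
      filter_upwards [isOpen_ball.mem_nhds hz] with y hy using hη1 y hy
    have : fderiv ℝ η z = 0 := by rw [h1.fderiv_eq]; simp
    simp [g, dbar, this]
  let F : ℂ → ℂ := fun z => -∫ ζ, g ζ * cauchyKer (ζ - z)
  have hF : DifferentiableOn ℂ F (ball z₀ r) := (differentiableOn_cauchy_integral hg hg0).neg
  refine ⟨r, hr, F, hrΩ, hF, ?_⟩
  have hmain : ∀ ρ : ℂ → ℂ, TestFn (ball z₀ r) ρ → ∫ z, (f z - F z) * ρ z = 0 := by
    intro ρ hρ
    obtain ⟨B, hB⟩ := hρ.smooth.continuous.bounded_above_of_compact_support hρ.cpt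
    have hρi := hρ.smooth.continuous.integrable_of_hasCompactSupport (μ := volume) hρ.cpt
    have h1 := h _ (hη.mul_smooth hΩ (contDiff_cauchyT hρ.smooth hρ.cpt).contDiffOn)
    have h2 : ∀ z, f z * dbar (fun z => η z * cauchyT ρ z) z = f z * ρ z + g z * cauchyT ρ z := by
      intro z
      rw [dbar_mul (hη.differentiable z)
        ((contDiff_cauchyT hρ.smooth hρ.cpt).differentiable (by simp) z),
        dbar_cauchyT (one_of_smooth hρ.smooth) hρ.cpt]
      simp only [g]
      by_cases hz : z ∈ ball z₀ r
      · rw [hη1 z hz]; ring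
      · rw [hρ.zero_of_notMem hz]; ring
    simp_rw [h2] at h1
    have i1 : Integrable (fun z => f z * ρ z) := by
      have := hf.integrable_smul_right_of_hasCompactSupport hρ.smooth.continuous hρ.cpt
      simpa [mul_comm] using this
    have i2 : Integrable (fun z => g z * cauchyT ρ z) := by
      obtain ⟨C, hC⟩ : ∃ C, ∀ z, ‖cauchyT ρ z‖ ≤ C := by
        refine ⟨B * kerMass + ∫ z, ‖ρ z‖, fun z => ?_⟩
        rw [cauchyT_eq_integral_sub]
        exact (norm_integral_le_integral_norm _).trans (cauchyKer_mul_bound hρi hB z).2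
      exact hg.mul_bdd (c := C) ((contDiff_cauchyT hρ.smooth hρ.cpt).continuous.aestronglyMeasurable)
        (Filter.Eventually.of_forall hC)
    rw [integral_add i1 i2] at h1
    have h3 : ∫ z, g z * cauchyT ρ z = ∫ z, (∫ ζ, g ζ * cauchyKer (ζ - z)) * ρ z := by
      simp_rw [cauchyT_eq_integral_sub]
      exact cauchyKer_fubini hg hρi hB
    have i3 : Integrable (fun z => F z * ρ z) := by
      have := (hρ.mul_smooth isOpen_ball (v := F)
        ((hF.contDiffOn isOpen_ball).restrict_scalars ℝ))
      simpa [mul_comm] using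
        this.smooth.continuous.integrable_of_hasCompactSupport (μ := volume) this.cpt
    simp_rw [sub_mul]
    rw [integral_sub i1 i3]
    simp only [F, neg_mul]
    rw [integral_neg, ← h3]
    linear_combination h1
  have hloc : LocallyIntegrableOn (fun z => f z - F z) (ball z₀ r) :=
    (hf.locallyIntegrableOn _).sub (hF.continuousOn.locallyIntegrableOn measurableSet_ball)
  have := isOpen_ball.ae_eq_zero_of_integral_contDiff_smul_eq_zero hloc (μ := volume) (by
    intro ψ hψ hψc hψs
    have := hmain (fun z => (ψ z : ℂ)) ⟨ofRealCLM.contDiff.comp hψ,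
      hψc.comp_left (g := fun x : ℝ => (x : ℂ)) (by simp),
      (show tsupport (fun z => (ψ z : ℂ)) ⊆ tsupport ψ from
        closure_mono (fun z hz h => hz (by simp [h]))).trans hψs⟩
    rw [← this]
    congr 1; ext z
    rw [Complex.real_smul, mul_comm])
  filter_upwards [this] with z hz h
  exact sub_eq_zero.1 (hz h)

/-- Weyl's lemma for `∂/∂z̄`. -/
theorem weyl {Ω : Set ℂ} (hΩ : IsOpen Ω) {f : ℂ → ℂ} (hf : LocallyIntegrable f)
    (h : ∀ χ, TestFn Ω χ → ∫ z, f z * dbar χ z = 0) :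
    ∃ F : ℂ → ℂ, DifferentiableOn ℂ F Ω ∧ ∀ᵐ z, z ∈ Ω → f z = F z := by
  have H := fun z₀ : Ω => weyl_local hΩ hf h z₀.2
  choose r hr F hsub hF hfF using H
  classical
  let G : ℂ → ℂ := fun z => if hz : z ∈ Ω then F ⟨z, hz⟩ z else 0
  have hG : ∀ z₀ : Ω, ∀ z ∈ ball (z₀ : ℂ) (r z₀), G z = F z₀ z := by
    intro z₀ z hz
    have hzΩ := hsub z₀ hz
    simp only [G, dif_pos hzΩ]
    set U := ball z (r ⟨z, hzΩ⟩) ∩ ball (z₀ : ℂ) (r z₀) with hU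
    have hUo : IsOpen U := isOpen_ball.inter isOpen_ball
    have hae : F ⟨z, hzΩ⟩ =ᵐ[volume.restrict U] F z₀ := by
      rw [Filter.EventuallyEq, ae_restrict_iff' hUo.measurableSet]
      filter_upwards [hfF ⟨z, hzΩ⟩, hfF z₀] with y h1 h2 hy
      rw [← h1 hy.1, h2 hy.2]
    have := Measure.eqOn_open_of_ae_eq hae hUo
      ((hF ⟨z, hzΩ⟩).continuousOn.mono inter_subset_left)
      ((hF z₀).continuousOn.mono inter_subset_right)
    exact this ⟨mem_ball_self (hr _), hz⟩
  refine ⟨G, ?_, ?_⟩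
  · intro z hz
    have h1 := (hF ⟨z, hz⟩).differentiableAt (ball_mem_nhds z (hr _))
    refine (h1.congr_of_eventuallyEq ?_).differentiableWithinAt
    filter_upwards [ball_mem_nhds z (hr ⟨z, hz⟩)] with y hy using hG ⟨z, hz⟩ y hy
  · have : volume {z | ¬ (z ∈ Ω → f z = G z)} = 0 := by
      apply measure_null_of_locally_null
      intro z hz
      simp only [Classical.not_imp, mem_ofPred_eq] at hz
      refine ⟨{y | ¬ (y ∈ Ω → f y = G y)} ∩ ball z (r ⟨z, hz.1⟩), ?_, ?_⟩
      · exact Filter.inter_mem self_mem_nhdsWithin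
          (mem_nhdsWithin_of_mem_nhds (ball_mem_nhds z (hr _)))
      · refine measure_mono_null ?_ (hfF ⟨z, hz.1⟩)
        rintro y ⟨h1, h2⟩ h3
        exact h1 (fun _ => (h3 h2).trans (hG ⟨z, hz.1⟩ y h2).symm)
    exact this

end Weyl

section Density

theorem bergmanFun_iff {Ω : Set ℂ} (hΩ : IsOpen Ω) {f : ℂ → ℂ} :
    BergmanFun Ω f ↔ DifferentiableOn ℂ f Ω ∧ MemLp f 2 (volume.restrict Ω) := by
  refine and_congr_right fun hf => ?_
  exact (memLp_two_iff_integrable_sq_norm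
    (hf.continuousOn.aestronglyMeasurable hΩ.measurableSet)).symm

theorem TestFn.memLp {Ω : Set ℂ} {χ : ℂ → ℂ} (h : TestFn Ω χ) (p : ℝ≥0∞) : MemLp χ p volume :=
  h.smooth.continuous.memLp_of_hasCompactSupport h.cpt

theorem testFn_zero (Ω : Set ℂ) : TestFn Ω (fun _ => 0) :=
  ⟨contDiff_const, by simp [HasCompactSupport, tsupport, Function.support],
    by simp [tsupport, Function.support]⟩

theorem TestFn.add {Ω : Set ℂ} {χ ψ : ℂ → ℂ} (h : TestFn Ω χ) (h' : TestFn Ω ψ) :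
    TestFn Ω (fun z => χ z + ψ z) :=
  ⟨h.smooth.add h'.smooth, h.cpt.add h'.cpt,
    (tsupport_add χ ψ).trans (union_subset h.sub h'.sub)⟩

theorem TestFn.const_mul {Ω : Set ℂ} {χ : ℂ → ℂ} (c : ℂ) (h : TestFn Ω χ) :
    TestFn Ω (fun z => c * χ z) :=
  ⟨contDiff_const.mul h.smooth, h.cpt.mul_left, (tsupport_mul_subset_right).trans h.sub⟩

theorem TestFn.sub' {Ω : Set ℂ} {χ ψ : ℂ → ℂ} (h : TestFn Ω χ) (h' : TestFn Ω ψ) :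
    TestFn Ω (fun z => χ z - ψ z) := by
  simpa [sub_eq_add_neg] using h.add (h'.const_mul (-1))

/-- The space of `∂/∂z̄` derivatives of test functions, in `L²`. -/
def dbarSpace (Ω : Set ℂ) : Submodule ℂ (Lp ℂ 2 (volume : Measure ℂ)) where
  carrier := {φ | ∃ χ, TestFn Ω χ ∧ φ =ᵐ[volume] dbar χ}
  zero_mem' := ⟨fun _ => 0, testFn_zero Ω, by
    filter_upwards [Lp.coeFn_zero ℂ 2 (volume : Measure ℂ)] with z hz
    rw [hz]; simp [dbar]⟩
  add_mem' := by
    rintro φ ψ ⟨χ, h1, h2⟩ ⟨χ', h1', h2'⟩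
    refine ⟨_, h1.add h1', ?_⟩
    filter_upwards [Lp.coeFn_add φ ψ, h2, h2'] with z hz h3 h4
    rw [hz, Pi.add_apply, h3, h4, dbar_add (h1.differentiable z) (h1'.differentiable z)]
  smul_mem' := by
    rintro c φ ⟨χ, h1, h2⟩
    refine ⟨_, h1.const_mul c, ?_⟩
    filter_upwards [Lp.coeFn_smul c φ, h2] with z hz h3
    rw [hz, Pi.smul_apply, h3, dbar_const_mul c (h1.differentiable z), smul_eq_mul]

/-- An `L²` function on `Ω` annihilating the Bergman space is a limit of `∂χ/∂z̄`. -/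
theorem exists_testFn_tendsto {Ω : Set ℂ} (hΩ : IsOpen Ω) {g : ℂ → ℂ} (hg : MemLp g 2 volume)
    (hg0 : EqOn g 0 Ωᶜ) (h : ∀ f, BergmanFun Ω f → ∫ z in Ω, f z * g z = 0) :
    ∃ χ : ℕ → ℂ → ℂ, (∀ n, TestFn Ω (χ n)) ∧
      Filter.Tendsto (fun n => eLpNorm (dbar (χ n) - g) 2 volume) Filter.atTop (𝓝 0) := by
  have hmem : hg.toLp g ∈ (dbarSpace Ω)ᗮᗮ := by
    rw [Submodule.mem_orthogonal]
    intro k hk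
    rw [Submodule.mem_orthogonal] at hk
    let k' : ℂ → ℂ := Ω.indicator fun z => conj (k z)
    have hk' : MemLp k' 2 volume := by
      refine MemLp.indicator hΩ.measurableSet ?_
      exact (Lp.memLp k).star
    have hweak : ∀ χ, TestFn Ω χ → ∫ z, k' z * dbar χ z = 0 := by
      intro χ hχ
      have h1 := hk _ (show (hχ.dbar.memLp 2).toLp (dbar χ) ∈ dbarSpace Ω from
        ⟨χ, hχ, (hχ.dbar.memLp 2).coeFn_toLp⟩)
      rw [L2.inner_def] at h1
      have h2 : ∫ z, conj (k' z * dbar χ z) = 0 := by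
        rw [← h1]
        refine integral_congr_ae ?_
        filter_upwards [(hχ.dbar.memLp 2).coeFn_toLp] with z hz
        rw [hz]
        by_cases hzΩ : z ∈ Ω
        · simp [k', hzΩ, mul_comm]
        · simp [k', hzΩ, hχ.dbar.zero_of_notMem hzΩ]
      rw [integral_conj] at h2
      simpa using h2
    obtain ⟨F, hF, hFk⟩ := weyl hΩ (hk'.locallyIntegrable (by norm_num)) hweak
    have hFk' : F =ᵐ[volume.restrict Ω] k' := by
      rw [Filter.EventuallyEq, ae_restrict_iff' hΩ.measurableSet]
      filter_upwards [hFk] with z hz hz' using (hz hz').symm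
    have hFB : BergmanFun Ω F :=
      (bergmanFun_iff hΩ).2 ⟨hF, (hk'.restrict Ω).ae_eq hFk'.symm⟩
    rw [L2.inner_def, ← h F hFB, ← integral_indicator hΩ.measurableSet]
    refine integral_congr_ae ?_
    filter_upwards [hFk, hg.coeFn_toLp] with z hz hz2
    rw [hz2]
    by_cases hzΩ : z ∈ Ω
    · simp only [indicator_of_mem hzΩ, ← hz hzΩ]
      simp [k', hzΩ, mul_comm]
    · simp [hzΩ, hg0 hzΩ]
  rw [Submodule.orthogonal_orthogonal_eq_closure, ← SetLike.mem_coe,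
    Submodule.topologicalClosure_coe, mem_closure_iff_seq_limit] at hmem
  obtain ⟨x, hx, hlim⟩ := hmem
  choose χ hχ hxχ using hx
  refine ⟨χ, hχ, ?_⟩
  rw [Lp.tendsto_Lp_iff_tendsto_eLpNorm] at hlim
  refine hlim.congr fun n => eLpNorm_congr_ae ?_
  filter_upwards [hxχ n] with z hz
  simp [hz]

theorem eLpNorm_dd {u : ℂ → ℂ} (hu : ContDiff ℝ ∞ u) (hc : HasCompactSupport u) :
    eLpNorm (dd u) 2 volume = eLpNorm (dbar u) 2 volume := by
  rw [((continuous_dd (one_of_smooth hu)).memLp_of_hasCompactSupport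
      (hasCompactSupport_dd hc)).eLpNorm_eq_integral_rpow_norm (by simp) (by simp),
    ((continuous_dbar (one_of_smooth hu)).memLp_of_hasCompactSupport
      (hasCompactSupport_dbar hc)).eLpNorm_eq_integral_rpow_norm (by simp) (by simp)]
  simp only [ENNReal.toReal_ofNat, Real.rpow_ofNat]
  rw [integral_norm_dd_sq hu hc]

theorem eLpNorm_fderiv_le {u : ℂ → ℂ} (hu : ContDiff ℝ ∞ u) (hc : HasCompactSupport u) :
    eLpNorm (fderiv ℝ u) 2 volume ≤ 2 * eLpNorm (dbar u) 2 volume := by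
  have h1 := (continuous_dd (one_of_smooth hu)).aestronglyMeasurable (μ := volume)
  have h2 := (continuous_dbar (one_of_smooth hu)).aestronglyMeasurable (μ := volume)
  calc eLpNorm (fderiv ℝ u) 2 volume
      ≤ eLpNorm (fun z => ‖dd u z‖ + ‖dbar u z‖) 2 volume :=
        eLpNorm_mono fun z => (norm_fderiv_le_dd_dbar u z).trans (le_abs_self _)
    _ ≤ eLpNorm (fun z => ‖dd u z‖) 2 volume + eLpNorm (fun z => ‖dbar u z‖) 2 volume :=
        eLpNorm_add_le h1.norm h2.norm (by norm_num)
    _ = _ := by rw [eLpNorm_norm, eLpNorm_norm, eLpNorm_dd hu hc, two_mul]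

/-- A Gagliardo–Nirenberg–Sobolev inequality for functions whose derivative lives on a set of
finite measure. -/
theorem exists_sobolev_const : ∃ C : ℝ≥0, 0 < C ∧ ∀ (u : ℂ → ℂ) (S : Set ℂ), ContDiff ℝ ∞ u →
    HasCompactSupport u → (∀ z ∉ S, fderiv ℝ u z = 0) →
    eLpNorm u 2 volume ≤ C * volume S ^ (2⁻¹ : ℝ) * eLpNorm (dbar u) 2 volume := by
  refine ⟨2 * (eLpNormLESNormFDerivOneConst (E := ℂ) volume (2 : ℝ≥0) + 1), by positivity, ?_⟩
  intro u S hu hc hS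
  set D := eLpNormLESNormFDerivOneConst (E := ℂ) volume (2 : ℝ≥0) with hD
  have hh : NNReal.HolderConjugate (Module.finrank ℝ ℂ : ℝ≥0) 2 := by
    rw [Complex.finrank_real_complex]
    constructor <;> norm_num
  have h1 : eLpNorm u 2 volume ≤ D * eLpNorm (fderiv ℝ u) 1 volume :=
    eLpNorm_le_eLpNorm_fderiv_one volume (one_of_smooth hu) hc hh
  have hcont := (one_of_smooth hu).continuous_fderiv (by simp)
  have h2 : eLpNorm (fderiv ℝ u) 1 volume ≤
      eLpNorm (fderiv ℝ u) 2 volume * volume S ^ (2⁻¹ : ℝ) := by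
    set T := toMeasurable volume S with hT
    have hTm : MeasurableSet T := measurableSet_toMeasurable _ _
    have e1 : fderiv ℝ u = T.indicator (fderiv ℝ u) := by
      symm; rw [indicator_eq_self]
      intro z hz
      by_contra h
      exact hz (hS z fun h' => h (subset_toMeasurable _ _ h'))
    calc eLpNorm (fderiv ℝ u) 1 volume = eLpNorm (fderiv ℝ u) 1 (volume.restrict T) := by
          conv_lhs => rw [e1]
          exact eLpNorm_indicator_eq_eLpNorm_restrict hTm
      _ ≤ eLpNorm (fderiv ℝ u) 2 (volume.restrict T) *
            (volume.restrict T) univ ^ (1 / (1 : ℝ≥0∞).toReal - 1 / (2 : ℝ≥0∞).toReal) :=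
          eLpNorm_le_eLpNorm_mul_rpow_measure_univ (by norm_num) hcont.aestronglyMeasurable
      _ ≤ _ := by
          rw [Measure.restrict_apply_univ, hT, measure_toMeasurable]
          have : (1 / (1 : ℝ≥0∞).toReal - 1 / (2 : ℝ≥0∞).toReal) = 2⁻¹ := by norm_num
          rw [this]
          gcongr
          exact Measure.restrict_le_self
  calc eLpNorm u 2 volume ≤ D * (2 * eLpNorm (dbar u) 2 volume * volume S ^ (2⁻¹ : ℝ)) := by
        refine h1.trans ?_
        gcongr
        refine h2.trans ?_
        gcongr
        exact eLpNorm_fderiv_le hu hc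
    _ = (2 * (D : ℝ≥0∞)) * volume S ^ (2⁻¹ : ℝ) * eLpNorm (dbar u) 2 volume := by ring
    _ ≤ _ := by
        push_cast
        gcongr
        exact le_self_add

theorem exists_limit_of_dominated {f h : ℕ → ℂ → ℂ} {g : ℂ → ℂ} {c : ℝ≥0∞} (hc : c ≠ ⊤)
    (hf : ∀ n, MemLp (f n) 2 volume) (hh : ∀ n, MemLp (h n) 2 volume) (hg : MemLp g 2 volume)
    (hle : ∀ n m, eLpNorm (f n - f m) 2 volume ≤ c * eLpNorm (h n - h m) 2 volume)
    (hlim : Filter.Tendsto (fun n => eLpNorm (h n - g) 2 volume) Filter.atTop (𝓝 0)) :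
    ∃ u, MemLp u 2 volume ∧
      Filter.Tendsto (fun n => eLpNorm (f n - u) 2 volume) Filter.atTop (𝓝 0) := by
  have h1 := ((Lp.tendsto_Lp_iff_tendsto_eLpNorm'' h hh g hg).2 hlim).cauchySeq
  rw [Lp.cauchySeq_Lp_iff_cauchySeq_eLpNorm] at h1
  have h2 : CauchySeq (fun n => (hf n).toLp (f n)) := by
    rw [Lp.cauchySeq_Lp_iff_cauchySeq_eLpNorm]
    refine tendsto_of_tendsto_of_tendsto_of_le_of_le tendsto_const_nhds
      (h := fun n : ℕ × ℕ => c * eLpNorm (h n.1 - h n.2) 2 volume) ?_ (fun _ => zero_le)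
      (fun n => ?_)
    · have := ENNReal.Tendsto.const_mul (a := c) h1 (Or.inr hc)
      rw [mul_zero] at this
      refine this.congr fun n => ?_
      congr 1
      exact eLpNorm_congr_ae (((hh n.1).coeFn_toLp).sub ((hh n.2).coeFn_toLp))
    · refine le_trans (le_of_eq ?_) (hle n.1 n.2)
      exact eLpNorm_congr_ae (((hf n.1).coeFn_toLp).sub ((hf n.2).coeFn_toLp))
  obtain ⟨u, hu⟩ := cauchySeq_tendsto_of_complete h2
  refine ⟨u, Lp.memLp u, ?_⟩
  rw [← Lp.tendsto_Lp_iff_tendsto_eLpNorm'' f hf u (Lp.memLp u), Lp.toLp_coeFn]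
  exact hu

/-- A sequence of test functions converging, with its first derivatives, in `L²`. -/
structure TestSeq (Ω : Set ℂ) (χ : ℕ → ℂ → ℂ) (u g v : ℂ → ℂ) : Prop where
  test : ∀ n, TestFn Ω (χ n)
  memu : MemLp u 2 volume
  memg : MemLp g 2 volume
  memv : MemLp v 2 volume
  limu : Filter.Tendsto (fun n => eLpNorm (χ n - u) 2 volume) Filter.atTop (𝓝 0)
  limg : Filter.Tendsto (fun n => eLpNorm (dbar (χ n) - g) 2 volume) Filter.atTop (𝓝 0)
  limv : Filter.Tendsto (fun n => eLpNorm (dd (χ n) - v) 2 volume) Filter.atTop (𝓝 0)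

theorem dbar_sub {u v : ℂ → ℂ} {z : ℂ} (hu : DifferentiableAt ℝ u z)
    (hv : DifferentiableAt ℝ v z) : dbar (fun z => u z - v z) z = dbar u z - dbar v z := by
  simp only [dbar, fderiv_fun_sub hu hv, _root_.sub_apply]
  ring

theorem dd_sub {u v : ℂ → ℂ} {z : ℂ} (hu : DifferentiableAt ℝ u z)
    (hv : DifferentiableAt ℝ v z) : dd (fun z => u z - v z) z = dd u z - dd v z := by
  simp only [dd, fderiv_fun_sub hu hv, _root_.sub_apply]
  ring

theorem exists_testSeq {Ω : Set ℂ} (hΩ : IsOpen Ω) (hA : volume Ω < ⊤) {g : ℂ → ℂ}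
    (hg : MemLp g 2 volume)
    (hg0 : EqOn g 0 Ωᶜ) (h : ∀ f, BergmanFun Ω f → ∫ z in Ω, f z * g z = 0) :
    ∃ χ u v, TestSeq Ω χ u g v := by
  obtain ⟨χ, hχ, hlim⟩ := exists_testFn_tendsto hΩ hg hg0 h
  obtain ⟨C, -, hC⟩ := exists_sobolev_const
  have e1 : ∀ n m, dbar (χ n) - dbar (χ m) = dbar (fun z => χ n z - χ m z) := fun n m => by
    ext z; rw [dbar_sub ((hχ n).differentiable z) ((hχ m).differentiable z)]; rfl
  have e2 : ∀ n m, dd (χ n) - dd (χ m) = dd (fun z => χ n z - χ m z) := fun n m => by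
    ext z; rw [dd_sub ((hχ n).differentiable z) ((hχ m).differentiable z)]; rfl
  obtain ⟨u, hu, hu'⟩ := exists_limit_of_dominated (f := χ) (h := fun n => dbar (χ n)) (g := g)
    (c := C * volume Ω ^ (2⁻¹ : ℝ))
    (ENNReal.mul_ne_top (by simp) (ENNReal.rpow_ne_top_of_nonneg (by norm_num) hA.ne))
    (fun n => (hχ n).memLp 2) (fun n => (hχ n).dbar.memLp 2) hg (fun n m => by
      have h3 := (hχ n).sub' (hχ m)
      rw [e1]
      refine hC _ Ω h3.smooth h3.cpt fun z hz => ?_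
      apply image_eq_zero_of_notMem_tsupport
      exact fun h => hz (h3.sub (tsupport_fderiv_subset ℝ h))) hlim
  obtain ⟨v, hv, hv'⟩ := exists_limit_of_dominated (f := fun n => dd (χ n))
    (h := fun n => dbar (χ n)) (g := g) (c := 1) (by simp)
    (fun n => (hχ n).dd.memLp 2) (fun n => (hχ n).dbar.memLp 2) hg (fun n m => by
      have h3 := (hχ n).sub' (hχ m)
      rw [e1, e2, one_mul, eLpNorm_dd h3.smooth h3.cpt]) hlim
  exact ⟨χ, u, v, hχ, hu, hg, hv, hu', hlim, hv'⟩

end Density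

section Bump

theorem DifferentiableOn.contDiffOn_real {Ω : Set ℂ} (hΩ : IsOpen Ω) {f : ℂ → ℂ}
    (hf : DifferentiableOn ℂ f Ω) : ContDiffOn ℝ ∞ f Ω :=
  (hf.contDiffOn (n := ∞) hΩ).restrict_scalars ℝ

theorem TestFn.integrable {Ω : Set ℂ} {χ : ℂ → ℂ} (h : TestFn Ω χ) : Integrable χ :=
  memLp_one_iff_integrable.1 (h.memLp 1)

theorem setIntegral_eq_of_testFn {Ω : Set ℂ} {χ : ℂ → ℂ} (h : TestFn Ω χ) (f : ℂ → ℂ) :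
    ∫ z in Ω, f z * χ z = ∫ z, f z * χ z :=
  setIntegral_eq_integral_of_forall_compl_eq_zero fun z hz => by
    rw [h.zero_of_notMem hz, mul_zero]

theorem dbar_mul_holo {Ω : Set ℂ} (hΩ : IsOpen Ω) {χ f : ℂ → ℂ} (h : TestFn Ω χ)
    (hf : DifferentiableOn ℂ f Ω) (z : ℂ) : dbar (fun z => χ z * f z) z = f z * dbar χ z := by
  by_cases hz : z ∈ Ω
  · have h1 := hf.differentiableAt (hΩ.mem_nhds hz)
    have := dbar_mul (h.differentiable z) (h1.restrictScalars ℝ)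
    rw [dbar_holo h1, mul_zero, zero_add] at this
    exact this
  · rw [(h.mul_smooth hΩ (hf.contDiffOn_real hΩ)).dbar.zero_of_notMem hz,
      h.dbar.zero_of_notMem hz, mul_zero]

theorem dd_mul_holo {Ω : Set ℂ} (hΩ : IsOpen Ω) {χ f : ℂ → ℂ} (h : TestFn Ω χ)
    (hf : DifferentiableOn ℂ f Ω) (z : ℂ) :
    dd (fun z => χ z * f z) z = deriv f z * χ z + f z * dd χ z := by
  by_cases hz : z ∈ Ω
  · have h1 := hf.differentiableAt (hΩ.mem_nhds hz)
    have := dd_mul (h.differentiable z) (h1.restrictScalars ℝ)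
    rw [dd_holo h1] at this
    rw [mul_comm (deriv f z)]
    exact this
  · rw [(h.mul_smooth hΩ (hf.contDiffOn_real hΩ)).dd.zero_of_notMem hz,
      h.dd.zero_of_notMem hz, h.zero_of_notMem hz, mul_zero, mul_zero, add_zero]

theorem exists_testFn_eval {Ω : Set ℂ} (hΩ : IsOpen Ω) {w : ℂ} (hw : w ∈ Ω) :
    ∃ b, TestFn Ω b ∧ ∀ f, DifferentiableOn ℂ f Ω → ∫ z in Ω, f z * b z = f w := by
  obtain ⟨r, hr, hrΩ, η, hη, hη1⟩ := exists_bump hΩ hw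
  have hdη : ∀ z ∈ ball w r, dbar η z = 0 := fun z hz => by
    have : η =ᶠ[𝓝 z] fun _ => (1 : ℂ) := by
      filter_upwards [isOpen_ball.mem_nhds hz] with y hy using hη1 y hy
    simp [dbar, this.fderiv_eq]
  have h1 : TestFn (Ω \ {w}) (dbar η) := by
    refine ⟨hη.dbar.smooth, hη.dbar.cpt, fun z hz => ⟨hη.dbar.sub hz, ?_⟩⟩
    rintro rfl
    refine (notMem_tsupport_iff_eventuallyEq.2 ?_) hz
    filter_upwards [ball_mem_nhds z hr] with y hy using hdη y hy
  have h2 : ContDiffOn ℝ ∞ (fun ζ => cauchyKer (w - ζ)) (Ω \ {w}) := by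
    refine DifferentiableOn.contDiffOn_real (hΩ.sdiff isClosed_singleton) fun ζ hζ => ?_
    have : w - ζ ≠ 0 := sub_ne_zero.2 fun h => hζ.2 h.symm
    unfold cauchyKer
    fun_prop (disch := assumption)
  have h3 := (h1.mul_smooth (hΩ.sdiff isClosed_singleton) h2).mono sdiff_subset
  refine ⟨_, h3, fun f hf => ?_⟩
  rw [setIntegral_eq_of_testFn h3]
  have h4 := hη.mul_smooth hΩ (hf.contDiffOn_real hΩ)
  have h5 := cauchyT_dbar (one_of_smooth h4.smooth) h4.cpt w
  rw [hη1 w (mem_ball_self hr), one_mul, cauchyT_eq_integral_sub] at h5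
  rw [← h5]
  congr 1 with z
  rw [dbar_mul_holo hΩ hη hf]
  ring

theorem integral_mul_dd {Ω : Set ℂ} (hΩ : IsOpen Ω) {b f : ℂ → ℂ} (h : TestFn Ω b)
    (hf : DifferentiableOn ℂ f Ω) :
    ∫ z in Ω, f z * (-1 * dd b z) = ∫ z in Ω, deriv f z * b z := by
  rw [setIntegral_eq_of_testFn h, setIntegral_eq_of_testFn (h.dd.const_mul (-1))]
  have h1 := h.mul_smooth hΩ (hf.contDiffOn_real hΩ)
  have h2 := h.mul_smooth hΩ ((hf.deriv hΩ).contDiffOn_real hΩ)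
  have h3 := h.dd.mul_smooth hΩ (hf.contDiffOn_real hΩ)
  have h0 := integral_dd_eq_zero (one_of_smooth h1.smooth) h1.cpt
  have e : dd (fun z => b z * f z) = fun z => b z * deriv f z + dd b z * f z := by
    ext z
    rw [dd_mul_holo hΩ h hf]
    ring
  rw [e, integral_add h2.integrable h3.integrable] at h0
  have e1 : ∫ z, f z * (-1 * dd b z) = - ∫ z, dd b z * f z := by
    rw [← integral_neg]
    congr 1 with z
    ring
  rw [e1, ← eq_neg_of_add_eq_zero_left h0]
  congr 1 with z
  rw [mul_comm]

theorem exists_testFn_iteratedDeriv {Ω : Set ℂ} (hΩ : IsOpen Ω) {w : ℂ} (hw : w ∈ Ω) (k : ℕ) :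
    ∃ b, TestFn Ω b ∧ ∀ f, DifferentiableOn ℂ f Ω →
      ∫ z in Ω, f z * b z = iteratedDerivWithin k f Ω w := by
  induction k with
  | zero => simpa using exists_testFn_eval hΩ hw
  | succ k ih =>
    obtain ⟨b, hb, h⟩ := ih
    refine ⟨_, hb.dd.const_mul (-1), fun f hf => ?_⟩
    rw [integral_mul_dd hΩ hb hf, h _ (hf.deriv hΩ), iteratedDerivWithin_succ']
    exact (iteratedDerivWithin_congr (fun z hz => derivWithin_of_isOpen hΩ hz) hw).symm

theorem TestFn.sum {Ω : Set ℂ} {ι : Type*} (s : Finset ι) {χ : ι → ℂ → ℂ}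
    (h : ∀ i ∈ s, TestFn Ω (χ i)) : TestFn Ω (fun z => ∑ i ∈ s, χ i z) := by
  classical
  induction s using Finset.induction_on with
  | empty => simpa using testFn_zero Ω
  | insert a s ha ih =>
    simp only [Finset.sum_insert ha]
    exact (h a (Finset.mem_insert_self a s)).add (ih fun i hi => h i (Finset.mem_insert_of_mem hi))

theorem integrable_mul_testFn {Ω : Set ℂ} (hΩ : IsOpen Ω) {χ f : ℂ → ℂ} (h : TestFn Ω χ)
    (hf : ContDiffOn ℝ ∞ f Ω) : Integrable (fun z => f z * χ z) := by
  exact (h.mul_smooth hΩ hf).integrable.congr (ae_of_all _ fun z => mul_comm _ _)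

theorem exists_testFn_quadrature {Ω : Set ℂ} (hΩ : IsOpen Ω) (hq : IsQuadratureDomain Ω) :
    ∃ b, TestFn Ω b ∧ ∀ f, BergmanFun Ω f → ∫ z in Ω, f z = ∫ z in Ω, f z * b z := by
  obtain ⟨N, -, w, n, c, hw, h⟩ := hq
  choose b hb hbf using fun (j : Fin N) (k : ℕ) => exists_testFn_iteratedDeriv hΩ (hw j) k
  refine ⟨fun z => ∑ j, ∑ k ∈ Finset.range (n j + 1), c j k * b j k z,
    TestFn.sum _ fun j _ => TestFn.sum _ fun k _ => (hb j k).const_mul _, fun f hf => ?_⟩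
  rw [h f hf]
  have hi := fun j k => (integrable_mul_testFn hΩ ((hb j k).const_mul (c j k))
    (hf.1.contDiffOn_real hΩ)).integrableOn (s := Ω)
  simp_rw [Finset.mul_sum]
  rw [integral_finsetSum _ fun j _ => integrable_finsetSum _ fun k _ => hi j k]
  refine Finset.sum_congr rfl fun j _ => ?_
  rw [integral_finsetSum _ fun k _ => hi j k]
  refine Finset.sum_congr rfl fun k _ => ?_
  rw [← hbf j k f hf.1, ← integral_const_mul]
  congr 1 with z
  ring

end Bump

section DeGiorgi

theorem exists_eq_zero_of_iteration {A B : ℝ → ℝ} {C r₀ : ℝ} (hC : 1 ≤ C) (hA : ∀ r, 0 ≤ A r)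
    (hB : ∀ r, 0 ≤ B r) (hAmono : Antitone A)
    (h1 : ∀ r ≥ r₀, ∀ ρ > 0, B (r + ρ) ≤ C * A r * (B r / ρ + A r))
    (h2 : ∀ r ≥ r₀, ∀ ρ > 0, A (r + ρ) ^ 2 ≤ C / ρ * A r * B r)
    (limA : Filter.Tendsto A Filter.atTop (𝓝 0)) (limB : Filter.Tendsto B Filter.atTop (𝓝 0)) :
    ∃ R, A R = 0 := by
  set δ : ℝ := 1 / (256 * C ^ 2) with hδ
  have hδ0 : 0 < δ := by positivity
  have hδC : 256 * C ^ 2 * δ = 1 := by rw [hδ]; field_simp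
  set β : ℝ := 16 * C * δ ^ 2 with hβ
  have hβ0 : 0 < β := by positivity
  obtain ⟨r, hr1, hr2, hr3⟩ := ((limA.eventually (gt_mem_nhds hδ0)).and
    ((limB.eventually (gt_mem_nhds hβ0)).and (Filter.eventually_ge_atTop r₀))).exists
  let R : ℕ → ℝ := fun k => r + 2 - 2 * (1 / 2) ^ k
  have hR : ∀ k, R (k + 1) = R k + (1 / 2) ^ k := fun k => by simp only [R, pow_succ]; ring
  have hRr : ∀ k, r ≤ R k := fun k => by
    have : (1 / 2 : ℝ) ^ k ≤ 1 := pow_le_one₀ (by norm_num) (by norm_num)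
    simp only [R]; linarith
  have key : ∀ k, A (R k) ≤ δ * (1 / 4) ^ k ∧ B (R k) ≤ β * (1 / 8) ^ k := by
    intro k
    induction k with
    | zero => simpa [R] using ⟨hr1.le, hr2.le⟩
    | succ k ih =>
      obtain ⟨ihA, ihB⟩ := ih
      set t : ℝ := (1 / 2) ^ k with ht
      have ht0 : 0 < t := by positivity
      have e4 : (1 / 4 : ℝ) ^ k = t ^ 2 := by rw [ht, ← pow_mul, mul_comm, pow_mul]; norm_num
      have e8 : (1 / 8 : ℝ) ^ k = t ^ 3 := by rw [ht, ← pow_mul, mul_comm, pow_mul]; norm_num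
      have ht1 : t ≤ 1 := pow_le_one₀ (by norm_num) (by norm_num)
      rw [hR, pow_succ, pow_succ, e4, e8]
      rw [e4] at ihA
      rw [e8] at ihB
      have g1 := h1 (R k) (hr3.trans (hRr k)) t ht0
      have g2 := h2 (R k) (hr3.trans (hRr k)) t ht0
      have f1 : C * A (R k) * (B (R k) / t + A (R k)) ≤
          C * (δ * t ^ 2) * (β * t ^ 3 / t + δ * t ^ 2) := by
        have := hA (R k); have := hB (R k); gcongr
      have f2 : C / t * A (R k) * B (R k) ≤ C / t * (δ * t ^ 2) * (β * t ^ 3) := by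
        have := hA (R k); have := hB (R k); gcongr
      have f3 : C * (δ * t ^ 2) * (β * t ^ 3 / t + δ * t ^ 2) = C * δ * (β + δ) * t ^ 4 := by
        field_simp
      have f4 : C / t * (δ * t ^ 2) * (β * t ^ 3) = C * δ * β * t ^ 4 := by
        field_simp
      have hCδ : 16 * (C * δ) ≤ 1 := by nlinarith
      constructor
      · refine (sq_le_sq₀ (hA _) (by positivity)).1 ?_
        refine (g2.trans f2).trans ?_
        rw [f4, hβ]
        have : C * δ * (16 * C * δ ^ 2) = (256 * C ^ 2 * δ) * (δ ^ 2 / 16) := by ring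
        rw [this, hδC]
        apply le_of_eq; ring
      · refine (g1.trans f1).trans ?_
        rw [f3]
        have e5 : C * δ * (β + δ) ≤ β / 8 := by
          have : C * δ * β ≤ β / 16 := by nlinarith
          have : C * δ * δ = β / 16 := by rw [hβ]; ring
          nlinarith
        calc C * δ * (β + δ) * t ^ 4 ≤ β / 8 * t ^ 3 := by
              have : t ^ 4 ≤ t ^ 3 := pow_le_pow_of_le_one ht0.le ht1 (by norm_num)
              gcongr
          _ = β * (t ^ 3 * (1 / 8)) := by ring
  refine ⟨r + 2, le_antisymm ?_ (hA _)⟩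
  have hl : Filter.Tendsto (fun k : ℕ => δ * (1 / 4 : ℝ) ^ k) Filter.atTop (𝓝 0) := by
    simpa using (tendsto_pow_atTop_nhds_zero_of_lt_one (by norm_num)
      (by norm_num : (1 / 4 : ℝ) < 1)).const_mul δ
  refine ge_of_tendsto' hl fun k => (hAmono ?_).trans (key k).1
  have : (0 : ℝ) < (1 / 2) ^ k := by positivity
  simp only [R]; linarith

end DeGiorgi

section Bounded

theorem tendsto_eLpNorm_restrict {f : ℕ → ℂ → ℂ} {g : ℂ → ℂ} (hf : ∀ n, MemLp (f n) 2 volume)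
    (hg : MemLp g 2 volume)
    (hlim : Filter.Tendsto (fun n => eLpNorm (f n - g) 2 volume) Filter.atTop (𝓝 0)) (T : Set ℂ) :
    Filter.Tendsto (fun n => eLpNorm (f n) 2 (volume.restrict T)) Filter.atTop
      (𝓝 (eLpNorm g 2 (volume.restrict T))) := by
  have h1 : Filter.Tendsto (fun n => eLpNorm (f n - g) 2 (volume.restrict T)) Filter.atTop
      (𝓝 0) :=
    tendsto_of_tendsto_of_tendsto_of_le_of_le tendsto_const_nhds hlim (fun _ => zero_le)
      fun n => eLpNorm_mono_measure _ Measure.restrict_le_self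
  have h2 := (Lp.tendsto_Lp_iff_tendsto_eLpNorm'' f (fun n => (hf n).restrict T) g
    (hg.restrict T)).2 h1
  have h3 := (continuous_enorm.tendsto _).comp h2
  simpa only [Function.comp_def, Lp.enorm_toLp] using h3

theorem tendsto_measure_superlevel (ν : Measure ℂ) [IsFiniteMeasure ν] {ℓ : ℂ → ℝ}
    (hℓ : Measurable ℓ) : Filter.Tendsto (fun r : ℝ => ν {z | r < ℓ z}) Filter.atTop (𝓝 0) := by
  have h := tendsto_measure_iInter_atTop (μ := ν) (s := fun r : ℝ => {z | r < ℓ z})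
    (fun r => (measurableSet_lt measurable_const hℓ).nullMeasurableSet)
    (fun r s hrs z hz => lt_of_le_of_lt hrs hz) ⟨0, measure_ne_top _ _⟩
  have h2 : (⋂ r : ℝ, {z | r < ℓ z}) = ∅ := by
    rw [eq_empty_iff_forall_notMem]
    intro z hz
    exact lt_irrefl (ℓ z) (mem_iInter.1 hz (ℓ z))
  rw [h2, measure_empty] at h
  exact h

theorem tendsto_eLpNorm_superlevel {u : ℂ → ℂ} (hu : MemLp u 2 volume) {ℓ : ℂ → ℝ}
    (hℓ : Measurable ℓ) : Filter.Tendsto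
      (fun r : ℝ => eLpNorm u 2 (volume.restrict {z | r < ℓ z})) Filter.atTop (𝓝 0) := by
  have hfin : ∫⁻ z, ‖u z‖ₑ ^ (2 : ℝ) ≠ ⊤ := by
    have := lintegral_rpow_enorm_lt_top_of_eLpNorm_lt_top (by norm_num) (by norm_num) hu.2
    simpa using this.ne
  have : IsFiniteMeasure (volume.withDensity fun z => ‖u z‖ₑ ^ (2 : ℝ)) :=
    isFiniteMeasure_withDensity hfin
  have h := tendsto_measure_superlevel (volume.withDensity fun z => ‖u z‖ₑ ^ (2 : ℝ)) hℓ
  have h2 := (ENNReal.continuous_rpow_const (y := (1 / 2 : ℝ))).tendsto 0 |>.comp h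
  rw [ENNReal.zero_rpow_of_pos (by norm_num)] at h2
  refine h2.congr fun r => ?_
  rw [eLpNorm_eq_lintegral_rpow_enorm_toReal (by norm_num) (by norm_num)]
  simp only [Function.comp_apply, ENNReal.toReal_ofNat]
  rw [withDensity_apply _ (measurableSet_lt measurable_const hℓ)]

theorem exists_cutoff (ℓ : ℂ →L[ℝ] ℝ) : ∃ L : ℝ≥0, 0 < L ∧ ∀ r : ℝ, ∀ ρ : ℝ≥0, 0 < ρ →
    ∃ t : ℂ → ℝ, ContDiff ℝ ∞ t ∧ (∀ z, 0 ≤ t z) ∧ (∀ z, t z ≤ 1) ∧ (∀ z, ℓ z ≤ r → t z = 0) ∧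
      (∀ z, r + ρ < ℓ z → t z = 1) ∧ (∀ z, ‖fderiv ℝ t z‖ ≤ L / ρ) ∧
      ∀ z, ℓ z ≤ r → fderiv ℝ t z = 0 := by
  obtain ⟨L, hL⟩ : ∃ L : ℝ, ∀ x, ‖deriv Real.smoothTransition x‖ ≤ L := by
    have hc : Continuous (deriv Real.smoothTransition) :=
      (Real.smoothTransition.contDiff (n := 1)).continuous_deriv le_rfl
    have hs : HasCompactSupport (deriv Real.smoothTransition) := by
      refine HasCompactSupport.intro (isCompact_Icc (a := (0 : ℝ)) (b := 1)) fun x hx => ?_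
      rw [mem_Icc, not_and_or, not_le, not_le] at hx
      rcases hx with hx | hx
      · have : Real.smoothTransition =ᶠ[𝓝 x] fun _ => 0 := by
          filter_upwards [gt_mem_nhds hx] with y hy using
            Real.smoothTransition.zero_of_nonpos (le_of_lt hy)
        rw [this.deriv_eq, deriv_const]
      · have : Real.smoothTransition =ᶠ[𝓝 x] fun _ => 1 := by
          filter_upwards [lt_mem_nhds hx] with y hy using
            Real.smoothTransition.one_of_one_le (le_of_lt hy)
        rw [this.deriv_eq, deriv_const]
    exact hc.bounded_above_of_compact_support hs
  have hL0 : 0 ≤ L := (norm_nonneg _).trans (hL 0)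
  refine ⟨⟨L, hL0⟩ * ‖ℓ‖₊ + 1, by positivity, fun r ρ hρ => ?_⟩
  have hρ' : (0 : ℝ) < ρ := hρ
  have hsm : ContDiff ℝ ∞ fun z => Real.smoothTransition ((ℓ z - r) / ρ) :=
    Real.smoothTransition.contDiff.comp ((ℓ.contDiff.sub contDiff_const).div_const _)
  have hz0 : ∀ z, ℓ z ≤ r → Real.smoothTransition ((ℓ z - r) / ρ) = 0 := fun z hz =>
    Real.smoothTransition.zero_of_nonpos (div_nonpos_of_nonpos_of_nonneg (by linarith) hρ'.le)
  refine ⟨fun z => Real.smoothTransition ((ℓ z - r) / ρ), hsm,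
    fun z => Real.smoothTransition.nonneg _, fun z => Real.smoothTransition.le_one _, hz0,
    fun z hz => Real.smoothTransition.one_of_one_le ?_, fun z => ?_, fun z hz => ?_⟩
  · rw [le_div_iff₀ hρ']; linarith
  · have h1 : HasFDerivAt (fun z => (ℓ z - r) / ρ) ((ρ : ℝ)⁻¹ • ℓ) z := by
      have := (ℓ.hasFDerivAt (x := z)).sub_const r |>.const_smul ((ρ : ℝ)⁻¹)
      refine this.congr_of_eventuallyEq (Filter.Eventually.of_forall fun y => ?_)
      simp [div_eq_inv_mul]
    have h2 : HasDerivAt Real.smoothTransition (deriv Real.smoothTransition ((ℓ z - r) / ρ))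
        ((ℓ z - r) / ρ) :=
      ((Real.smoothTransition.contDiff (n := 1)).differentiable (by simp) _).hasDerivAt
    have h3 := h2.comp_hasFDerivAt z h1
    rw [show (fun z => Real.smoothTransition ((ℓ z - r) / ρ)) =
      Real.smoothTransition ∘ fun z => (ℓ z - r) / ρ from rfl, h3.fderiv, norm_smul, norm_smul,
      norm_inv, Real.norm_of_nonneg hρ'.le]
    have := hL ((ℓ z - r) / ρ)
    calc ‖deriv Real.smoothTransition ((ℓ z - r) / ρ)‖ * ((ρ : ℝ)⁻¹ * ‖ℓ‖)
        ≤ L * ((ρ : ℝ)⁻¹ * ‖ℓ‖) := by gcongr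
      _ = (L * ‖ℓ‖) / ρ := by ring
      _ ≤ (L * ‖ℓ‖ + 1) / ρ := by gcongr; linarith
  · refine IsLocalMin.fderiv_eq_zero (Filter.Eventually.of_forall fun y => ?_)
    simp only
    rw [hz0 z hz]
    exact Real.smoothTransition.nonneg _

theorem enorm_setIntegral_mul_le {S : Set ℂ} {φ f : ℂ → ℂ} {M : ℝ≥0} (hφ : ∀ z, ‖φ z‖ ≤ M)
    (hf : AEStronglyMeasurable f volume) :
    ‖∫ z in S, φ z * f z‖ₑ ≤
      M * (volume S ^ (2⁻¹ : ℝ) * eLpNorm f 2 (volume.restrict S)) := by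
  calc ‖∫ z in S, φ z * f z‖ₑ ≤ ∫⁻ z in S, ‖φ z * f z‖ₑ := enorm_integral_le_lintegral_enorm _
    _ ≤ ∫⁻ z in S, M * ‖f z‖ₑ := by
        refine lintegral_mono fun z => ?_
        rw [enorm_mul]
        gcongr
        exact enorm_le_coe.2 (hφ z)
    _ = M * eLpNorm f 1 (volume.restrict S) := by
        rw [lintegral_const_mul' _ _ (by simp), eLpNorm_one_eq_lintegral_enorm]
    _ ≤ M * (eLpNorm f 2 (volume.restrict S) * (volume.restrict S) univ ^
          (1 / (1 : ℝ≥0∞).toReal - 1 / (2 : ℝ≥0∞).toReal)) := by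
        gcongr
        exact eLpNorm_le_eLpNorm_mul_rpow_measure_univ (by norm_num) hf.restrict
    _ = _ := by
        rw [Measure.restrict_apply_univ,
          show (1 / (1 : ℝ≥0∞).toReal - 1 / (2 : ℝ≥0∞).toReal) = 2⁻¹ by norm_num]
        ring

end Bounded

section Steps

theorem exists_complex_cutoff (ℓ : ℂ →L[ℝ] ℝ) : ∃ L : ℝ≥0, 0 < L ∧ ∀ r : ℝ, ∀ ρ : ℝ≥0, 0 < ρ →
    ∃ t : ℂ → ℝ, ContDiff ℝ ∞ (fun z => (t z : ℂ)) ∧ (∀ z, 0 ≤ t z) ∧ (∀ z, t z ≤ 1) ∧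
      (∀ z, ℓ z ≤ r → t z = 0) ∧ (∀ z, r + ρ < ℓ z → t z = 1) ∧
      (∀ z, ‖dbar (fun z => (t z : ℂ)) z‖ ≤ (L / ρ : ℝ≥0)) ∧
      ∀ z, ℓ z ≤ r → fderiv ℝ (fun z => (t z : ℂ)) z = 0 := by
  obtain ⟨L, hL, h⟩ := exists_cutoff ℓ
  refine ⟨L, hL, fun r ρ hρ => ?_⟩
  obtain ⟨t, h1, h2, h3, h4, h5, h6, h7⟩ := h r ρ hρ
  have hd : ∀ z, fderiv ℝ (fun z => (t z : ℂ)) z = ofRealCLM.comp (fderiv ℝ t z) := fun z =>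
    (ofRealCLM.hasFDerivAt.comp z (h1.differentiable (by simp) z).hasFDerivAt).fderiv
  refine ⟨t, ofRealCLM.contDiff.comp h1, h2, h3, h4, h5, fun z => (norm_dbar_le _ _).trans ?_,
    fun z hz => by rw [hd, h7 z hz, ContinuousLinearMap.comp_zero]⟩
  rw [hd]
  refine (ContinuousLinearMap.opNorm_comp_le _ _).trans ?_
  rw [ofRealCLM_norm, one_mul]
  exact_mod_cast h6 z

variable {Ω : Set ℂ} {χ : ℕ → ℂ → ℂ} {u g v : ℂ → ℂ} {ℓ : ℂ →L[ℝ] ℝ}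

theorem measurableSet_superlevel (ℓ : ℂ →L[ℝ] ℝ) (r : ℝ) : MeasurableSet {z | r < ℓ z} :=
  measurableSet_lt measurable_const ℓ.continuous.measurable

theorem eLpNorm_superlevel_testFn {C L : ℝ≥0} (hC : ∀ (u : ℂ → ℂ) (S : Set ℂ), ContDiff ℝ ∞ u →
    HasCompactSupport u → (∀ z ∉ S, fderiv ℝ u z = 0) →
    eLpNorm u 2 volume ≤ C * volume S ^ (2⁻¹ : ℝ) * eLpNorm (dbar u) 2 volume)
    (hΩ : IsOpen Ω) {χ : ℂ → ℂ} (hχ : TestFn Ω χ) {r : ℝ} {ρ : ℝ≥0} {t : ℂ → ℝ}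
    (h1 : ContDiff ℝ ∞ (fun z => (t z : ℂ))) (h2 : ∀ z, 0 ≤ t z) (h3 : ∀ z, t z ≤ 1)
    (h4 : ∀ z, ℓ z ≤ r → t z = 0) (h5 : ∀ z, r + ρ < ℓ z → t z = 1)
    (h6 : ∀ z, ‖dbar (fun z => (t z : ℂ)) z‖ ≤ (L / ρ : ℝ≥0))
    (h7 : ∀ z, ℓ z ≤ r → fderiv ℝ (fun z => (t z : ℂ)) z = 0) :
    eLpNorm χ 2 (volume.restrict {z | r + ρ < ℓ z}) ≤
      C * volume (Ω ∩ {z | r < ℓ z}) ^ (2⁻¹ : ℝ) *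
        ((L / ρ : ℝ≥0) * eLpNorm χ 2 (volume.restrict {z | r < ℓ z}) +
          eLpNorm (dbar χ) 2 (volume.restrict {z | r < ℓ z})) := by
  have ht := hχ.mul_smooth hΩ (h1.contDiffOn (s := Ω))
  have hd : ∀ z, dbar (fun z => χ z * (t z : ℂ)) z =
      χ z * dbar (fun z => (t z : ℂ)) z + t z * dbar χ z := fun z =>
    dbar_mul (hχ.differentiable z) (h1.differentiable (by simp) z)
  have hT := measurableSet_superlevel ℓ r
  have hT' := measurableSet_superlevel ℓ (r + ρ)
  have hfd : ∀ z, ℓ z ≤ r → fderiv ℝ (fun z => χ z * (t z : ℂ)) z = 0 := fun z hz => by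
    rw [fderiv_fun_mul (hχ.differentiable z) (h1.differentiable (by simp) z), h7 z hz, h4 z hz]
    simp
  calc eLpNorm χ 2 (volume.restrict {z | r + ρ < ℓ z})
      = eLpNorm (fun z => χ z * (t z : ℂ)) 2 (volume.restrict {z | r + ρ < ℓ z}) := by
        refine eLpNorm_congr_ae ?_
        filter_upwards [ae_restrict_mem hT'] with z hz
        simp [h5 z hz]
    _ ≤ eLpNorm (fun z => χ z * (t z : ℂ)) 2 volume :=
        eLpNorm_mono_measure _ Measure.restrict_le_self
    _ ≤ C * volume (Ω ∩ {z | r < ℓ z}) ^ (2⁻¹ : ℝ) *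
        eLpNorm (dbar fun z => χ z * (t z : ℂ)) 2 volume := by
        refine hC _ _ ht.smooth ht.cpt fun z hz => ?_
        rw [mem_inter_iff, not_and_or] at hz
        rcases hz with hz | hz
        · apply image_eq_zero_of_notMem_tsupport
          exact fun h => hz (ht.sub (tsupport_fderiv_subset ℝ h))
        · exact hfd z (not_lt.1 hz)
    _ ≤ _ := by
        gcongr
        have e : (dbar fun z => χ z * (t z : ℂ)) =
            {z | r < ℓ z}.indicator (dbar fun z => χ z * (t z : ℂ)) := by
          symm; rw [indicator_eq_self]
          intro z hz
          by_contra h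
          exact hz (by simp [dbar, hfd z (not_lt.1 h)])
        rw [e, eLpNorm_indicator_eq_eLpNorm_restrict hT, funext hd]
        refine (eLpNorm_add_le ?_ ?_ (by norm_num)).trans (add_le_add ?_ ?_)
        · exact (hχ.smooth.continuous.mul (contDiff_dbar h1).continuous).aestronglyMeasurable
        · exact (h1.continuous.mul hχ.dbar.smooth.continuous).aestronglyMeasurable
        · refine eLpNorm_le_nnreal_smul_eLpNorm_of_ae_le_mul (ae_of_all _ fun z => ?_) 2
          rw [nnnorm_mul, mul_comm]
          gcongr
          exact_mod_cast h6 z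
        · refine eLpNorm_mono fun z => ?_
          rw [norm_mul]
          refine mul_le_of_le_one_left (norm_nonneg _) ?_
          simp [abs_of_nonneg (h2 z), h3 z]

theorem measure_superlevel_testFn {L : ℝ≥0} (hΩ : IsOpen Ω) (hA : volume Ω < ⊤)
    (hgm : MemLp g 2 volume) {χ : ℂ → ℂ} (hχ : TestFn Ω χ) {r : ℝ} {ρ : ℝ≥0} {t : ℂ → ℝ}
    (hg : ∀ z ∈ Ω, r < ℓ z → g z = 1)
    (h1 : ContDiff ℝ ∞ (fun z => (t z : ℂ))) (h2 : ∀ z, 0 ≤ t z) (h3 : ∀ z, t z ≤ 1)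
    (h4 : ∀ z, ℓ z ≤ r → t z = 0) (h5 : ∀ z, r + ρ < ℓ z → t z = 1)
    (h6 : ∀ z, ‖dbar (fun z => (t z : ℂ)) z‖ ≤ (L / ρ : ℝ≥0))
    (h7 : ∀ z, ℓ z ≤ r → fderiv ℝ (fun z => (t z : ℂ)) z = 0) :
    volume (Ω ∩ {z | r + ρ < ℓ z}) ≤
      volume (Ω ∩ {z | r < ℓ z}) ^ (2⁻¹ : ℝ) * eLpNorm (dbar χ - g) 2 volume +
      (L / ρ : ℝ≥0) * (volume (Ω ∩ {z | r < ℓ z}) ^ (2⁻¹ : ℝ) *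
        eLpNorm χ 2 (volume.restrict {z | r < ℓ z})) := by
  have ht := hχ.mul_smooth hΩ (h1.contDiffOn (s := Ω))
  have hd : ∀ z, dbar (fun z => χ z * (t z : ℂ)) z =
      dbar (fun z => (t z : ℂ)) z * χ z + t z * dbar χ z := fun z => by
    rw [mul_comm _ (χ z)]
    exact dbar_mul (hχ.differentiable z) (h1.differentiable (by simp) z)
  have hT := measurableSet_superlevel ℓ r
  have hT' := measurableSet_superlevel ℓ (r + ρ)
  set S := Ω ∩ {z | r < ℓ z} with hS
  have hSm : MeasurableSet S := hΩ.measurableSet.inter hT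
  have hSfin : volume S < ⊤ := (measure_mono inter_subset_left).trans_lt hA
  have : IsFiniteMeasure (volume.restrict S) := ⟨by simpa using hSfin⟩
  have ht1 : ∀ z, ‖(t z : ℂ)‖ ≤ (1 : ℝ≥0) := fun z => by simp [abs_of_nonneg (h2 z), h3 z]
  have htm : MemLp (fun z => (t z : ℂ)) 2 (volume.restrict S) :=
    MemLp.of_bound h1.continuous.aestronglyMeasurable 1 (ae_of_all _ ht1)
  have hi1 : IntegrableOn (fun z => (t z : ℂ) * g z) S := by
    exact MemLp.integrable_mul htm (hgm.restrict S)
  have hi2 : IntegrableOn (fun z => (t z : ℂ) * dbar χ z) S := by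
    exact MemLp.integrable_mul htm ((hχ.dbar.memLp 2).restrict S)
  have hi3 : IntegrableOn (fun z => dbar (fun z => (t z : ℂ)) z * χ z) S :=
    ((hχ.mul_smooth hΩ ((contDiff_dbar h1).contDiffOn (s := Ω))).integrable.congr
      (ae_of_all _ fun z => mul_comm _ _)).integrableOn
  have hzero : ∫ z in S, (t z : ℂ) * dbar χ z = - ∫ z in S, dbar (fun z => (t z : ℂ)) z * χ z := by
    rw [eq_neg_iff_add_eq_zero, add_comm, ← integral_add hi3 hi2,
      ← integral_dbar_eq_zero (one_of_smooth ht.smooth) ht.cpt,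
      setIntegral_eq_integral_of_forall_compl_eq_zero]
    · congr 1 with z
      rw [hd]
    · intro z hz
      rw [hS, mem_inter_iff, not_and_or] at hz
      rcases hz with hz | hz
      · rw [hχ.zero_of_notMem hz, hχ.dbar.zero_of_notMem hz, mul_zero, mul_zero, add_zero]
      · have hz' : ℓ z ≤ r := not_lt.1 hz
        rw [h4 z hz']
        simp [dbar, h7 z hz']
  have key : ∫ z in S, (t z : ℂ) = - (∫ z in S, (t z : ℂ) * (dbar χ z - g z)) -
      ∫ z in S, dbar (fun z => (t z : ℂ)) z * χ z := by
    have e1 : ∫ z in S, (t z : ℂ) = ∫ z in S, (t z : ℂ) * g z :=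
      setIntegral_congr_fun hSm fun z hz => by simp only [hg z hz.1 hz.2, mul_one]
    have e2 : ∫ z in S, (t z : ℂ) * (dbar χ z - g z) =
        (∫ z in S, (t z : ℂ) * dbar χ z) - ∫ z in S, (t z : ℂ) * g z := by
      rw [← integral_sub hi2 hi1]
      congr 1 with z
      ring
    rw [e1, e2, hzero]
    ring
  calc volume (Ω ∩ {z | r + ρ < ℓ z}) = ∫⁻ z in Ω ∩ {z | r + ρ < ℓ z}, 1 := by simp
    _ ≤ ∫⁻ z in Ω ∩ {z | r + ρ < ℓ z}, ENNReal.ofReal (t z) := by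
        refine setLIntegral_mono' (hΩ.measurableSet.inter hT') fun z hz => ?_
        rw [h5 z hz.2, ENNReal.ofReal_one]
    _ ≤ ∫⁻ z in S, ENNReal.ofReal (t z) := by
        refine lintegral_mono_set (inter_subset_inter_right _ fun z hz => ?_)
        have : (0 : ℝ) ≤ ρ := ρ.2
        simp only [mem_ofPred_eq] at hz ⊢
        linarith
    _ = ‖∫ z in S, (t z : ℂ)‖ₑ := by
        rw [integral_complex_ofReal, ← ofReal_integral_eq_lintegral_ofReal]
        · rw [← ofReal_norm, Complex.norm_real, Real.norm_of_nonneg (integral_nonneg h2)]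
        · exact (htm.integrable (by norm_num)).re
        · exact ae_of_all _ h2
    _ ≤ ‖∫ z in S, (t z : ℂ) * (dbar χ z - g z)‖ₑ +
          ‖∫ z in S, dbar (fun z => (t z : ℂ)) z * χ z‖ₑ := by
        rw [key, ← enorm_neg (∫ z in S, (t z : ℂ) * (dbar χ z - g z))]
        exact enorm_sub_le
    _ ≤ _ := by
        refine add_le_add ?_ ?_
        · refine (enorm_setIntegral_mul_le ht1 (f := dbar χ - g)
            ((hχ.dbar.memLp 2).1.sub hgm.1)).trans ?_
          rw [ENNReal.coe_one, one_mul]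
          gcongr
          exact Measure.restrict_le_self
        · refine (enorm_setIntegral_mul_le h6 (hχ.memLp 2).1).trans ?_
          gcongr
          exact inter_subset_right

end Steps

section BoundedMain

variable {Ω : Set ℂ} {χ : ℕ → ℂ → ℂ} {u g v : ℂ → ℂ}

theorem TestSeq.exists_superlevel_empty (hΩ : IsOpen Ω) (hA : volume Ω < ⊤)
    (ts : TestSeq Ω χ u g v) (ℓ : ℂ →L[ℝ] ℝ) {r₀ : ℝ}
    (hg : ∀ z, r₀ < ℓ z → g z = Ω.indicator 1 z) :
    ∃ R, ∀ z ∈ Ω, ℓ z ≤ R := by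
  obtain ⟨C, hC0, hC⟩ := exists_sobolev_const
  obtain ⟨L, hL0, hL⟩ := exists_complex_cutoff ℓ
  have hT := measurableSet_superlevel ℓ
  have hfin : ∀ r, volume (Ω ∩ {z | r < ℓ z}) ≠ ⊤ := fun r =>
    ((measure_mono inter_subset_left).trans_lt hA).ne
  have hfin' : ∀ r, volume (Ω ∩ {z | r < ℓ z}) ^ (2⁻¹ : ℝ) ≠ ⊤ := fun r =>
    ENNReal.rpow_ne_top_of_nonneg (by norm_num) (hfin r)
  have hufin : ∀ r, eLpNorm u 2 (volume.restrict {z | r < ℓ z}) ≠ ⊤ := fun r =>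
    (ts.memu.restrict _).2.ne
  have hgA : ∀ r ≥ r₀, eLpNorm g 2 (volume.restrict {z | r < ℓ z}) =
      volume (Ω ∩ {z | r < ℓ z}) ^ (2⁻¹ : ℝ) := fun r hr => by
    have e : eLpNorm g 2 (volume.restrict {z | r < ℓ z}) =
        eLpNorm (Ω.indicator fun _ => (1 : ℂ)) 2 (volume.restrict {z | r < ℓ z}) := by
      refine eLpNorm_congr_ae ?_
      filter_upwards [ae_restrict_mem (hT r)] with z hz
      exact hg z (lt_of_le_of_lt hr hz)
    rw [e, eLpNorm_indicator_const hΩ.measurableSet (by norm_num) (by norm_num),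
      Measure.restrict_apply hΩ.measurableSet]
    simp
  have s1 : ∀ r ≥ r₀, ∀ ρ : ℝ≥0, 0 < ρ → eLpNorm u 2 (volume.restrict {z | r + ρ < ℓ z}) ≤
      C * volume (Ω ∩ {z | r < ℓ z}) ^ (2⁻¹ : ℝ) *
        ((L / ρ : ℝ≥0) * eLpNorm u 2 (volume.restrict {z | r < ℓ z}) +
          volume (Ω ∩ {z | r < ℓ z}) ^ (2⁻¹ : ℝ)) := fun r hr ρ hρ => by
    obtain ⟨t, h1, h2, h3, h4, h5, h6, h7⟩ := hL r ρ hρ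
    rw [← hgA r hr]
    refine le_of_tendsto_of_tendsto'
      (tendsto_eLpNorm_restrict (fun n => (ts.test n).memLp 2) ts.memu ts.limu _) ?_
      (fun n => eLpNorm_superlevel_testFn hC hΩ (ts.test n) h1 h2 h3 h4 h5 h6 h7)
    rw [← hgA r hr]
    refine ENNReal.Tendsto.const_mul (Filter.Tendsto.add (ENNReal.Tendsto.const_mul
      (tendsto_eLpNorm_restrict (fun n => (ts.test n).memLp 2) ts.memu ts.limu _) (Or.inr
          (by simp)))
      (tendsto_eLpNorm_restrict (fun n => (ts.test n).dbar.memLp 2) ts.memg ts.limg _)) (Or.inr ?_)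
    rw [hgA r hr]
    exact ENNReal.mul_ne_top (by simp) (hfin' r)
  have s2 : ∀ r ≥ r₀, ∀ ρ : ℝ≥0, 0 < ρ → volume (Ω ∩ {z | r + ρ < ℓ z}) ≤
      (L / ρ : ℝ≥0) * (volume (Ω ∩ {z | r < ℓ z}) ^ (2⁻¹ : ℝ) *
        eLpNorm u 2 (volume.restrict {z | r < ℓ z})) := fun r hr ρ hρ => by
    obtain ⟨t, h1, h2, h3, h4, h5, h6, h7⟩ := hL r ρ hρ
    refine ge_of_tendsto' (x := Filter.atTop) ?_
        (fun n => measure_superlevel_testFn hΩ hA ts.memg (ts.test n)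
      (fun z hz hrz => by rw [hg z (lt_of_le_of_lt hr hrz), indicator_of_mem hz, Pi.one_apply])
      h1 h2 h3 h4 h5 h6 h7)
    rw [← zero_add (((L / ρ : ℝ≥0) : ℝ≥0∞) * _), ← mul_zero (volume (Ω ∩ {z | r < ℓ z}) ^
        (2⁻¹ : ℝ))]
    exact Filter.Tendsto.add (ENNReal.Tendsto.const_mul ts.limg (Or.inr (hfin' r)))
      (ENNReal.Tendsto.const_mul (ENNReal.Tendsto.const_mul
        (tendsto_eLpNorm_restrict (fun n => (ts.test n).memLp 2) ts.memu ts.limu _)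
        (Or.inr (hfin' r))) (Or.inr (by simp)))
  let A : ℝ → ℝ := fun r => (volume (Ω ∩ {z | r < ℓ z}) ^ (2⁻¹ : ℝ)).toReal
  let B : ℝ → ℝ := fun r => (eLpNorm u 2 (volume.restrict {z | r < ℓ z})).toReal
  have hAsq : ∀ r, A r ^ 2 = (volume (Ω ∩ {z | r < ℓ z})).toReal := fun r => by
    simp only [A]
    rw [← ENNReal.toReal_pow, ← ENNReal.rpow_natCast, ← ENNReal.rpow_mul]
    norm_num
  obtain ⟨R, hR⟩ : ∃ R, A R = 0 := by
    obtain ⟨M, hM1, hCM, hLM, hCLM⟩ : ∃ M : ℝ, 1 ≤ M ∧ C ≤ M ∧ L ≤ M ∧ C * L ≤ M :=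
      have hC1 : (0 : ℝ) ≤ C := C.2
      have hL1 : (0 : ℝ) ≤ L := L.2
      have hCL1 : (0 : ℝ) ≤ C * L := mul_nonneg hC1 hL1
      ⟨1 + C + L + C * L, by linarith, by linarith, by linarith, by linarith⟩
    have hA0 : ∀ r, 0 ≤ A r := fun r => ENNReal.toReal_nonneg
    have hB0 : ∀ r, 0 ≤ B r := fun r => ENNReal.toReal_nonneg
    refine exists_eq_zero_of_iteration (A := A) (B := B) (r₀ := r₀) hM1 hA0 hB0 ?_ ?_ ?_ ?_ ?_
    · intro r s hrs
      refine ENNReal.toReal_mono (hfin' r) (ENNReal.rpow_le_rpow (measure_mono ?_) (by norm_num))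
      exact inter_subset_inter_right _ fun z hz => lt_of_le_of_lt hrs hz
    · intro r hr ρ hρ
      have := ENNReal.toReal_mono ?_ (s1 r hr ⟨ρ, hρ.le⟩ hρ)
      · rw [ENNReal.toReal_mul, ENNReal.toReal_mul, ENNReal.toReal_add (ENNReal.mul_ne_top (by simp)
          (hufin r)) (hfin' r), ENNReal.toReal_mul] at this
        refine le_trans this (le_of_eq_of_le (b := C * A r * (L / ρ * B r + A r)) rfl ?_)
        calc C * A r * (L / ρ * B r + A r) = (C * L) * (A r * (B r / ρ)) + C * (A r * A r) :=
            by ring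
          _ ≤ M * (A r * (B r / ρ)) + M * (A r * A r) := by
              have := hA0 r
              have := hB0 r
              gcongr
          _ = _ := by ring
      · exact ENNReal.mul_ne_top (ENNReal.mul_ne_top (by simp) (hfin' r))
          (ENNReal.add_ne_top.2 ⟨ENNReal.mul_ne_top (by simp) (hufin r), hfin' r⟩)
    · intro r hr ρ hρ
      have := ENNReal.toReal_mono ?_ (s2 r hr ⟨ρ, hρ.le⟩ hρ)
      · rw [ENNReal.toReal_mul, ENNReal.toReal_mul] at this
        rw [hAsq]
        refine le_trans this (le_of_eq_of_le (b := L / ρ * (A r * B r)) rfl ?_)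
        rw [mul_assoc]
        have := hA0 r
        have := hB0 r
        gcongr
      · exact ENNReal.mul_ne_top (by simp) (ENNReal.mul_ne_top (hfin' r) (hufin r))
    · have : IsFiniteMeasure (volume.restrict Ω) := ⟨by simpa using hA⟩
      have h := tendsto_measure_superlevel (volume.restrict Ω) ℓ.continuous.measurable
      have h2 := (ENNReal.continuous_rpow_const (y := (2⁻¹ : ℝ))).tendsto 0 |>.comp h
      rw [ENNReal.zero_rpow_of_pos (by norm_num)] at h2
      have h3 := (ENNReal.tendsto_toReal (by simp)).comp h2
      refine h3.congr fun r => ?_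
      simp only [Function.comp_apply, A]
      rw [Measure.restrict_apply (hT r), inter_comm]
    · have h3 := (ENNReal.tendsto_toReal (by simp)).comp
        (tendsto_eLpNorm_superlevel ts.memu ℓ.continuous.measurable)
      exact h3
  refine ⟨R, ?_⟩
  have h0 : volume (Ω ∩ {z | R < ℓ z}) = 0 := by
    have := hAsq R
    rw [hR, eq_comm, zero_pow two_ne_zero, ENNReal.toReal_eq_zero_iff] at this
    exact this.resolve_right (hfin R)
  rw [(hΩ.inter (isOpen_lt continuous_const ℓ.continuous)).measure_eq_zero_iff volume] at h0
  intro z hz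
  by_contra h
  exact (h0 ▸ (⟨hz, not_le.1 h⟩ : z ∈ Ω ∩ {z | R < ℓ z}) : z ∈ (∅ : Set ℂ))

theorem isBounded_of_quadrature (hΩ : IsOpen Ω) (hA : volume Ω < ⊤)
    (hq : IsQuadratureDomain Ω) : Bornology.IsBounded Ω := by
  obtain ⟨b, hb, hbq⟩ := exists_testFn_quadrature hΩ hq
  have h1 : MemLp (Ω.indicator 1 : ℂ → ℂ) 2 volume :=
    memLp_indicator_const 2 hΩ.measurableSet (1 : ℂ) (Or.inr hA.ne)
  obtain ⟨χ, u, v, ts⟩ := exists_testSeq hΩ hA (g := fun z => Ω.indicator 1 z - b z)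
    (h1.sub (hb.memLp 2)) (fun z hz => by
      simp [indicator_of_notMem hz, hb.zero_of_notMem hz]) (fun f hf => by
      have hfi : IntegrableOn f Ω := by
        have : IsFiniteMeasure (volume.restrict Ω) := ⟨by simpa using hA⟩
        exact ((bergmanFun_iff hΩ).1 hf).2.integrable (by norm_num)
      have e : ∫ z in Ω, f z * (Ω.indicator 1 z - b z) = ∫ z in Ω, (f z - f z * b z) :=
        setIntegral_congr_fun hΩ.measurableSet fun z hz => by
          simp only [indicator_of_mem hz, Pi.one_apply]; ring
      rw [e, integral_sub hfi (integrable_mul_testFn hΩ hb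
        (hf.1.contDiffOn_real hΩ)).integrableOn, hbq f hf, sub_self])
  obtain ⟨D, hD⟩ := hb.cpt.isBounded.exists_norm_le
  have main : ∀ ℓ : ℂ →L[ℝ] ℝ, ∃ R, ∀ z ∈ Ω, ℓ z ≤ R := fun ℓ => by
    refine ts.exists_superlevel_empty hΩ hA ℓ (r₀ := ‖ℓ‖ * D) fun z hz => ?_
    have : b z = 0 := by
      apply image_eq_zero_of_notMem_tsupport
      intro h
      have := (le_abs_self _).trans ((ℓ.le_opNorm z).trans
        (mul_le_mul_of_nonneg_left (hD z h) (norm_nonneg ℓ)))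
      linarith
    rw [this, sub_zero]
  obtain ⟨R1, h1⟩ := main reCLM
  obtain ⟨R2, h2⟩ := main (-reCLM)
  obtain ⟨R3, h3⟩ := main imCLM
  obtain ⟨R4, h4⟩ := main (-imCLM)
  refine isBounded_iff_forall_norm_le.2 ⟨max R1 R2 + max R3 R4, fun z hz => ?_⟩
  refine (norm_le_abs_re_add_abs_im z).trans (add_le_add ?_ ?_)
  · exact abs_le'.2 ⟨(h1 z hz).trans (le_max_left _ _), (h2 z hz).trans (le_max_right _ _)⟩
  · exact abs_le'.2 ⟨(h3 z hz).trans (le_max_left _ _), (h4 z hz).trans (le_max_right _ _)⟩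

end BoundedMain

section Nice

/-- Bounded smooth functions on `Ω` with finite Dirichlet integral. -/
structure Nice (Ω : Set ℂ) (v : ℂ → ℂ) : Prop where
  smooth : ContDiffOn ℝ ∞ v Ω
  bdd : ∃ B, ∀ z ∈ Ω, ‖v z‖ ≤ B
  memLp_dbar : MemLp (dbar v) 2 (volume.restrict Ω)
  memLp_dd : MemLp (dd v) 2 (volume.restrict Ω)

/-- Nice functions which vanish on the boundary of `Ω` in a weak sense. -/
def Null (Ω : Set ℂ) (v : ℂ → ℂ) : Prop :=
  Nice Ω v ∧ ∀ φ, Nice Ω φ → ∀ f, BergmanFun Ω f →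
    ∫ z in Ω, f z * dbar (fun z => φ z * v z) z = 0 ∧
    ∫ z in Ω, f z * dbar (fun z => conj (φ z * v z)) z = 0

variable {Ω : Set ℂ} {u v φ f : ℂ → ℂ}

theorem fderiv_congr_of_eqOn (hΩ : IsOpen Ω) (h : EqOn u v Ω) {z : ℂ} (hz : z ∈ Ω) :
    fderiv ℝ u z = fderiv ℝ v z :=
  (Filter.eventuallyEq_of_mem (hΩ.mem_nhds hz) h).fderiv_eq

theorem dbar_congr_of_eqOn (hΩ : IsOpen Ω) (h : EqOn u v Ω) {z : ℂ} (hz : z ∈ Ω) :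
    dbar u z = dbar v z := by
  simp only [dbar, fderiv_congr_of_eqOn hΩ h hz]

theorem dd_congr_of_eqOn (hΩ : IsOpen Ω) (h : EqOn u v Ω) {z : ℂ} (hz : z ∈ Ω) :
    dd u z = dd v z := by
  simp only [dd, fderiv_congr_of_eqOn hΩ h hz]

theorem ae_eq_restrict_of_eqOn (hΩ : IsOpen Ω) (h : EqOn u v Ω) :
    u =ᵐ[volume.restrict Ω] v := by
  filter_upwards [ae_restrict_mem hΩ.measurableSet] with z hz using h hz

theorem Nice.congr (hΩ : IsOpen Ω) (h : Nice Ω u) (huv : EqOn v u Ω) : Nice Ω v where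
  smooth := h.smooth.congr huv
  bdd := h.bdd.imp fun B hB z hz => by rw [huv hz]; exact hB z hz
  memLp_dbar := h.memLp_dbar.ae_eq (ae_eq_restrict_of_eqOn hΩ fun _ hz =>
    (dbar_congr_of_eqOn hΩ huv hz).symm)
  memLp_dd := h.memLp_dd.ae_eq (ae_eq_restrict_of_eqOn hΩ fun _ hz =>
    (dd_congr_of_eqOn hΩ huv hz).symm)

theorem Nice.differentiableAt (hΩ : IsOpen Ω) (h : Nice Ω u) {z : ℂ} (hz : z ∈ Ω) :
    DifferentiableAt ℝ u z :=
  (h.smooth.contDiffAt (hΩ.mem_nhds hz)).differentiableAt (by simp)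

theorem Nice.add (hΩ : IsOpen Ω) (hu : Nice Ω u) (hv : Nice Ω v) :
    Nice Ω (fun z => u z + v z) where
  smooth := hu.smooth.add hv.smooth
  bdd := by
    obtain ⟨B, hB⟩ := hu.bdd
    obtain ⟨B', hB'⟩ := hv.bdd
    exact ⟨B + B', fun z hz => (norm_add_le _ _).trans (add_le_add (hB z hz) (hB' z hz))⟩
  memLp_dbar := (hu.memLp_dbar.add hv.memLp_dbar).ae_eq <| ae_eq_restrict_of_eqOn hΩ fun _ hz =>
    (dbar_add (hu.differentiableAt hΩ hz) (hv.differentiableAt hΩ hz)).symm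
  memLp_dd := (hu.memLp_dd.add hv.memLp_dd).ae_eq <| ae_eq_restrict_of_eqOn hΩ fun _ hz =>
    (dd_add (hu.differentiableAt hΩ hz) (hv.differentiableAt hΩ hz)).symm

theorem Nice.memLp_mul (hΩ : IsOpen Ω) (hu : Nice Ω u) {F : ℂ → ℂ}
    (hF : MemLp F 2 (volume.restrict Ω)) : MemLp (fun z => u z * F z) 2 (volume.restrict Ω) := by
  obtain ⟨B, hB⟩ := hu.bdd
  refine hF.of_le_mul (c := B) ((hu.smooth.continuousOn.aestronglyMeasurable
    hΩ.measurableSet).mul hF.1) ?_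
  filter_upwards [ae_restrict_mem hΩ.measurableSet] with z hz
  rw [norm_mul]
  exact mul_le_mul_of_nonneg_right (hB z hz) (norm_nonneg _)

theorem Nice.mul (hΩ : IsOpen Ω) (hu : Nice Ω u) (hv : Nice Ω v) :
    Nice Ω (fun z => u z * v z) where
  smooth := hu.smooth.mul hv.smooth
  bdd := by
    obtain ⟨B, hB⟩ := hu.bdd
    obtain ⟨B', hB'⟩ := hv.bdd
    refine ⟨B * B', fun z hz => ?_⟩
    rw [norm_mul]
    exact mul_le_mul (hB z hz) (hB' z hz) (norm_nonneg _) ((norm_nonneg _).trans (hB z hz))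
  memLp_dbar := ((hu.memLp_mul hΩ hv.memLp_dbar).add (hv.memLp_mul hΩ hu.memLp_dbar)).ae_eq <|
    ae_eq_restrict_of_eqOn hΩ fun _ hz =>
      (dbar_mul (hu.differentiableAt hΩ hz) (hv.differentiableAt hΩ hz)).symm
  memLp_dd := ((hu.memLp_mul hΩ hv.memLp_dd).add (hv.memLp_mul hΩ hu.memLp_dd)).ae_eq <|
    ae_eq_restrict_of_eqOn hΩ fun _ hz =>
      (dd_mul (hu.differentiableAt hΩ hz) (hv.differentiableAt hΩ hz)).symm

theorem Nice.conj (hΩ : IsOpen Ω) (hu : Nice Ω u) : Nice Ω (fun z => conj (u z)) where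
  smooth := conjCLE.contDiff.comp_contDiffOn hu.smooth
  bdd := hu.bdd.imp fun B hB z hz => by simpa using hB z hz
  memLp_dbar := (MemLp.star hu.memLp_dd).ae_eq <| ae_eq_restrict_of_eqOn hΩ fun _ hz =>
    (dbar_conj (hu.differentiableAt hΩ hz)).symm
  memLp_dd := (MemLp.star hu.memLp_dbar).ae_eq <| ae_eq_restrict_of_eqOn hΩ fun _ hz =>
    (dd_conj (hu.differentiableAt hΩ hz)).symm

theorem Nice.bergmanFun_deriv (hΩ : IsOpen Ω) (h : Nice Ω f) (hf : DifferentiableOn ℂ f Ω) :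
    BergmanFun Ω (deriv f) :=
  (bergmanFun_iff hΩ).2 ⟨hf.deriv hΩ, h.memLp_dd.ae_eq <| ae_eq_restrict_of_eqOn hΩ fun _ hz =>
    dd_holo (hf.differentiableAt (hΩ.mem_nhds hz))⟩

theorem isFiniteMeasure_restrict_of_isBounded (hb : Bornology.IsBounded Ω) :
    IsFiniteMeasure (volume.restrict Ω) :=
  ⟨by simpa using hb.measure_lt_top⟩

theorem memLp_of_bounded_on (hΩ : IsOpen Ω) (hbΩ : Bornology.IsBounded Ω) (hf : ContinuousOn f Ω)
    (hb : ∃ B, ∀ z ∈ Ω, ‖f z‖ ≤ B) : MemLp f 2 (volume.restrict Ω) := by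
  have := isFiniteMeasure_restrict_of_isBounded hbΩ
  obtain ⟨B, hB⟩ := hb
  refine MemLp.of_bound (hf.aestronglyMeasurable hΩ.measurableSet) B ?_
  filter_upwards [ae_restrict_mem hΩ.measurableSet] with z hz using hB z hz

theorem bounded_on_of_continuous (hbΩ : Bornology.IsBounded Ω) (hf : Continuous f) :
    ∃ B, ∀ z ∈ Ω, ‖f z‖ ≤ B := by
  obtain ⟨B, hB⟩ := hbΩ.isCompact_closure.exists_bound_of_continuousOn hf.continuousOn
  exact ⟨B, fun z hz => hB z (subset_closure hz)⟩

theorem nice_of_smooth (hΩ : IsOpen Ω) (hbΩ : Bornology.IsBounded Ω) (h : ContDiff ℝ ∞ u) :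
    Nice Ω u where
  smooth := h.contDiffOn
  bdd := bounded_on_of_continuous hbΩ h.continuous
  memLp_dbar := memLp_of_bounded_on hΩ hbΩ (contDiff_dbar h).continuous.continuousOn
    (bounded_on_of_continuous hbΩ (contDiff_dbar h).continuous)
  memLp_dd := memLp_of_bounded_on hΩ hbΩ (contDiff_dd h).continuous.continuousOn
    (bounded_on_of_continuous hbΩ (contDiff_dd h).continuous)

theorem nice_polynomial (hΩ : IsOpen Ω) (hbΩ : Bornology.IsBounded Ω) (p : Polynomial ℂ) :
    Nice Ω (fun z => p.eval z) :=
  nice_of_smooth hΩ hbΩ (p.differentiable.contDiff.restrict_scalars ℝ)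

theorem BergmanFun.nice_mul (hΩ : IsOpen Ω) (hu : Nice Ω u) (hu' : DifferentiableOn ℂ u Ω)
    (hf : BergmanFun Ω f) : BergmanFun Ω (fun z => u z * f z) :=
  (bergmanFun_iff hΩ).2 ⟨hu'.mul hf.1, hu.memLp_mul hΩ ((bergmanFun_iff hΩ).1 hf).2⟩

theorem Nice.bergmanFun (hΩ : IsOpen Ω) (hbΩ : Bornology.IsBounded Ω) (hu : Nice Ω u)
    (hu' : DifferentiableOn ℂ u Ω) : BergmanFun Ω u :=
  (bergmanFun_iff hΩ).2 ⟨hu', memLp_of_bounded_on hΩ hbΩ hu'.continuousOn hu.bdd⟩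

theorem Nice.integrable_mul_dbar (hΩ : IsOpen Ω) (hu : Nice Ω u) (hf : BergmanFun Ω f) :
    IntegrableOn (fun z => f z * dbar u z) Ω :=
  ((bergmanFun_iff hΩ).1 hf).2.integrable_mul hu.memLp_dbar

theorem Null.congr (hΩ : IsOpen Ω) (h : Null Ω u) (huv : EqOn v u Ω) : Null Ω v := by
  refine ⟨h.1.congr hΩ huv, fun φ hφ f hf => ?_⟩
  have h2 := h.2 φ hφ f hf
  have e1 : EqOn (fun z => φ z * v z) (fun z => φ z * u z) Ω := fun z hz => by
    simp only [huv hz]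
  have e2 : EqOn (fun z => conj (φ z * v z)) (fun z => conj (φ z * u z)) Ω := fun z hz => by
    simp only [huv hz]
  exact ⟨(setIntegral_congr_fun hΩ.measurableSet fun z hz => by
      simp only [dbar_congr_of_eqOn hΩ e1 hz]).trans h2.1,
    (setIntegral_congr_fun hΩ.measurableSet fun z hz => by
      simp only [dbar_congr_of_eqOn hΩ e2 hz]).trans h2.2⟩

theorem Null.add (hΩ : IsOpen Ω) (hu : Null Ω u) (hv : Null Ω v) :
    Null Ω (fun z => u z + v z) := by
  have aux : ∀ {a b c f : ℂ → ℂ}, Nice Ω a → Nice Ω b → BergmanFun Ω f →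
      (c = fun z => a z + b z) → ∫ z in Ω, f z * dbar a z = 0 → ∫ z in Ω, f z * dbar b z = 0 →
      ∫ z in Ω, f z * dbar c z = 0 := by
    intro a b c f ha hb hf hc h1 h2
    rw [hc]
    have e : ∫ z in Ω, f z * dbar (fun z => a z + b z) z =
        ∫ z in Ω, (f z * dbar a z + f z * dbar b z) :=
      setIntegral_congr_fun hΩ.measurableSet fun z hz => by
        simp only [dbar_add (ha.differentiableAt hΩ hz) (hb.differentiableAt hΩ hz)]; ring
    rw [e, integral_add (ha.integrable_mul_dbar hΩ hf) (hb.integrable_mul_dbar hΩ hf), h1, h2,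
      add_zero]
  refine ⟨hu.1.add hΩ hv.1, fun φ hφ f hf => ?_⟩
  have h1 := hu.2 φ hφ f hf
  have h2 := hv.2 φ hφ f hf
  have n1 := hφ.mul hΩ hu.1
  have n2 := hφ.mul hΩ hv.1
  exact ⟨aux n1 n2 hf (funext fun z => by ring) h1.1 h2.1,
    aux (n1.conj hΩ) (n2.conj hΩ) hf (funext fun z => by simp only [map_mul, map_add]; ring)
      h1.2 h2.2⟩

theorem Null.mul_nice (hΩ : IsOpen Ω) (hu : Null Ω u) (hv : Nice Ω v) :
    Null Ω (fun z => v z * u z) := by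
  refine ⟨hv.mul hΩ hu.1, fun φ hφ f hf => ?_⟩
  have := hu.2 _ (hφ.mul hΩ hv) f hf
  simpa only [mul_assoc] using this

theorem Null.conj (hΩ : IsOpen Ω) (hu : Null Ω u) : Null Ω (fun z => conj (u z)) := by
  refine ⟨hu.1.conj hΩ, fun φ hφ f hf => ?_⟩
  have := hu.2 _ (hφ.conj hΩ) f hf
  refine ⟨?_, ?_⟩
  · simpa only [map_mul, conj_conj] using this.2
  · simpa only [map_mul, conj_conj] using this.1

theorem integral_mul_dbar_testFn (hΩ : IsOpen Ω) {χ : ℂ → ℂ} (h : TestFn Ω χ)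
    (hf : DifferentiableOn ℂ f Ω) : ∫ z in Ω, f z * dbar χ z = 0 := by
  have h1 := h.mul_smooth hΩ (hf.contDiffOn_real hΩ)
  rw [setIntegral_eq_of_testFn h.dbar, ← integral_dbar_eq_zero (one_of_smooth h1.smooth) h1.cpt]
  congr 1 with z
  rw [dbar_mul_holo hΩ h hf]

theorem TestFn.conj {χ : ℂ → ℂ} (h : TestFn Ω χ) : TestFn Ω (fun z => conj (χ z)) :=
  ⟨conjCLE.contDiff.comp h.smooth, h.cpt.comp_left (g := fun z => conj z) (by simp),
    (tsupport_comp_subset (g := fun z => conj z) (by simp) χ).trans h.sub⟩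

theorem TestFn.null (hΩ : IsOpen Ω) (hbΩ : Bornology.IsBounded Ω) {χ : ℂ → ℂ} (h : TestFn Ω χ) :
    Null Ω χ := by
  refine ⟨nice_of_smooth hΩ hbΩ h.smooth, fun φ hφ f hf => ?_⟩
  have h1 := h.mul_smooth hΩ hφ.smooth
  simp only [mul_comm (φ _)]
  exact ⟨integral_mul_dbar_testFn hΩ h1 hf.1, integral_mul_dbar_testFn hΩ h1.conj hf.1⟩

theorem Null.deriv_eq_zero (hΩ : IsOpen Ω) (hbΩ : Bornology.IsBounded Ω) (hf : Null Ω f)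
    (hf' : DifferentiableOn ℂ f Ω) : EqOn (deriv f) 0 Ω := by
  have hB := hf.1.bergmanFun_deriv hΩ hf'
  have h1 := (hf.2 (fun _ => 1) (nice_of_smooth hΩ hbΩ contDiff_const) _ hB).2
  have e : ∫ z in Ω, deriv f z * dbar (fun z => conj ((fun _ => 1) z * f z)) z =
      ∫ z in Ω, ((‖deriv f z‖ ^ 2 : ℝ) : ℂ) := by
    refine setIntegral_congr_fun hΩ.measurableSet fun z hz => ?_
    have hd := hf'.differentiableAt (hΩ.mem_nhds hz)
    simp only [one_mul]
    rw [dbar_conj (hd.restrictScalars ℝ), dd_holo hd, mul_conj, Complex.normSq_eq_norm_sq]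
  rw [e, integral_complex_ofReal, ofReal_eq_zero, integral_eq_zero_iff_of_nonneg
    (fun z => by positivity) hB.2] at h1
  have h2 : deriv f =ᵐ[volume.restrict Ω] 0 := by
    filter_upwards [h1] with z hz
    simpa using hz
  exact Measure.eqOn_open_of_ae_eq h2 hΩ hB.1.continuousOn continuousOn_const

theorem Null.eq_zero_of_holo (hΩ : IsOpen Ω) (hbΩ : Bornology.IsBounded Ω) (hf : Null Ω f)
    (hf' : DifferentiableOn ℂ f Ω) : EqOn f 0 Ω := by
  have h1 := hf.deriv_eq_zero hΩ hbΩ hf'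
  have h2 := (hf.mul_nice hΩ (nice_of_smooth hΩ hbΩ contDiff_id)).deriv_eq_zero hΩ hbΩ
    (differentiableOn_id.mul hf')
  intro z hz
  have h3 := h2 hz
  have hd := hf'.differentiableAt (hΩ.mem_nhds hz)
  simp only [id] at h3
  rw [deriv_fun_mul differentiableAt_fun_id hd, h1 hz] at h3
  simpa using h3

end Nice

section Annihilator

variable {Ω : Set ℂ} {f : ℂ → ℂ}

theorem iteratedDerivWithin_pow_mul_eq_zero (hΩ : IsOpen Ω) {w : ℂ} (hw : w ∈ Ω) {k m : ℕ}
    (hkm : k < m) {h : ℂ → ℂ} (hh : DifferentiableOn ℂ h Ω) :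
    iteratedDerivWithin k (fun z => (z - w) ^ m * h z) Ω w = 0 := by
  induction k generalizing m h with
  | zero => simp [iteratedDerivWithin_zero, hkm.ne']
  | succ k ih =>
    obtain ⟨m, rfl⟩ : ∃ l, m = l + 1 := ⟨m - 1, by omega⟩
    rw [iteratedDerivWithin_succ']
    have e : EqOn (derivWithin (fun z => (z - w) ^ (m + 1) * h z) Ω)
        (fun z => (z - w) ^ m * ((m + 1) * h z + (z - w) * deriv h z)) Ω := fun z hz => by
      have h1 := (hh.differentiableAt (hΩ.mem_nhds hz)).hasDerivAt
      have h2 := ((((hasDerivAt_id z).sub_const w).pow (m + 1)).mul h1).hasDerivWithinAt (s := Ω)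
      refine (h2.derivWithin (hΩ.uniqueDiffOn z hz)).trans ?_
      simp only [id, Pi.pow_apply, Nat.add_sub_cancel, Nat.cast_add, Nat.cast_one]
      ring
    rw [iteratedDerivWithin_congr e hw]
    exact ih (by omega) (((differentiableOn_const _).mul hh).add
      ((differentiableOn_id.sub_const w).mul (hh.deriv hΩ)))

/-- Polynomials whose conjugates are orthogonal to the Bergman space. -/
def bergmanAnnihilator (hΩ : IsOpen Ω) (hb : Bornology.IsBounded Ω) : Ideal (Polynomial ℂ) where
  carrier := {p | ∀ f, BergmanFun Ω f → ∫ z in Ω, p.eval z * f z = 0}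
  add_mem' {p q} hp hq f hf := by
    have hi : ∀ p : Polynomial ℂ, IntegrableOn (fun z => p.eval z * f z) Ω := fun p => by
      have := isFiniteMeasure_restrict_of_isBounded hb
      have h1 := (nice_polynomial hΩ hb p).memLp_mul hΩ ((bergmanFun_iff hΩ).1 hf).2
      exact (h1.mono_exponent one_le_two).integrable le_rfl
    simp only [Polynomial.eval_add, add_mul]
    rw [integral_add (hi p) (hi q), hp f hf, hq f hf, add_zero]
  zero_mem' f hf := by simp
  smul_mem' q p hp f hf := by
    have h1 := hp _ (hf.nice_mul hΩ (nice_polynomial hΩ hb q) q.differentiable.differentiableOn)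
    rw [← h1]
    congr 1 with z
    simp only [smul_eq_mul, Polynomial.eval_mul]
    ring

theorem exists_annihilator (hΩ : IsOpen Ω) (hb : Bornology.IsBounded Ω) (hne : Ω.Nonempty)
    (hq : IsQuadratureDomain Ω) : ∃ p : Polynomial ℂ, p ≠ 0 ∧ 0 < p.natDegree ∧
      (∀ a, p.IsRoot a → a ∈ Ω) ∧ (∀ f, BergmanFun Ω f → ∫ z in Ω, p.eval z * f z = 0) ∧
      ∀ r : Polynomial ℂ, r ≠ 0 → (∀ f, BergmanFun Ω f → ∫ z in Ω, r.eval z * f z = 0) →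
        p.natDegree ≤ r.natDegree := by
  obtain ⟨N, -, w, n, c, hw, hq⟩ := hq
  set I := bergmanAnnihilator hΩ hb with hI
  set W : Polynomial ℂ := ∏ j, (Polynomial.X - Polynomial.C (w j)) ^ (n j + 1) with hWd
  have hW0 : W ≠ 0 := Finset.prod_ne_zero_iff.2 fun j _ => pow_ne_zero _
      (Polynomial.X_sub_C_ne_zero _)
  have hW : W ∈ I := fun f hf => by
    rw [hq _ (hf.nice_mul hΩ (nice_polynomial hΩ hb W) W.differentiable.differentiableOn)]
    refine Finset.sum_eq_zero fun j _ => Finset.sum_eq_zero fun k hk => ?_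
    set V : Polynomial ℂ := ∏ i ∈ Finset.univ.erase j, (Polynomial.X - Polynomial.C (w i)) ^
        (n i + 1)
    have e : (fun z => W.eval z * f z) = fun z => (z - w j) ^ (n j + 1) * (V.eval z * f z) := by
      funext z
      rw [hWd, ← Finset.mul_prod_erase _ _ (Finset.mem_univ j)]
      simp [V, mul_assoc]
    have h1 := iteratedDerivWithin_pow_mul_eq_zero hΩ (hw j) (Finset.mem_range.1 hk)
      (h := fun z => V.eval z * f z) (V.differentiable.differentiableOn.mul hf.1)
    rw [e, h1, mul_zero]
  have hgen : ∀ r ∈ I, Submodule.IsPrincipal.generator I ∣ r := fun r hr =>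
    (Submodule.IsPrincipal.mem_iff_generator_dvd I).1 hr
  set p := Submodule.IsPrincipal.generator I with hp
  have hpI : p ∈ I := Submodule.IsPrincipal.generator_mem I
  have hp0 : p ≠ 0 := fun h => hW0 (by simpa [h] using hgen W hW)
  refine ⟨p, hp0, ?_, fun a ha => ?_, hpI, fun r hr0 hr => Polynomial.natDegree_le_of_dvd
      (hgen r hr) hr0⟩
  · by_contra! h
    have h1 : (1 : Polynomial ℂ) ∈ I := by
      obtain ⟨a, ha⟩ := Polynomial.natDegree_eq_zero.1 (Nat.le_zero.1 h)
      have ha0 : a ≠ 0 := by rintro rfl; exact hp0 (by simp [← ha])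
      have := I.mul_mem_left (Polynomial.C a⁻¹) hpI
      rwa [← ha, ← Polynomial.C_mul, inv_mul_cancel₀ ha0, Polynomial.C_1] at this
    have h2 := h1 (fun _ => 1) ((nice_of_smooth hΩ hb contDiff_const).bergmanFun hΩ hb
      (differentiableOn_const _))
    simp only [Polynomial.eval_one, mul_one, integral_const, MeasurableSet.univ,
        measureReal_restrict_apply,
      univ_inter, real_smul, ofReal_eq_zero] at h2
    rw [measureReal_eq_zero_iff hb.measure_lt_top.ne] at h2
    exact (hΩ.measure_pos volume hne).ne' h2
  · have h1 : W.IsRoot a := ha.dvd (hgen W hW)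
    rw [Polynomial.IsRoot, hWd, Polynomial.eval_prod, Finset.prod_eq_zero_iff] at h1
    obtain ⟨j, -, hj⟩ := h1
    have : a = w j := by simpa [sub_eq_zero] using hj
    exact this ▸ hw j

end Annihilator

section Potential

variable {Ω : Set ℂ} {χ : ℕ → ℂ → ℂ} {u g v : ℂ → ℂ}

theorem eLpNorm_mul_le {μ : Measure ℂ} {φ F : ℂ → ℂ} (hφ : AEStronglyMeasurable φ μ)
    (hF : AEStronglyMeasurable F μ) :
    eLpNorm (fun z => φ z * F z) 1 μ ≤ eLpNorm φ 2 μ * eLpNorm F 2 μ := by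
  have h := eLpNorm_smul_le_mul_eLpNorm (p := 2) (q := 2) (r := 1) hF hφ
  rwa [smul_eq_mul] at h

theorem tendsto_integral_mul {μ : Measure ℂ} {F : ℕ → ℂ → ℂ} {G φ : ℂ → ℂ}
    (hF : ∀ n, MemLp (F n) 2 μ) (hG : MemLp G 2 μ) (hφ : MemLp φ 2 μ)
    (h : Filter.Tendsto (fun n => eLpNorm (F n - G) 2 μ) Filter.atTop (𝓝 0)) :
    Filter.Tendsto (fun n => ∫ z, φ z * F n z ∂μ) Filter.atTop (𝓝 (∫ z, φ z * G z ∂μ)) := by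
  refine tendsto_integral_of_L1' _ (hφ.1.mul hG.1)
    (Filter.Eventually.of_forall fun n => hφ.integrable_mul (hF n)) ?_
  refine tendsto_of_tendsto_of_tendsto_of_le_of_le tendsto_const_nhds (h := fun n =>
    eLpNorm φ 2 μ * eLpNorm (F n - G) 2 μ) ?_ (fun _ => zero_le) fun n => ?_
  · simpa using ENNReal.Tendsto.const_mul h (Or.inr hφ.2.ne)
  · refine (le_of_eq ?_).trans (eLpNorm_mul_le hφ.1 ((hF n).1.sub hG.1))
    congr 1
    ext z
    simp only [Pi.sub_apply, Pi.mul_apply]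
    ring

theorem integral_mul_dbar_eq {ψ χ : ℂ → ℂ} (hψ : TestFn univ ψ) (hχ : TestFn univ χ) :
    ∫ z, dbar ψ z * χ z = -∫ z, ψ z * dbar χ z := by
  have h := hψ.mul_smooth isOpen_univ hχ.smooth.contDiffOn
  have h1 := integral_dbar_eq_zero (one_of_smooth h.smooth) h.cpt
  have i1 := (hψ.mul_smooth isOpen_univ hχ.dbar.smooth.contDiffOn).integrable
  have i2 := (hψ.dbar.mul_smooth isOpen_univ hχ.smooth.contDiffOn).integrable
  have h2 : ∫ z, dbar (fun z => ψ z * χ z) z = ∫ z, (ψ z * dbar χ z + dbar ψ z * χ z) := by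
    congr 1 with z
    rw [dbar_mul (hψ.differentiable z) (hχ.differentiable z)]
    ring
  rw [h1, integral_add i1 i2] at h2
  linear_combination -h2

theorem integral_mul_dd_eq {ψ χ : ℂ → ℂ} (hψ : TestFn univ ψ) (hχ : TestFn univ χ) :
    ∫ z, dd ψ z * χ z = -∫ z, ψ z * dd χ z := by
  have h := hψ.mul_smooth isOpen_univ hχ.smooth.contDiffOn
  have h1 := integral_dd_eq_zero (one_of_smooth h.smooth) h.cpt
  have i1 := (hψ.mul_smooth isOpen_univ hχ.dd.smooth.contDiffOn).integrable
  have i2 := (hψ.dd.mul_smooth isOpen_univ hχ.smooth.contDiffOn).integrable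
  have h2 : ∫ z, dd (fun z => ψ z * χ z) z = ∫ z, (ψ z * dd χ z + dd ψ z * χ z) := by
    congr 1 with z
    rw [dd_mul (hψ.differentiable z) (hχ.differentiable z)]
    ring
  rw [h1, integral_add i1 i2] at h2
  linear_combination -h2

theorem TestSeq.integral_dbar (ts : TestSeq Ω χ u g v) {ψ : ℂ → ℂ} (hψ : TestFn univ ψ) :
    ∫ z, dbar ψ z * u z = -∫ z, ψ z * g z := by
  have h1 := tendsto_integral_mul (fun n => (ts.test n).memLp 2) ts.memu (hψ.dbar.memLp 2) ts.limu
  have h2 := tendsto_integral_mul (fun n => (ts.test n).dbar.memLp 2) ts.memg (hψ.memLp 2) ts.limg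
  refine tendsto_nhds_unique h1 (h2.neg.congr fun n => ?_)
  rw [integral_mul_dbar_eq hψ ((ts.test n).mono (subset_univ _))]

theorem TestSeq.integral_dd (ts : TestSeq Ω χ u g v) {ψ : ℂ → ℂ} (hψ : TestFn univ ψ) :
    ∫ z, dd ψ z * u z = -∫ z, ψ z * v z := by
  have h1 := tendsto_integral_mul (fun n => (ts.test n).memLp 2) ts.memu (hψ.dd.memLp 2) ts.limu
  have h2 := tendsto_integral_mul (fun n => (ts.test n).dd.memLp 2) ts.memv (hψ.memLp 2) ts.limv
  refine tendsto_nhds_unique h1 (h2.neg.congr fun n => ?_)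
  rw [integral_mul_dd_eq hψ ((ts.test n).mono (subset_univ _))]

/-- Pairing a test function with a Cauchy transform. -/
theorem integral_mul_cauchy {h ψ : ℂ → ℂ} {B : ℝ} (hψ : TestFn univ ψ) (hi : Integrable h)
    (hb : ∀ z, ‖h z‖ ≤ B) :
    ∫ z, ψ z * ∫ ζ, cauchyKer (z - ζ) * h ζ = ∫ ζ, -cauchyT ψ ζ * h ζ := by
  rw [cauchyKer_fubini hψ.integrable hi hb]
  congr 1 with ζ
  rw [cauchyT_eq_integral_sub, ← integral_neg]
  congr 2 with z
  rw [← neg_sub, cauchyKer, cauchyKer, inv_neg]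
  ring

theorem TestSeq.ae_eq_cauchy (ts : TestSeq Ω χ u g v) (hΩ : IsOpen Ω)
    (hb : Bornology.IsBounded Ω) (hgm : Measurable g) (hg0 : EqOn g 0 Ωᶜ) {B : ℝ}
    (hgb : ∀ z, ‖g z‖ ≤ B) :
    ∀ᵐ z, u z = ∫ ζ, cauchyKer (z - ζ) * g ζ := by
  have hfin := isFiniteMeasure_restrict_of_isBounded hb
  have hgi : Integrable g := by
    have h1 : IntegrableOn g Ω := (ts.memg.restrict Ω).integrable one_le_two
    refine h1.integrable_of_forall_notMem_eq_zero fun z hz => hg0 hz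
  have hbd := fun z => cauchyKer_mul_bound hgi hgb z
  set CT : ℂ → ℂ := fun z => ∫ ζ, cauchyKer (z - ζ) * g ζ with hCT
  have hm : StronglyMeasurable CT := by
    apply StronglyMeasurable.integral_prod_right
    refine Measurable.stronglyMeasurable ?_
    exact (measurable_cauchyKer.comp (measurable_fst.sub measurable_snd)).mul
      (hgm.comp measurable_snd)
  have hCTl : LocallyIntegrable CT := by
    have h1 : LocallyIntegrable (fun _ : ℂ => B * kerMass + ∫ z, ‖g z‖) :=
      continuous_const.locallyIntegrable
    refine h1.mono hm.aestronglyMeasurable (ae_of_all _ fun z => ?_)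
    exact (norm_integral_le_integral_norm _).trans ((hbd z).2.trans (le_abs_self _))
  have hul : LocallyIntegrable u := ts.memu.locallyIntegrable one_le_two
  have key : ∀ ψ, TestFn univ ψ → ∫ z, ψ z * u z = ∫ z, ψ z * CT z := by
    intro ψ hψ
    have h1 := tendsto_integral_mul (fun n => (ts.test n).memLp 2) ts.memu (hψ.memLp 2) ts.limu
    have hc : Continuous (fun z => -cauchyT ψ z) :=
        (contDiff_cauchyT hψ.smooth hψ.cpt).continuous.neg
    have hcm : MemLp (fun z => -cauchyT ψ z) 2 (volume.restrict Ω) :=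
      memLp_of_bounded_on hΩ hb hc.continuousOn (bounded_on_of_continuous hb hc)
    have h2 := tendsto_integral_mul (μ := volume.restrict Ω)
      (fun n => ((ts.test n).dbar.memLp 2).restrict Ω) (ts.memg.restrict Ω) hcm
      (tendsto_of_tendsto_of_tendsto_of_le_of_le tendsto_const_nhds ts.limg (fun _ => zero_le)
        fun n => eLpNorm_mono_measure _ Measure.restrict_le_self)
    refine tendsto_nhds_unique h1 ?_
    have e : ∫ z, ψ z * CT z = ∫ z in Ω, -cauchyT ψ z * g z := by
      rw [hCT, integral_mul_cauchy hψ hgi hgb]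
      refine (setIntegral_eq_integral_of_forall_compl_eq_zero fun z hz => ?_).symm
      rw [hg0 hz]; simp
    rw [e]
    refine h2.congr fun n => ?_
    have hd := (ts.test n).dbar
    obtain ⟨C, hC⟩ := hd.smooth.continuous.bounded_above_of_compact_support hd.cpt
    rw [setIntegral_eq_of_testFn hd, ← integral_mul_cauchy hψ hd.integrable hC]
    congr 1 with z
    rw [← cauchyT_eq_integral_sub, cauchyT_dbar (one_of_smooth (ts.test n).smooth) (ts.test n).cpt]
  refine ae_eq_of_integral_contDiff_smul_eq hul hCTl fun ψ h1 h2 => ?_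
  have hψ : TestFn univ (fun z => (ψ z : ℂ)) :=
    ⟨ofRealCLM.contDiff.comp h1, h2.comp_left (g := fun x : ℝ => (x : ℂ)) (by simp), subset_univ _⟩
  simpa only [real_smul] using key _ hψ

theorem norm_le_of_ae (hΩ : IsOpen Ω) {U : ℂ → ℂ} (hU : ContinuousOn U Ω) {M : ℝ}
    (h : ∀ᵐ z, z ∈ Ω → ‖U z‖ ≤ M) : ∀ z ∈ Ω, ‖U z‖ ≤ M := by
  intro z hz
  by_contra! hlt
  have ho : IsOpen (Ω ∩ (fun z => ‖U z‖) ⁻¹' Ioi M) :=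
    hU.norm.isOpen_inter_preimage hΩ isOpen_Ioi
  have h0 : volume (Ω ∩ (fun z => ‖U z‖) ⁻¹' Ioi M) = 0 :=
    measure_mono_null (t := {y | ¬ (y ∈ Ω → ‖U y‖ ≤ M)})
      (fun y hy (h' : y ∈ Ω → ‖U y‖ ≤ M) => absurd (h' hy.1) (not_le.2 hy.2)) h
  exact (ho.measure_pos volume ⟨z, hz, hlt⟩).ne' h0

end Potential

section Approximation

variable {Ω : Set ℂ} {χ : ℕ → ℂ → ℂ} {u g v U f φ : ℂ → ℂ}

/-- `U` is the limit of the test functions `χ n` in the Sobolev space `W^{1,2}(Ω)`. -/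
structure Approx (Ω : Set ℂ) (χ : ℕ → ℂ → ℂ) (U : ℂ → ℂ) : Prop where
  test : ∀ n, TestFn Ω (χ n)
  lim : Filter.Tendsto (fun n => eLpNorm (χ n - U) 2 (volume.restrict Ω)) Filter.atTop (𝓝 0)
  lim_dbar : Filter.Tendsto (fun n => eLpNorm (dbar (χ n) - dbar U) 2 (volume.restrict Ω))
    Filter.atTop (𝓝 0)
  lim_dd : Filter.Tendsto (fun n => eLpNorm (dd (χ n) - dd U) 2 (volume.restrict Ω))
    Filter.atTop (𝓝 0)

theorem Approx.comp (h : Approx Ω χ U) {s : ℕ → ℕ} (hs : StrictMono s) :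
    Approx Ω (fun n => χ (s n)) U :=
  ⟨fun _ => h.test _, h.lim.comp hs.tendsto_atTop, h.lim_dbar.comp hs.tendsto_atTop,
    h.lim_dd.comp hs.tendsto_atTop⟩

theorem Approx.conj (hΩ : IsOpen Ω) (hU : Nice Ω U) (h : Approx Ω χ U) :
    Approx Ω (fun n z => conj (χ n z)) (fun z => conj (U z)) := by
  have aux : ∀ {a b c d : ℂ → ℂ}, (∀ z ∈ Ω, ‖a z - b z‖ = ‖c z - d z‖) →
      eLpNorm (a - b) 2 (volume.restrict Ω) = eLpNorm (c - d) 2 (volume.restrict Ω) := by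
    intro a b c d h
    refine eLpNorm_congr_norm_ae ?_
    filter_upwards [ae_restrict_mem hΩ.measurableSet] with z hz using h z hz
  have hn : ∀ a b : ℂ, ‖conj a - conj b‖ = ‖a - b‖ := fun a b => by
    rw [← map_sub, norm_conj]
  refine ⟨fun n => (h.test n).conj, h.lim.congr fun n => aux fun z _ => (hn _ _).symm,
    h.lim_dd.congr fun n => aux fun z hz => ?_, h.lim_dbar.congr fun n => aux fun z hz => ?_⟩
  · rw [dbar_conj ((h.test n).differentiable z), dbar_conj (hU.differentiableAt hΩ hz), hn]
  · rw [dd_conj ((h.test n).differentiable z), dd_conj (hU.differentiableAt hΩ hz), hn]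

theorem tendsto_integral_bdd_mul {μ : Measure ℂ} {F a : ℕ → ℂ → ℂ} {G h A : ℂ → ℂ} {M : ℝ}
    (hF : ∀ n, MemLp (F n) 2 μ) (hG : MemLp G 2 μ) (hh : MemLp h 2 μ)
    (hlim : Filter.Tendsto (fun n => eLpNorm (F n - G) 2 μ) Filter.atTop (𝓝 0))
    (ha : ∀ n, AEStronglyMeasurable (a n) μ) (hb : ∀ n z, ‖a n z‖ ≤ M)
    (hA : ∀ᵐ z ∂μ, Filter.Tendsto (fun n => a n z) Filter.atTop (𝓝 (A z))) :
    Filter.Tendsto (fun n => ∫ z, a n z * (h z * F n z) ∂μ) Filter.atTop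
      (𝓝 (∫ z, A z * (h z * G z) ∂μ)) := by
  have i1 : ∀ n, Integrable (fun z => a n z * (h z * G z)) μ := fun n =>
    (hh.integrable_mul hG).bdd_mul (ha n) (ae_of_all _ (hb n))
  have i2 : ∀ n, Integrable (fun z => a n z * (h z * (F n z - G z))) μ := fun n =>
    (hh.integrable_mul ((hF n).sub hG)).bdd_mul (ha n) (ae_of_all _ (hb n))
  have h1 : Filter.Tendsto (fun n => ∫ z, a n z * (h z * G z) ∂μ) Filter.atTop
      (𝓝 (∫ z, A z * (h z * G z) ∂μ)) := by
    refine tendsto_integral_of_dominated_convergence (fun z => M * ‖h z * G z‖)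
      (fun n => (i1 n).1) ((hh.integrable_mul hG).norm.const_mul M)
          (fun n => ae_of_all _ fun z => ?_)
      ?_
    · rw [norm_mul]
      exact mul_le_mul_of_nonneg_right (hb n z) (norm_nonneg _)
    · filter_upwards [hA] with z hz using hz.mul_const _
  have h2 : Filter.Tendsto (fun n => ∫ z, a n z * (h z * (F n z - G z)) ∂μ) Filter.atTop (𝓝 0) := by
    have h3 := tendsto_integral_of_L1' (μ := μ) (fun _ : ℂ => (0 : ℂ)) aestronglyMeasurable_const
      (F := fun n z => a n z * (h z * (F n z - G z))) (Filter.Eventually.of_forall i2)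
      (l := Filter.atTop) ?_
    · simpa using h3
    refine tendsto_of_tendsto_of_tendsto_of_le_of_le tendsto_const_nhds (h := fun n =>
      ENNReal.ofReal M * eLpNorm h 2 μ * eLpNorm (F n - G) 2 μ) ?_ (fun _ => zero_le) fun n => ?_
    · simpa using ENNReal.Tendsto.const_mul hlim
        (Or.inr (ENNReal.mul_ne_top ENNReal.ofReal_ne_top hh.2.ne))
    · simp only [mul_assoc]
      refine le_trans (eLpNorm_le_mul_eLpNorm_of_ae_le_mul (g := fun z => h z * (F n z - G z))
        (c := M) (ae_of_all _ fun z => ?_) 1) ?_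
      · simp only [Pi.sub_apply, sub_zero, norm_mul (a n z)]
        exact mul_le_mul_of_nonneg_right (hb n z) (norm_nonneg _)
      · exact mul_le_mul_right (eLpNorm_mul_le hh.1 ((hF n).1.sub hG.1)) _
  have h3 := h1.add h2
  rw [add_zero] at h3
  refine h3.congr fun n => ?_
  rw [← integral_add (i1 n) (i2 n)]
  congr 1 with z
  ring

theorem dbar_comp {θ χ : ℂ → ℂ} {z : ℂ} (hθ : DifferentiableAt ℝ θ (χ z))
    (hχ : DifferentiableAt ℝ χ z) : dbar (fun z => θ (χ z)) z =
      dd θ (χ z) * dbar χ z + dbar θ (χ z) * conj (dd χ z) := by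
  have h1 : ∀ v, fderiv ℝ (fun z => θ (χ z)) z v = fderiv ℝ θ (χ z) (fderiv ℝ χ z v) := fun v => by
    rw [fderiv_fun_comp z hθ hχ]; rfl
  simp only [dbar]
  rw [h1, h1, fderiv_eq_dd_dbar θ, fderiv_eq_dd_dbar θ]
  simp only [dbar, dd, map_sub, map_mul, map_div₀, conj_I, map_ofNat]
  ring

/-- A smooth truncation of the identity. -/
theorem exists_truncation (M : ℝ) (hM : 0 ≤ M) : ∃ θ : ℂ → ℂ, TestFn univ θ ∧ θ 0 = 0 ∧
    ∀ z, ‖z‖ ≤ M → θ z = z ∧ dd θ z = 1 ∧ dbar θ z = 0 := by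
  let b : ContDiffBump (0 : ℂ) := ⟨M + 1, M + 2, by linarith, by linarith⟩
  have h1 : ContDiff ℝ ∞ (fun z => (b z : ℂ)) := ofRealCLM.contDiff.comp b.contDiff
  refine ⟨fun z => b z * z, ⟨h1.mul contDiff_id, ?_, subset_univ _⟩, by simp, fun z hz => ?_⟩
  · exact HasCompactSupport.mul_right
      (b.hasCompactSupport.comp_left (g := fun x : ℝ => (x : ℂ)) (by simp))
  · have h2 : (fun z => (b z : ℂ) * z) =ᶠ[𝓝 z] id := by
      filter_upwards [isOpen_ball.mem_nhds (show z ∈ ball (0 : ℂ) (M + 1) by simp; linarith)]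
        with y hy
      rw [b.one_of_mem_closedBall (ball_subset_closedBall hy)]
      simp
    have h3 : fderiv ℝ (fun z => (b z : ℂ) * z) z = fderiv ℝ id z := h2.fderiv_eq
    refine ⟨h2.eq_of_nhds, ?_, ?_⟩
    · rw [dd, h3, ← dd, dd_holo differentiableAt_id, deriv_id]
    · rw [dbar, h3, ← dbar, dbar_holo differentiableAt_id]

theorem TestFn.comp_left {θ χ : ℂ → ℂ} (hχ : TestFn Ω χ) (hθ : ContDiff ℝ ∞ θ) (h0 : θ 0 = 0) :
    TestFn Ω (fun z => θ (χ z)) :=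
  ⟨hθ.comp hχ.smooth, hχ.cpt.comp_left h0, (tsupport_comp_subset h0 χ).trans hχ.sub⟩

theorem Approx.integral_eq_zero (hΩ : IsOpen Ω) (hU : Nice Ω U) (h : Approx Ω χ U)
    (hφ : Nice Ω φ) (hf : BergmanFun Ω f) (hUm : MemLp U 2 (volume.restrict Ω)) :
    ∫ z in Ω, f z * dbar (fun z => φ z * U z) z = 0 := by
  obtain ⟨s, hs, hae⟩ := (tendstoInMeasure_of_tendsto_eLpNorm (p := 2) (by simp)
    (fun n => ((h.test n).memLp 2).1.restrict) hUm.1 h.lim).exists_seq_tendsto_ae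
  replace h := h.comp hs
  set X : ℕ → ℂ → ℂ := fun n => χ (s n) with hX
  obtain ⟨M, hM⟩ := hU.bdd
  obtain ⟨θ, hθ, hθ0, hθ1⟩ := exists_truncation |M| (abs_nonneg M)
  have hbd : ∀ {κ : ℂ → ℂ}, TestFn univ κ → ∃ B, ∀ z, ‖κ z‖ ≤ B := fun hκ =>
    hκ.smooth.continuous.bounded_above_of_compact_support hκ.cpt
  have hlim : ∀ {κ : ℂ → ℂ}, TestFn univ κ → ∀ᵐ z ∂(volume.restrict Ω),
      Filter.Tendsto (fun n => κ (X n z)) Filter.atTop (𝓝 (κ (U z))) := fun hκ => by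
    filter_upwards [hae] with z hz using (hκ.smooth.continuous.tendsto _).comp hz
  have hmeas : ∀ {κ : ℂ → ℂ}, TestFn univ κ → ∀ n,
      AEStronglyMeasurable (fun z => κ (X n z)) (volume.restrict Ω) := fun hκ n =>
    (hκ.smooth.continuous.comp (h.test n).smooth.continuous).aestronglyMeasurable
  have hfm := ((bergmanFun_iff hΩ).1 hf).2
  have hfφ := hφ.memLp_mul hΩ hfm
  obtain ⟨B₀, hB₀⟩ := hbd hθ
  obtain ⟨B₁, hB₁⟩ := hbd hθ.dd
  obtain ⟨B₂, hB₂⟩ := hbd hθ.dbar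
  have hcl : Filter.Tendsto (fun n => eLpNorm ((fun z => conj (dd (X n) z)) -
      (fun z => conj (dd U z))) 2 (volume.restrict Ω)) Filter.atTop (𝓝 0) :=
    h.lim_dd.congr fun n => eLpNorm_congr_norm_ae (ae_of_all _ fun z => by
      simp only [Pi.sub_apply]; rw [← map_sub, norm_conj])
  have t0 := tendsto_integral_bdd_mul (μ := volume.restrict Ω) (F := fun _ => dbar φ)
    (fun _ => hφ.memLp_dbar) hφ.memLp_dbar hfm (by simp) (hmeas hθ) (fun n z => hB₀ _) (hlim hθ)
  have t1 := tendsto_integral_bdd_mul (fun n => ((h.test n).dbar.memLp 2).restrict Ω)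
    hU.memLp_dbar hfφ h.lim_dbar (hmeas hθ.dd) (fun n z => hB₁ _) (hlim hθ.dd)
  have t2 := tendsto_integral_bdd_mul (fun n => ((h.test n).dd.memLp 2).star.restrict Ω)
    (MemLp.star hU.memLp_dd) hfφ hcl (hmeas hθ.dbar) (fun n z => hB₂ _) (hlim hθ.dbar)
  have hbi : ∀ {κ h F : ℂ → ℂ} {B : ℝ}, AEStronglyMeasurable κ (volume.restrict Ω) →
      (∀ z ∈ Ω, ‖κ z‖ ≤ B) → MemLp h 2 (volume.restrict Ω) → MemLp F 2 (volume.restrict Ω) →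
      Integrable (fun z => κ z * (h z * F z)) (volume.restrict Ω) := fun hκ hB hh hF =>
    (hh.integrable_mul hF).bdd_mul hκ (by
      filter_upwards [ae_restrict_mem hΩ.measurableSet] with z hz using hB z hz)
  have t := (t0.add t1).add t2
  have hMU : ∀ z ∈ Ω, ‖U z‖ ≤ |M| := fun z hz => (hM z hz).trans (le_abs_self _)
  have e1 : ∫ z in Ω, f z * dbar (fun z => φ z * U z) z =
      (∫ z in Ω, θ (U z) * (f z * dbar φ z)) + (∫ z in Ω, dd θ (U z) * ((φ z * f z) * dbar U z)) +
        ∫ z in Ω, dbar θ (U z) * ((φ z * f z) * conj (dd U z)) := by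
    have hUc : ∀ {κ : ℂ → ℂ}, TestFn univ κ →
        AEStronglyMeasurable (fun z => κ (U z)) (volume.restrict Ω) := fun hκ =>
      (hκ.smooth.continuous.comp_continuousOn hU.smooth.continuousOn).aestronglyMeasurable
        hΩ.measurableSet
    rw [← integral_add (hbi (hUc hθ) (fun _ _ => hB₀ _) hfm hφ.memLp_dbar)
      (hbi (hUc hθ.dd) (fun _ _ => hB₁ _) hfφ hU.memLp_dbar), ← integral_add]
    · refine setIntegral_congr_fun hΩ.measurableSet fun z hz => ?_
      obtain ⟨h1, h2, h3⟩ := hθ1 _ (hMU z hz)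
      simp only [h1, h2, h3, dbar_mul (hφ.differentiableAt hΩ hz) (hU.differentiableAt hΩ hz)]
      ring
    · exact (hbi (hUc hθ) (fun _ _ => hB₀ _) hfm hφ.memLp_dbar).add
        (hbi (hUc hθ.dd) (fun _ _ => hB₁ _) hfφ hU.memLp_dbar)
    · exact hbi (hUc hθ.dbar) (fun _ _ => hB₂ _) hfφ (MemLp.star hU.memLp_dd)
  rw [e1]
  refine tendsto_nhds_unique t (tendsto_const_nhds.congr fun n => ?_)
  have hT := (h.test n).comp_left hθ.smooth hθ0
  rw [← integral_mul_dbar_testFn hΩ (hT.mul_smooth hΩ hφ.smooth) hf.1]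
  have j0 := hbi (hmeas hθ n) (fun _ _ => hB₀ _) hfm hφ.memLp_dbar
  have j1 := hbi (hmeas hθ.dd n) (fun _ _ => hB₁ _) hfφ (((h.test n).dbar.memLp 2).restrict Ω)
  have j2 := hbi (hmeas hθ.dbar n) (fun _ _ => hB₂ _) hfφ (((h.test n).dd.memLp 2).star.restrict Ω)
  rw [← integral_add j0 j1, ← integral_add ?_ j2]
  swap
  · exact j0.add j1
  refine setIntegral_congr_fun hΩ.measurableSet fun z hz => ?_
  simp only [dbar_mul (hT.differentiable z) (hφ.differentiableAt hΩ hz),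
    dbar_comp (hθ.differentiable _) ((h.test n).differentiable z), Pi.star_apply]
  simp only [RCLike.star_def]
  ring

theorem Approx.null (hΩ : IsOpen Ω) (hb : Bornology.IsBounded Ω) (hU : Nice Ω U)
    (h : Approx Ω χ U) : Null Ω U := by
  have hUm := memLp_of_bounded_on hΩ hb hU.smooth.continuousOn hU.bdd
  refine ⟨hU, fun φ hφ f hf => ⟨h.integral_eq_zero hΩ hU hφ hf hUm, ?_⟩⟩
  simp only [map_mul]
  exact (h.conj hΩ hU).integral_eq_zero hΩ (hU.conj hΩ) (hφ.conj hΩ) hf (MemLp.star hUm)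

end Approximation

section Schottky

variable {Ω : Set ℂ} {χ : ℕ → ℂ → ℂ} {u g v U f φ : ℂ → ℂ}

theorem TestSeq.approx (hΩ : IsOpen Ω) (ts : TestSeq Ω χ u g v) (hu : ∀ᵐ z, z ∈ Ω → u z = U z)
    (hg : ∀ z ∈ Ω, g z = dbar U z) (hv : ∀ᵐ z, z ∈ Ω → v z = dd U z) : Approx Ω χ U := by
  have aux : ∀ {a b : ℂ → ℂ} {c : ℕ → ℂ → ℂ}, (∀ᵐ z, z ∈ Ω → a z = b z) →
      Filter.Tendsto (fun n => eLpNorm (c n - a) 2 volume) Filter.atTop (𝓝 0) →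
      Filter.Tendsto (fun n => eLpNorm (c n - b) 2 (volume.restrict Ω)) Filter.atTop (𝓝 0) := by
    intro a b c h h1
    have h2 : a =ᵐ[volume.restrict Ω] b := (ae_restrict_iff' hΩ.measurableSet).2 h
    refine tendsto_of_tendsto_of_tendsto_of_le_of_le tendsto_const_nhds h1 (fun _ => zero_le)
      fun n => ?_
    rw [← eLpNorm_congr_ae ((Filter.EventuallyEq.refl _ (c n)).sub h2)]
    exact eLpNorm_mono_measure _ Measure.restrict_le_self
  exact ⟨ts.test, aux hu ts.limu, aux (ae_of_all _ hg) ts.limg, aux hv ts.limv⟩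

theorem TestSeq.dd_ae_eq (hΩ : IsOpen Ω) (ts : TestSeq Ω χ u g v) (hU : ContDiffOn ℝ ∞ U Ω)
    (hu : ∀ᵐ z, z ∈ Ω → u z = U z) : ∀ᵐ z, z ∈ Ω → v z = dd U z := by
  have hUc : ContinuousOn (dd U) Ω := by
    have h1 : ContinuousOn (fderiv ℝ U) Ω := hU.continuousOn_fderiv_of_isOpen hΩ (by simp)
    exact ((h1.clm_apply continuousOn_const).sub
      (continuousOn_const.mul (h1.clm_apply continuousOn_const))).div_const _
  have hl : LocallyIntegrableOn (fun z => v z - dd U z) Ω :=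
    ((ts.memv.locallyIntegrable one_le_two).locallyIntegrableOn Ω).sub
      (hUc.locallyIntegrableOn hΩ.measurableSet)
  have := hΩ.ae_eq_zero_of_integral_contDiff_smul_eq_zero hl fun ψ h1 h2 h3 => ?_
  · filter_upwards [this] with z hz h using sub_eq_zero.1 (hz h)
  have hψ : TestFn Ω (fun z => (ψ z : ℂ)) :=
    ⟨ofRealCLM.contDiff.comp h1, h2.comp_left (g := fun x : ℝ => (x : ℂ)) (by simp),
      (tsupport_comp_subset (g := fun x : ℝ => (x : ℂ)) (by simp) ψ).trans h3⟩
  simp only [real_smul, mul_sub]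
  have e := ts.integral_dd (hψ.mono (subset_univ _))
  have hm := hψ.mul_smooth hΩ hU
  have hdm : ∀ z, dd (fun z => (ψ z : ℂ) * U z) z =
      ψ z * dd U z + dd (fun z => (ψ z : ℂ)) z * U z := by
    intro z
    by_cases hz : z ∈ Ω
    · rw [dd_mul (hψ.differentiable z)
        ((hU.contDiffAt (hΩ.mem_nhds hz)).differentiableAt (by simp))]
      ring
    · rw [hm.dd.zero_of_notMem hz, hψ.dd.zero_of_notMem hz]
      simp [hψ.zero_of_notMem hz]
  have hψU : Integrable (fun z => dd (fun z => (ψ z : ℂ)) z * U z) :=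
    (hψ.dd.mul_smooth hΩ hU).integrable
  have i2 : Integrable (fun z => (ψ z : ℂ) * dd U z) := by
    refine (hm.dd.integrable.sub hψU).congr (ae_of_all _ fun z => ?_)
    simp only [Pi.sub_apply, hdm]
    ring
  have i1 : Integrable (fun z => (ψ z : ℂ) * v z) := (hψ.memLp 2).integrable_mul ts.memv
  have h4 := integral_dd_eq_zero (one_of_smooth hm.smooth) hm.cpt
  simp only [hdm] at h4
  rw [integral_add i2 hψU] at h4
  rw [integral_sub i1 i2]
  have h5 : ∫ z, dd (fun z => (ψ z : ℂ)) z * u z = ∫ z, dd (fun z => (ψ z : ℂ)) z * U z := by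
    refine integral_congr_ae ?_
    filter_upwards [hu] with z hz
    by_cases h : z ∈ Ω
    · rw [hz h]
    · rw [hψ.dd.zero_of_notMem h]; simp
  rw [h5] at e
  linear_combination e - h4

theorem contDiff_conj : ContDiff ℝ ∞ (fun z : ℂ => conj z) := conjCLE.contDiff

theorem dbar_conj_id (z : ℂ) : dbar (fun z => conj z) z = 1 := by
  have := dbar_conj (u := fun z => z) (z := z) differentiableAt_fun_id
  rw [this, dd_holo differentiableAt_fun_id]; simp

theorem dbar_poly_conj (p : Polynomial ℂ) (z : ℂ) :
    dbar (fun z => p.eval z * conj z) z = p.eval z := by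
  have hp : DifferentiableAt ℂ (fun z => p.eval z) z := p.differentiable z
  rw [dbar_mul (hp.restrictScalars ℝ) (contDiff_conj.differentiable (by simp) z),
    dbar_conj_id, dbar_holo hp]
  ring

/-- An annihilating polynomial `p` produces a holomorphic `G` with `p z * conj z = G` on the
boundary of `Ω`. -/
theorem exists_schottky (hΩ : IsOpen Ω) (hb : Bornology.IsBounded Ω) (p : Polynomial ℂ)
    (hp : ∀ f, BergmanFun Ω f → ∫ z in Ω, p.eval z * f z = 0) :
    ∃ G : ℂ → ℂ, DifferentiableOn ℂ G Ω ∧ Nice Ω G ∧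
      Null Ω (fun z => p.eval z * conj z - G z) := by
  have hfin := isFiniteMeasure_restrict_of_isBounded hb
  have hpn := nice_polynomial hΩ hb p
  have hpc : ContDiff ℝ ∞ (fun z => p.eval z * conj z) :=
    (p.differentiable.contDiff.restrict_scalars ℝ).mul contDiff_conj
  obtain ⟨B, hB⟩ := hpn.bdd
  set g : ℂ → ℂ := Ω.indicator (fun z => p.eval z) with hg
  have hg0 : EqOn g 0 Ωᶜ := fun z hz => indicator_of_notMem hz _
  have hg1 : ∀ z ∈ Ω, g z = p.eval z := fun z hz => indicator_of_mem hz _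
  have hgm : Measurable g := p.continuous.measurable.indicator hΩ.measurableSet
  have hgb : ∀ z, ‖g z‖ ≤ |B| := fun z => by
    by_cases hz : z ∈ Ω
    · rw [hg1 z hz]; exact (hB z hz).trans (le_abs_self _)
    · rw [hg0 hz]; simp
  have hgL : MemLp g 2 volume := (memLp_indicator_iff_restrict hΩ.measurableSet).2
    (memLp_of_bounded_on hΩ hb p.continuous.continuousOn hpn.bdd)
  obtain ⟨χ, u, v, ts⟩ := exists_testSeq hΩ hb.measure_lt_top hgL hg0 fun f hf => by
    rw [← hp f hf]
    exact setIntegral_congr_fun hΩ.measurableSet fun z hz => by simp only [hg1 z hz]; ring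
  have hul : LocallyIntegrable u := ts.memu.locallyIntegrable one_le_two
  have hcz : LocallyIntegrable (fun z => p.eval z * conj z) := hpc.continuous.locallyIntegrable
  obtain ⟨G, hG, hGu⟩ := weyl hΩ (f := fun z => p.eval z * conj z - u z) (hcz.sub hul)
    fun ψ hψ => by
      have hψ' := hψ.mono (subset_univ Ω)
      have h1 := hψ.mul_smooth hΩ hpc.contDiffOn
      have h2 := integral_dbar_eq_zero (one_of_smooth h1.smooth) h1.cpt
      have j1 := (hψ.mul_smooth hΩ hpn.smooth).integrable
      have j2 := (hψ.dbar.mul_smooth hΩ hpc.contDiffOn).integrable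
      have j3 : Integrable (fun z => dbar ψ z * u z) := (hψ.dbar.memLp 2).integrable_mul ts.memu
      have h3 : ∫ z, dbar (fun z => ψ z * (p.eval z * conj z)) z =
          ∫ z, (ψ z * p.eval z + dbar ψ z * (p.eval z * conj z)) := by
        congr 1 with z
        rw [dbar_mul (hψ.differentiable z) (hpc.differentiable (by simp) z), dbar_poly_conj]
        ring
      rw [h2, integral_add j1 j2] at h3
      have h4 := ts.integral_dbar hψ'
      have h5 : ∫ z, ψ z * g z = ∫ z, ψ z * p.eval z := by
        congr 1 with z
        by_cases hz : z ∈ Ω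
        · rw [hg1 z hz]
        · rw [hψ.zero_of_notMem hz]; simp
      have h6 : ∫ z, (p.eval z * conj z - u z) * dbar ψ z =
          ∫ z, (dbar ψ z * (p.eval z * conj z) - dbar ψ z * u z) := by
        congr 1 with z; ring
      rw [h6, integral_sub j2 j3]
      linear_combination -h3 - h4 + h5
  set U : ℂ → ℂ := fun z => p.eval z * conj z - G z with hU
  have hUu : ∀ᵐ z, z ∈ Ω → u z = U z := by
    filter_upwards [hGu] with z hz h
    simp only [hU]
    rw [← hz h]; ring
  have hUs : ContDiffOn ℝ ∞ U Ω := hpc.contDiffOn.sub (hG.contDiffOn_real hΩ)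
  have hGd : ∀ z ∈ Ω, DifferentiableAt ℂ G z := fun z hz => hG.differentiableAt (hΩ.mem_nhds hz)
  have hUg : ∀ z ∈ Ω, g z = dbar U z := fun z hz => by
    rw [hg1 z hz, hU, dbar_sub (hpc.differentiable (by simp) z) ((hGd z hz).restrictScalars ℝ),
      dbar_poly_conj, dbar_holo (hGd z hz), sub_zero]
  have hUv := ts.dd_ae_eq hΩ hUs hUu
  have hUb : ∃ M, ∀ z ∈ Ω, ‖U z‖ ≤ M := by
    have hgi' : IntegrableOn g Ω := (ts.memg.restrict Ω).integrable one_le_two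
    have hgi := hgi'.integrable_of_forall_notMem_eq_zero fun z hz => hg0 hz
    refine ⟨_, norm_le_of_ae hΩ hUs.continuousOn (M := |B| * kerMass + ∫ z, ‖g z‖) ?_⟩
    filter_upwards [hUu, ts.ae_eq_cauchy hΩ hb hgm hg0 hgb] with z h1 h2 hz
    rw [← h1 hz, h2]
    exact (norm_integral_le_integral_norm _).trans (cauchyKer_mul_bound hgi hgb z).2
  have hUn : Nice Ω U :=
    ⟨hUs, hUb, (ts.memg.restrict Ω).ae_eq ((ae_restrict_iff' hΩ.measurableSet).2 (ae_of_all _ hUg)),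
      (ts.memv.restrict Ω).ae_eq ((ae_restrict_iff' hΩ.measurableSet).2 hUv)⟩
  refine ⟨G, hG, ?_, (ts.approx hΩ hUu hUg hUv).null hΩ hb hUn⟩
  exact ((nice_of_smooth hΩ hb hpc).add hΩ ((nice_of_smooth hΩ hb
    (contDiff_const (c := (-1 : ℂ)))).mul hΩ hUn)).congr hΩ fun z _ => by simp only [hU]; ring

end Schottky

section NiceAlgebra

variable {Ω : Set ℂ} {u v f : ℂ → ℂ}

theorem exists_point_cutoff (hΩ : IsOpen Ω) {w : ℂ} (hw : w ∈ Ω) :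
    ∃ η ψ : ℂ → ℂ, TestFn Ω η ∧ ContDiff ℝ ∞ ψ ∧ ∀ z, η z + ψ z * (z - w) = 1 := by
  obtain ⟨r, hr, -, η, hη, hη1⟩ := exists_bump hΩ hw
  refine ⟨η, fun z => (1 - η z) / (z - w), hη, ?_, fun z => ?_⟩
  · rw [contDiff_iff_contDiffAt]
    intro z
    by_cases hz : z = w
    · have h0 : (fun z => (1 - η z) / (z - w)) =ᶠ[𝓝 z] fun _ => 0 := by
        filter_upwards [ball_mem_nhds z hr] with y hy
        rw [hη1 y (hz ▸ hy), sub_self, zero_div]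
      exact contDiffAt_const.congr_of_eventuallyEq h0
    · simp only [div_eq_mul_inv]
      exact (contDiffAt_const.sub hη.smooth.contDiffAt).mul
        ((contDiffAt_id.sub contDiffAt_const).inv (sub_ne_zero.2 hz))
  · by_cases hz : z = w
    · simp [hz, hη1 w (mem_ball_self hr)]
    · rw [div_mul_cancel₀ _ (sub_ne_zero.2 hz)]
      ring

theorem Null.of_sub_mul (hΩ : IsOpen Ω) (hb : Bornology.IsBounded Ω) {w : ℂ} (hw : w ∈ Ω)
    (hv : Nice Ω v) (h : Null Ω (fun z => (z - w) * v z)) : Null Ω v := by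
  obtain ⟨η, ψ, hη, hψ, h1⟩ := exists_point_cutoff hΩ hw
  refine (((hη.mul_smooth hΩ hv.smooth).null hΩ hb).add hΩ
    (h.mul_nice hΩ (nice_of_smooth hΩ hb hψ))).congr hΩ fun z _ => ?_
  rw [← mul_assoc, ← add_mul, h1, one_mul]

theorem dslope_eq_cutoff {η ψ : ℂ → ℂ} {w : ℂ} (h1 : ∀ z, η z + ψ z * (z - w) = 1) (z : ℂ) :
    dslope f w z = η z * dslope f w z + ψ z * (f z - f w) := by
  rw [← sub_smul_dslope f w z, smul_eq_mul, ← mul_assoc, ← add_mul, h1, one_mul]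

theorem Nice.dslope (hΩ : IsOpen Ω) (hb : Bornology.IsBounded Ω) (hf : Nice Ω f)
    (hf' : DifferentiableOn ℂ f Ω) {w : ℂ} (hw : w ∈ Ω) : Nice Ω (dslope f w) := by
  obtain ⟨η, ψ, hη, hψ, h1⟩ := exists_point_cutoff hΩ hw
  have hd := (differentiableOn_dslope (hΩ.mem_nhds hw)).2 hf'
  refine ((nice_of_smooth hΩ hb (hη.mul_smooth hΩ (hd.contDiffOn_real hΩ)).smooth).add hΩ
    ((nice_of_smooth hΩ hb hψ).mul hΩ (hf.add hΩ (nice_of_smooth hΩ hb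
      (contDiff_const (c := -f w)))))).congr hΩ fun z _ => ?_
  simpa only [sub_eq_add_neg] using dslope_eq_cutoff h1 z

theorem BergmanFun.dslope (hΩ : IsOpen Ω) (hb : Bornology.IsBounded Ω) (hf : BergmanFun Ω f)
    {w : ℂ} (hw : w ∈ Ω) : BergmanFun Ω (dslope f w) := by
  obtain ⟨η, ψ, hη, hψ, h1⟩ := exists_point_cutoff hΩ hw
  have hd := (differentiableOn_dslope (hΩ.mem_nhds hw)).2 hf.1
  have hfin := isFiniteMeasure_restrict_of_isBounded hb
  refine (bergmanFun_iff hΩ).2 ⟨hd, ?_⟩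
  have h2 := nice_of_smooth hΩ hb (hη.mul_smooth hΩ (hd.contDiffOn_real hΩ)).smooth
  have h3 := (memLp_of_bounded_on hΩ hb h2.smooth.continuousOn h2.bdd).add
    ((nice_of_smooth hΩ hb hψ).memLp_mul hΩ
      (((bergmanFun_iff hΩ).1 hf).2.sub (memLp_const (f w))))
  refine h3.ae_eq (Filter.Eventually.of_forall fun z => ?_)
  simp only [Pi.add_apply, Pi.sub_apply]
  rw [← dslope_eq_cutoff h1 z]

theorem Nice.pow (hΩ : IsOpen Ω) (hb : Bornology.IsBounded Ω) (hu : Nice Ω u) (n : ℕ) :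
    Nice Ω (fun z => u z ^ n) := by
  induction n with
  | zero => simpa using nice_of_smooth hΩ hb (contDiff_const (c := (1 : ℂ)))
  | succ n ih => simpa only [pow_succ] using ih.mul hΩ hu

/-- The algebra of nice functions. -/
def niceAlg (hΩ : IsOpen Ω) (hb : Bornology.IsBounded Ω) : Subalgebra ℂ (ℂ → ℂ) where
  carrier := {v | Nice Ω v}
  mul_mem' h h' := Nice.mul hΩ h h'
  add_mem' h h' := Nice.add hΩ h h'
  algebraMap_mem' _ := nice_of_smooth hΩ hb contDiff_const

/-- The algebra of nice holomorphic functions. -/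
def holoAlg (hΩ : IsOpen Ω) (hb : Bornology.IsBounded Ω) : Subalgebra ℂ (ℂ → ℂ) where
  carrier := {v | Nice Ω v ∧ DifferentiableOn ℂ v Ω}
  mul_mem' h h' := ⟨Nice.mul hΩ h.1 h'.1, h.2.mul h'.2⟩
  add_mem' h h' := ⟨Nice.add hΩ h.1 h'.1, h.2.add h'.2⟩
  algebraMap_mem' _ := ⟨nice_of_smooth hΩ hb contDiff_const, differentiableOn_const _⟩

/-- The ideal of null functions in the algebra of nice functions. -/
def nullIdeal (hΩ : IsOpen Ω) (hb : Bornology.IsBounded Ω) : Ideal (niceAlg hΩ hb) where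
  carrier := {v | Null Ω v.1}
  zero_mem' := TestFn.null hΩ hb (testFn_zero Ω)
  add_mem' h h' := Null.add hΩ h h'
  smul_mem' c _ h := Null.mul_nice hΩ h c.2

/-- The algebra of boundary values of nice functions. -/
def BdryAlg (hΩ : IsOpen Ω) (hb : Bornology.IsBounded Ω) : Type :=
  niceAlg hΩ hb ⧸ nullIdeal hΩ hb

instance (hΩ : IsOpen Ω) (hb : Bornology.IsBounded Ω) : CommRing (BdryAlg hΩ hb) :=
  inferInstanceAs (CommRing (niceAlg hΩ hb ⧸ nullIdeal hΩ hb))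

instance (hΩ : IsOpen Ω) (hb : Bornology.IsBounded Ω) : Algebra ℂ (BdryAlg hΩ hb) :=
  inferInstanceAs (Algebra ℂ (niceAlg hΩ hb ⧸ nullIdeal hΩ hb))

/-- The projection to boundary values. -/
def toBdry (hΩ : IsOpen Ω) (hb : Bornology.IsBounded Ω) : niceAlg hΩ hb →ₐ[ℂ] BdryAlg hΩ hb :=
  Ideal.Quotient.mkₐ ℂ (nullIdeal hΩ hb)

variable (hΩ : IsOpen Ω) (hb : Bornology.IsBounded Ω)

/-- The boundary value of a nice function. -/
def bdry (h : Nice Ω v) : BdryAlg hΩ hb := toBdry hΩ hb ⟨v, h⟩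

theorem bdry_eq_iff {hu : Nice Ω u} {hv : Nice Ω v} :
    bdry hΩ hb hu = bdry hΩ hb hv ↔ Null Ω (fun z => u z - v z) :=
  Ideal.Quotient.eq

theorem bdry_eq_zero_iff {hu : Nice Ω u} : bdry hΩ hb hu = 0 ↔ Null Ω u :=
  Ideal.Quotient.eq_zero_iff_mem

/-- Boundary values of holomorphic functions. -/
def holoBdry : holoAlg hΩ hb →ₐ[ℂ] BdryAlg hΩ hb :=
  (toBdry hΩ hb).comp (Subalgebra.inclusion fun _ h => h.1)

theorem holoBdry_apply (F : holoAlg hΩ hb) : holoBdry hΩ hb F = bdry hΩ hb F.2.1 := rfl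

theorem eqOn_zero_of_holoBdry {F : holoAlg hΩ hb} (h : holoBdry hΩ hb F = 0) : EqOn F.1 0 Ω :=
  Null.eq_zero_of_holo hΩ hb ((bdry_eq_zero_iff hΩ hb).1 h) F.2.2

theorem bdry_aeval (hu : Nice Ω u) (p : Polynomial ℂ) (h : Nice Ω (fun z => p.eval (u z))) :
    bdry hΩ hb h = Polynomial.aeval (bdry hΩ hb hu) p := by
  have : (⟨fun z => p.eval (u z), h⟩ : niceAlg hΩ hb) = Polynomial.aeval ⟨u, hu⟩ p := by
    ext z
    rw [Polynomial.aeval_subalgebra_coe, Polynomial.aeval_fn_apply, Polynomial.coe_aeval_eq_eval]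
  simp only [bdry, this]
  exact (Polynomial.aeval_algHom_apply (toBdry hΩ hb) _ p).symm

/-- The coordinate function in the algebra of holomorphic functions. -/
def coordHolo : holoAlg hΩ hb := ⟨fun z => z, nice_of_smooth hΩ hb contDiff_id, differentiableOn_id⟩

theorem aeval_coordHolo_apply (p : Polynomial ℂ) (z : ℂ) :
    (Polynomial.aeval (coordHolo hΩ hb) p).1 z = p.eval z := by
  rw [Polynomial.aeval_subalgebra_coe, Polynomial.aeval_fn_apply]
  rfl

theorem nice_conj (hΩ : IsOpen Ω) (hb : Bornology.IsBounded Ω) : Nice Ω (fun z => conj z) :=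
    nice_of_smooth hΩ hb contDiff_conj

/-- The class of `z`. -/
abbrev zB : BdryAlg hΩ hb := holoBdry hΩ hb (coordHolo hΩ hb)

/-- The class of `conj z`. -/
abbrev zcB : BdryAlg hΩ hb := bdry hΩ hb (nice_conj hΩ hb)

theorem aeval_zB (p : Polynomial ℂ) :
    Polynomial.aeval (zB hΩ hb) p = holoBdry hΩ hb (Polynomial.aeval (coordHolo hΩ hb) p) :=
  Polynomial.aeval_algHom_apply _ _ p

theorem eq_zero_of_mul_eq_zero {p : Polynomial ℂ} (hp : p ≠ 0) (hr : ∀ a, p.IsRoot a → a ∈ Ω)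
    {a : BdryAlg hΩ hb} (h : Polynomial.aeval (zB hΩ hb) p * a = 0) : a = 0 := by
  induction hn : p.natDegree generalizing p with
  | zero =>
    rw [Polynomial.eq_C_of_natDegree_eq_zero hn] at h hp
    rw [Polynomial.aeval_C] at h
    have h0 : p.coeff 0 ≠ 0 := fun h0 => hp (by rw [h0, Polynomial.C_0])
    rw [← one_mul a, ← map_one (algebraMap ℂ (BdryAlg hΩ hb)), ← inv_mul_cancel₀ h0, map_mul,
      mul_assoc, h, mul_zero]
  | succ n ih =>
    obtain ⟨w, hw⟩ := IsAlgClosed.exists_root p (by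
      rw [Polynomial.degree_eq_natDegree hp, hn]; exact_mod_cast Nat.succ_ne_zero n)
    obtain ⟨q, rfl⟩ := Polynomial.dvd_iff_isRoot.2 hw
    have hq : q ≠ 0 := right_ne_zero_of_mul hp
    have hwΩ := hr w hw
    refine ih hq (fun b hb' => hr b (Polynomial.root_mul_left_of_isRoot _ hb')) ?_ ?_
    · rw [map_mul, mul_assoc] at h
      set c := Polynomial.aeval (zB hΩ hb) q * a with hc
      obtain ⟨⟨v, hv⟩, hvc⟩ := Ideal.Quotient.mk_surjective c
      have hvc' : bdry hΩ hb hv = c := hvc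
      rw [← hvc'] at h ⊢
      refine (bdry_eq_zero_iff hΩ hb).2 (Null.of_sub_mul hΩ hb hwΩ hv ?_)
      refine (bdry_eq_zero_iff hΩ hb (hu := ((nice_of_smooth hΩ hb
        (contDiff_id.sub (contDiff_const (c := w)))).mul hΩ hv))).1 ?_
      rw [← h, map_sub, Polynomial.aeval_X, Polynomial.aeval_C]
      rfl
    · rw [Polynomial.natDegree_mul (Polynomial.X_sub_C_ne_zero w) hq,
        Polynomial.natDegree_X_sub_C] at hn
      omega

end NiceAlgebra

section BoundaryValues

variable {Ω : Set ℂ} {u v f G : ℂ → ℂ}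

open Polynomial in
theorem exists_division {S : (ℂ → ℂ) → Prop} (hs : ∀ f, S f → ∀ w ∈ Ω, S (dslope f w))
    (hc : ∀ f, S f → ∀ c : ℂ, S (fun z => c * f z)) {p : ℂ[X]} (hp : p ≠ 0)
    (hr : ∀ a, p.IsRoot a → a ∈ Ω) (hf : S f) :
    ∃ q : ℂ[X], q.degree < p.degree ∧ ∃ f₁, S f₁ ∧ ∀ z, f z = q.eval z + p.eval z * f₁ z := by
  induction hn : p.natDegree generalizing p f with
  | zero =>
    have hC := eq_C_of_natDegree_eq_zero hn
    have h0 : p.coeff 0 ≠ 0 := fun h0 => hp (by rw [hC, h0, C_0])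
    refine ⟨0, by rw [degree_zero]; exact bot_lt_iff_ne_bot.2 (degree_ne_bot.2 hp), _,
      hc f hf (p.coeff 0)⁻¹, fun z => ?_⟩
    rw [hC, eval_C, coeff_C_zero, eval_zero, zero_add, mul_inv_cancel_left₀ h0]
  | succ n ih =>
    obtain ⟨w, hw⟩ := IsAlgClosed.exists_root p (by
      rw [degree_eq_natDegree hp, hn]; exact_mod_cast Nat.succ_ne_zero n)
    obtain ⟨q, rfl⟩ := dvd_iff_isRoot.2 hw
    have hq : q ≠ 0 := right_ne_zero_of_mul hp
    have hn' := natDegree_mul (X_sub_C_ne_zero w) hq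
    rw [natDegree_X_sub_C, hn] at hn'
    obtain ⟨q', hq', f₁, hf₁, h⟩ := ih hq (fun b hb' => hr b (root_mul_left_of_isRoot _ hb'))
      (hs f hf w (hr w hw)) (by omega)
    refine ⟨C (f w) + (X - C w) * q', ?_, f₁, hf₁, fun z => ?_⟩
    · rw [degree_mul, degree_X_sub_C, degree_eq_natDegree hq]
      rw [degree_eq_natDegree hq] at hq'
      refine (degree_add_le _ _).trans_lt (max_lt ?_ ?_)
      · refine degree_C_le.trans_lt ?_
        exact_mod_cast (by omega : 0 < 1 + q.natDegree)
      · rw [degree_mul, degree_X_sub_C]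
        by_cases h0 : q' = 0
        · rw [h0, degree_zero]
          simp
        · rw [degree_eq_natDegree h0] at hq' ⊢
          norm_cast at hq' ⊢
          omega
    · have h1 := sub_smul_dslope f w z
      rw [smul_eq_mul, h z] at h1
      simp only [eval_add, eval_mul, eval_C, eval_sub, eval_X]
      linear_combination -h1

theorem holo_division (hΩ : IsOpen Ω) (hb : Bornology.IsBounded Ω) {p : Polynomial ℂ} (hp : p ≠ 0)
    (hr : ∀ a, p.IsRoot a → a ∈ Ω) (F : holoAlg hΩ hb) :
    ∃ q : Polynomial ℂ, q.degree < p.degree ∧ ∃ F₁ : holoAlg hΩ hb,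
      ∀ z, F.1 z = q.eval z + p.eval z * F₁.1 z := by
  obtain ⟨q, hq, f₁, hf₁, h⟩ := exists_division (Ω := Ω)
    (S := fun f => Nice Ω f ∧ DifferentiableOn ℂ f Ω)
    (fun f hf w hw => ⟨hf.1.dslope hΩ hb hf.2 hw,
      (differentiableOn_dslope (hΩ.mem_nhds hw)).2 hf.2⟩)
    (fun f hf c => ⟨(nice_of_smooth hΩ hb (contDiff_const (c := c))).mul hΩ hf.1,
      hf.2.const_mul c⟩) hp hr F.2
  exact ⟨q, hq, ⟨f₁, hf₁⟩, h⟩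

variable (hΩ : IsOpen Ω) (hb : Bornology.IsBounded Ω)

/-- Evaluation at a point. -/
def evalHolo (a : ℂ) : holoAlg hΩ hb →+* ℂ := (Pi.evalRingHom _ a).comp
    (holoAlg hΩ hb).val.toRingHom

theorem evalHolo_aeval (a : ℂ) (p : Polynomial ℂ) :
    evalHolo hΩ hb a (Polynomial.aeval (coordHolo hΩ hb) p) = p.eval a :=
  aeval_coordHolo_apply hΩ hb p a

theorem exists_pow_of_integral {A B D : Type*} [CommRing A] [CommRing B] [CommRing D] [Nontrivial D]
    (ι : A →+* B) {s : B} (hs : ι.IsIntegralElem s) {p q : A} (h : ι p * s = ι q) (ev : A →+* D)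
    (hp : ev p = 0) : ∃ c n, ι c = 0 ∧ ev c = ev q ^ n := by
  obtain ⟨P, hP, hPs⟩ := hs
  have h1 := Polynomial.scaleRoots_eval₂_eq_zero (s := p) ι hPs
  rw [h, Polynomial.eval₂_at_apply] at h1
  refine ⟨_, P.natDegree, h1, ?_⟩
  rw [← Polynomial.eval₂_at_apply, ← Polynomial.eval_map, Polynomial.map_scaleRoots _ _ _
    (by rw [hP.leadingCoeff, map_one]; exact one_ne_zero), hp, Polynomial.scaleRoots_zero,
    (hP.map _).leadingCoeff, one_smul, Polynomial.eval_pow, Polynomial.eval_X, hP.natDegree_map]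

theorem isUnit_of_integral {p q : Polynomial ℂ} (hpq : IsCoprime p q)
    (hr : ∀ a, p.IsRoot a → a ∈ Ω) {s : BdryAlg hΩ hb}
    (hs : (holoBdry hΩ hb).toRingHom.IsIntegralElem s)
    (h : Polynomial.aeval (zB hΩ hb) p * s = Polynomial.aeval (zB hΩ hb) q) : IsUnit p := by
  by_contra hu
  obtain ⟨a, ha⟩ := IsAlgClosed.exists_root p fun h => hu (Polynomial.isUnit_iff_degree_eq_zero.2 h)
  rw [aeval_zB, aeval_zB] at h
  obtain ⟨c, n, hc, hcn⟩ := exists_pow_of_integral (holoBdry hΩ hb).toRingHom hs h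
    (evalHolo hΩ hb a) (by rw [evalHolo_aeval]; exact ha)
  have h3 : evalHolo hΩ hb a c = 0 := eqOn_zero_of_holoBdry hΩ hb hc (hr a ha)
  rw [hcn, evalHolo_aeval] at h3
  obtain ⟨x, y, hxy⟩ := hpq
  have h4 := congrArg (Polynomial.eval a) hxy
  rw [Polynomial.eval_add, Polynomial.eval_mul, Polynomial.eval_mul, ha.eq_zero,
    pow_eq_zero_iff'.1 h3 |>.1] at h4
  simp at h4

theorem dvd_of_integral {p q : Polynomial ℂ} (hp : p ≠ 0)
    (hr : ∀ a, p.IsRoot a → a ∈ Ω) {s : BdryAlg hΩ hb}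
    (hs : (holoBdry hΩ hb).toRingHom.IsIntegralElem s)
    (h : Polynomial.aeval (zB hΩ hb) p * s = Polynomial.aeval (zB hΩ hb) q) : p ∣ q := by
  set g := EuclideanDomain.gcd p q with hg
  have hg0 : g ≠ 0 := fun h0 => hp (EuclideanDomain.gcd_eq_zero_iff.1 h0).1
  obtain ⟨p', hp'⟩ := EuclideanDomain.gcd_dvd_left p q
  obtain ⟨q', hq'⟩ := EuclideanDomain.gcd_dvd_right p q
  rw [← hg] at hp' hq'
  have hc : IsCoprime p' q' := by
    refine ⟨EuclideanDomain.gcdA p q, EuclideanDomain.gcdB p q, mul_left_cancel₀ hg0 ?_⟩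
    have := EuclideanDomain.gcd_eq_gcd_ab p q
    rw [← hg] at this
    linear_combination -this - EuclideanDomain.gcdA p q * hp' - EuclideanDomain.gcdB p q * hq'
  have hu := isUnit_of_integral hΩ hb hc (fun a ha => hr a (by
    rw [hp']; exact Polynomial.root_mul_left_of_isRoot _ ha)) hs (by
    rw [← sub_eq_zero]
    refine eq_zero_of_mul_eq_zero hΩ hb hg0 (fun a ha => hr a (by
      rw [hp']; exact Polynomial.root_mul_right_of_isRoot _ ha)) ?_
    rw [mul_sub, ← mul_assoc, ← map_mul, ← map_mul, ← hp', ← hq', h, sub_self])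
  rw [hq', hp']
  exact mul_dvd_mul_left g hu.dvd

end BoundaryValues

section Independence

variable {Ω : Set ℂ} {u v f G : ℂ → ℂ}

/-- The polynomial with conjugated coefficients. -/
abbrev conjPoly (p : Polynomial ℂ) : Polynomial ℂ := p.map (starRingEnd ℂ)

theorem conj_eval (p : Polynomial ℂ) (z : ℂ) : conj (p.eval z) = (conjPoly p).eval (conj z) := by
  rw [Polynomial.eval_map, Polynomial.eval₂_at_apply]

variable (hΩ : IsOpen Ω) (hb : Bornology.IsBounded Ω)

theorem bdry_mul {hu : Nice Ω u} {hv : Nice Ω v} :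
    bdry hΩ hb (hu.mul hΩ hv) = bdry hΩ hb hu * bdry hΩ hb hv := rfl

theorem bdry_pow {hu : Nice Ω u} (n : ℕ) :
    bdry hΩ hb (hu.pow hΩ hb n) = bdry hΩ hb hu ^ n :=
  (map_pow (toBdry hΩ hb) _ n).symm ▸ rfl

theorem bdry_poly (p : Polynomial ℂ) :
    bdry hΩ hb (nice_polynomial hΩ hb p) = Polynomial.aeval (zB hΩ hb) p :=
  bdry_aeval hΩ hb (nice_of_smooth hΩ hb contDiff_id) p _

theorem bdry_conj_poly (p : Polynomial ℂ) :
    bdry hΩ hb ((nice_polynomial hΩ hb p).conj hΩ) =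
      Polynomial.aeval (zcB hΩ hb) (conjPoly p) := by
  have h : (fun z => conj (p.eval z)) = fun z => (conjPoly p).eval (conj z) :=
    funext fun z => conj_eval p z
  rw [← bdry_aeval hΩ hb (nice_conj hΩ hb) (conjPoly p)
    (h ▸ (nice_polynomial hΩ hb p).conj hΩ)]
  congr 1

theorem Null.bdry_eq {p : Polynomial ℂ} {hG : Nice Ω G}
    (hU : Null Ω (fun z => p.eval z * conj z - G z)) :
    Polynomial.aeval (zB hΩ hb) p * zcB hΩ hb = bdry hΩ hb hG := by
  rw [← bdry_poly, ← bdry_mul]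
  exact (bdry_eq_iff hΩ hb).2 hU

theorem Null.bdry_conj_eq {p : Polynomial ℂ} {hG : Nice Ω G}
    (hU : Null Ω (fun z => p.eval z * conj z - G z)) :
    Polynomial.aeval (zcB hΩ hb) (conjPoly p) * zB hΩ hb = bdry hΩ hb (hG.conj hΩ) := by
  rw [← bdry_conj_poly, show zB hΩ hb = bdry hΩ hb (coordHolo hΩ hb).2.1 from rfl, ← bdry_mul]
  refine (bdry_eq_iff hΩ hb).2 ((hU.conj hΩ).congr hΩ fun z _ => ?_)
  simp [coordHolo]

/-- The relation between the classes of `z` and `conj z` obtained by conjugating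
`∑ q i * G ^ i = 0`. -/
def conjRel (d : ℕ) (p : Polynomial ℂ) (q : ℕ → Polynomial ℂ) : Polynomial (Polynomial ℂ) :=
  ∑ i ∈ Finset.range d, (conjPoly (q i) * conjPoly p ^ i).map Polynomial.C *
    Polynomial.C (Polynomial.X ^ i)

theorem conjRel_coeff (d : ℕ) (p : Polynomial ℂ) (q : ℕ → Polynomial ℂ) (k : ℕ) :
    (conjRel d p q).coeff k = ∑ i ∈ Finset.range d,
      Polynomial.C ((conjPoly (q i) * conjPoly p ^ i).coeff k) * Polynomial.X ^ i := by
  simp only [conjRel, Polynomial.finsetSum_coeff, Polynomial.coeff_mul_C, Polynomial.coeff_map]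

theorem conjRel_eq_zero {d : ℕ} {p : Polynomial ℂ} (hp : p ≠ 0) {q : ℕ → Polynomial ℂ}
    (h : conjRel d p q = 0) {i : ℕ} (hi : i < d) : q i = 0 := by
  have h1 : conjPoly (q i) * conjPoly p ^ i = 0 := by
    ext k
    have h2 := congrArg (fun r => Polynomial.coeff r i) (conjRel_coeff d p q k)
    simp only [h, Polynomial.coeff_zero, Polynomial.finsetSum_coeff, Polynomial.coeff_C_mul,
      Polynomial.coeff_X_pow, mul_ite, mul_one, mul_zero, Finset.sum_ite_eq, Finset.mem_range,
      if_pos hi] at h2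
    rw [← h2, Polynomial.coeff_zero]
  have hinj := Polynomial.map_injective (starRingEnd ℂ) (starRingEnd ℂ).injective
  have h3 : conjPoly p ≠ 0 := (Polynomial.map_ne_zero_iff (starRingEnd ℂ).injective).2 hp
  exact (Polynomial.map_eq_zero_iff (starRingEnd ℂ).injective).1
    ((mul_eq_zero.1 h1).resolve_right (pow_ne_zero _ h3))

theorem natDegree_conjRel_coeff_lt {d : ℕ} (hd : 0 < d) (p : Polynomial ℂ) (q : ℕ → Polynomial ℂ)
    (k : ℕ) : ((conjRel d p q).coeff k).natDegree < d := by
  rw [conjRel_coeff]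
  refine (Polynomial.natDegree_sum_le_of_forall_le (n := d - 1) _ _ fun i hi => ?_).trans_lt
    (by omega)
  exact (Polynomial.natDegree_C_mul_X_pow_le _ _).trans (by have := Finset.mem_range.1 hi; omega)

theorem conjRel_eval {d : ℕ} {p : Polynomial ℂ} {q : ℕ → Polynomial ℂ} {hG : Nice Ω G}
    (hU : Null Ω (fun z => p.eval z * conj z - G z))
    (h : ∀ z ∈ Ω, ∑ i ∈ Finset.range d, (q i).eval z * G z ^ i = 0) :
    (conjRel d p q).eval₂ (Polynomial.aeval (zB hΩ hb)).toRingHom (zcB hΩ hb) = 0 := by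
  have h1 : ∑ i ∈ Finset.range d, Polynomial.aeval (zcB hΩ hb) (conjPoly (q i)) *
      bdry hΩ hb (hG.conj hΩ) ^ i = 0 := by
    have h2 : ∑ i ∈ Finset.range d, Polynomial.aeval (zcB hΩ hb) (conjPoly (q i)) *
        bdry hΩ hb (hG.conj hΩ) ^ i = toBdry hΩ hb (∑ i ∈ Finset.range d,
          ⟨_, (nice_polynomial hΩ hb (q i)).conj hΩ⟩ * ⟨_, hG.conj hΩ⟩ ^ i) := by
      rw [map_sum]
      refine Finset.sum_congr rfl fun i _ => ?_
      rw [map_mul, map_pow, ← bdry_conj_poly]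
      rfl
    rw [h2]
    generalize hE : (∑ i ∈ Finset.range d, _ : niceAlg hΩ hb) = E
    refine (bdry_eq_zero_iff hΩ hb (hu := E.2)).2
      ((TestFn.null hΩ hb (testFn_zero Ω)).congr hΩ fun z hz => ?_)
    have h3 := congrArg conj (h z hz)
    rw [map_zero, map_sum] at h3
    rw [← hE]
    refine (congrFun (map_sum (niceAlg hΩ hb).val _ _) z).trans ?_
    rw [← h3, Finset.sum_apply]
    refine Finset.sum_congr rfl fun i _ => ?_
    rw [map_mul, map_mul, map_pow, map_pow]
    rfl
  rw [← h1, conjRel, Polynomial.eval₂_finsetSum]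
  refine Finset.sum_congr rfl fun i _ => ?_
  rw [Polynomial.eval₂_mul, Polynomial.eval₂_C, Polynomial.eval₂_map,
    ← Null.bdry_conj_eq hΩ hb hU (hG := hG), mul_pow, ← mul_assoc]
  have h4 : ((Polynomial.aeval (zB hΩ hb)).toRingHom.comp Polynomial.C) =
      algebraMap ℂ (BdryAlg hΩ hb) := by
    ext c
    exact Polynomial.aeval_C _ _
  rw [h4, ← Polynomial.aeval_def, map_mul, map_pow]
  congr 1
  exact (map_pow _ _ _).trans (congrArg (· ^ i) (Polynomial.aeval_X _))

theorem eq_zero_of_sum_eq_zero (hΩ : IsOpen Ω) (hb : Bornology.IsBounded Ω) {p : Polynomial ℂ}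
    (hp : p ≠ 0) (hr : ∀ a, p.IsRoot a → a ∈ Ω)
    (hmin : ∀ r ≠ 0, (∀ f, BergmanFun Ω f → ∫ z in Ω, Polynomial.eval z r * f z = 0) →
      p.natDegree ≤ r.natDegree)
    (hG : Nice Ω G) (hG' : DifferentiableOn ℂ G Ω)
    (hU : Null Ω (fun z => p.eval z * conj z - G z)) {q : ℕ → Polynomial ℂ}
    (h : ∀ z ∈ Ω, ∑ i ∈ Finset.range p.natDegree, (q i).eval z * G z ^ i = 0) {i : ℕ}
    (hi : i < p.natDegree) : q i = 0 := by
  refine conjRel_eq_zero hp (of_not_not fun hR => ?_) hi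
  set R := conjRel p.natDegree p q with hRdef
  set r := R.leadingCoeff with hrdef
  have hr0 : r ≠ 0 := Polynomial.leadingCoeff_ne_zero.2 hR
  have hrd : r.natDegree < p.natDegree := natDegree_conjRel_coeff_lt (by omega) p q _
  have h_intg := RingHom.isIntegralElem_leadingCoeff_mul _ R _
    (conjRel_eval hΩ hb (hG := hG) hU h)
  obtain ⟨q', hq', F, hF⟩ := holo_division hΩ hb hp hr
    (Polynomial.aeval (coordHolo hΩ hb) r * ⟨G, hG, hG'⟩)
  have hF2 : Polynomial.aeval (coordHolo hΩ hb) r * ⟨G, hG, hG'⟩ =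
      Polynomial.aeval (coordHolo hΩ hb) q' + Polynomial.aeval (coordHolo hΩ hb) p * F := by
    ext z
    refine (hF z).trans ?_
    rw [← aeval_coordHolo_apply hΩ hb q', ← aeval_coordHolo_apply hΩ hb p]
    rfl
  have hF3 := congrArg (holoBdry hΩ hb) hF2
  rw [map_mul, map_add, map_mul, ← aeval_zB, ← aeval_zB, ← aeval_zB] at hF3
  have hs : (holoBdry hΩ hb).toRingHom.IsIntegralElem
      (Polynomial.aeval (zB hΩ hb) r * zcB hΩ hb - holoBdry hΩ hb F) := by
    refine RingHom.IsIntegralElem.sub _ ?_ (RingHom.isIntegralElem_map _)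
    obtain ⟨P, hP, hP2⟩ := h_intg
    refine ⟨P.map (Polynomial.aeval (coordHolo hΩ hb)).toRingHom, hP.map _, ?_⟩
    rw [Polynomial.eval₂_map]
    have hcomp : (holoBdry hΩ hb).toRingHom.comp (Polynomial.aeval (coordHolo hΩ hb)).toRingHom =
        (Polynomial.aeval (zB hΩ hb)).toRingHom := RingHom.ext fun x => (aeval_zB hΩ hb x).symm
    rw [hcomp]
    exact hP2
  have hps : Polynomial.aeval (zB hΩ hb) p *
      (Polynomial.aeval (zB hΩ hb) r * zcB hΩ hb - holoBdry hΩ hb F) =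
      Polynomial.aeval (zB hΩ hb) q' := by
    have h5 := Null.bdry_eq hΩ hb hU (hG := hG)
    have h6 : bdry hΩ hb hG = holoBdry hΩ hb ⟨G, hG, hG'⟩ := rfl
    rw [← h6, ← h5] at hF3
    linear_combination hF3
  have hq0 : q' = 0 := Polynomial.eq_zero_of_dvd_of_degree_lt
      (dvd_of_integral hΩ hb hp hr hs hps) hq'
  rw [hq0, map_zero] at hps
  have hs0 := eq_zero_of_mul_eq_zero hΩ hb hp hr hps
  rw [← bdry_poly, ← bdry_mul, holoBdry_apply, sub_eq_zero, bdry_eq_iff] at hs0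
  refine absurd (hmin r hr0 fun f hf => ?_) (not_le.2 hrd)
  rw [← (hs0.2 (fun _ => 1) (nice_of_smooth hΩ hb contDiff_const) f hf).1]
  refine setIntegral_congr_fun hΩ.measurableSet fun z hz => ?_
  have e : (fun z => (fun _ => (1 : ℂ)) z * (r.eval z * conj z - F.1 z)) =
      fun z => r.eval z * conj z - F.1 z := by ext z; exact one_mul _
  have hd := F.2.2.differentiableAt (hΩ.mem_nhds hz)
  simp only
  rw [e, dbar_sub _ (hd.restrictScalars ℝ), dbar_poly_conj, dbar_holo hd, sub_zero, mul_comm]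
  exact ((nice_polynomial hΩ hb r).mul hΩ (nice_conj hΩ hb)).differentiableAt hΩ hz

end Independence

section Transfer

variable {Ω : Set ℂ} {u v f G : ℂ → ℂ}

theorem exists_holoBdry_eq (hΩ : IsOpen Ω) (hb : Bornology.IsBounded Ω) {p : Polynomial ℂ}
    (hG : Nice Ω G) (hG' : DifferentiableOn ℂ G Ω)
    (hU : Null Ω (fun z => p.eval z * conj z - G z)) (b i M : ℕ) (hM : b + p.natDegree * i ≤ M) :
    ∃ Y : holoAlg hΩ hb, Null Ω (fun z => p.eval z ^ M * conj (z ^ b * G z ^ i) - Y.1 z) := by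
  have h1 := Null.bdry_eq hΩ hb hU (hG := hG)
  have h2 := Null.bdry_conj_eq hΩ hb hU (hG := hG)
  have h3 : bdry hΩ hb hG = holoBdry hΩ hb ⟨G, hG, hG'⟩ := rfl
  set T : Polynomial ℂ := Polynomial.X ^ b * conjPoly p ^ i with hT
  have hTd : T.natDegree < M + 1 := by
    refine Nat.lt_succ_of_le (le_trans (Polynomial.natDegree_mul_le.trans ?_) hM)
    rw [Polynomial.natDegree_X_pow]
    refine Nat.add_le_add_left (Polynomial.natDegree_pow_le.trans ?_) _
    rw [mul_comm, Polynomial.natDegree_map]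
  have h4 : Polynomial.aeval (zB hΩ hb) p ^ M * Polynomial.aeval (zcB hΩ hb) T ∈
      (holoBdry hΩ hb).range := by
    rw [Polynomial.aeval_eq_sum_range' hTd, Finset.mul_sum]
    refine sum_mem fun k hk => ?_
    rw [← Nat.sub_add_cancel (Nat.lt_succ_iff.1 (Finset.mem_range.1 hk)), pow_add, mul_smul_comm,
      mul_assoc]
    refine Subalgebra.smul_mem _ (mul_mem (pow_mem ?_ _) ?_) _
    · rw [aeval_zB]
      exact ⟨_, rfl⟩
    · rw [← mul_pow, h1, h3]
      exact pow_mem (show holoBdry hΩ hb ⟨G, hG, hG'⟩ ∈ (holoBdry hΩ hb).range from ⟨_, rfl⟩) _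
  have hz : zB hΩ hb ∈ (holoBdry hΩ hb).range := ⟨_, rfl⟩
  have h5 : Polynomial.aeval (zB hΩ hb) p ^ M * (zcB hΩ hb ^ b * bdry hΩ hb (hG.conj hΩ) ^ i) ∈
      (holoBdry hΩ hb).range := by
    have e : Polynomial.aeval (zB hΩ hb) p ^ M * (zcB hΩ hb ^ b * bdry hΩ hb (hG.conj hΩ) ^ i) =
        Polynomial.aeval (zB hΩ hb) p ^ M * Polynomial.aeval (zcB hΩ hb) T * zB hΩ hb ^ i := by
      rw [← h2, hT, map_mul, map_pow, map_pow, Polynomial.aeval_X]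
      ring
    rw [e]
    exact mul_mem h4 (pow_mem hz _)
  obtain ⟨Y, hY⟩ := h5
  refine ⟨Y, ?_⟩
  rw [← bdry_poly, ← bdry_pow, ← bdry_pow, ← bdry_pow, ← bdry_mul, ← bdry_mul] at hY
  refine ((bdry_eq_iff hΩ hb).1 hY.symm).congr hΩ fun z _ => ?_
  simp only [map_mul, map_pow]

theorem deriv_holo {F : ℂ → ℂ} (hΩ : IsOpen Ω) (hF : DifferentiableOn ℂ F Ω) {z : ℂ} (hz : z ∈ Ω) :
    dbar (fun z => conj (F z)) z = conj (deriv F z) := by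
  have hd := hF.differentiableAt (hΩ.mem_nhds hz)
  rw [dbar_conj (hd.restrictScalars ℝ), dd_holo hd]

theorem Null.integral_eq (hΩ : IsOpen Ω) {P Y φ : ℂ → ℂ}
    (hP : Nice Ω P) (hP' : DifferentiableOn ℂ P Ω)
    (hY : Nice Ω Y) (hY' : DifferentiableOn ℂ Y Ω) (hφ : Nice Ω φ) (hφ' : DifferentiableOn ℂ φ Ω)
    (hu : Nice Ω u) (hu' : DifferentiableOn ℂ u Ω)
    (h : Null Ω (fun z => P z * conj (u z) - Y z)) (hf : BergmanFun Ω f) :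
    ∫ z in Ω, f z * u z * conj (deriv (fun z => φ z * P z) z) =
      ∫ z in Ω, f z * conj (deriv (fun z => φ z * Y z) z) := by
  have h1 := (h.2 φ hφ f hf).2
  have hfu := BergmanFun.nice_mul hΩ hu hu' hf
  have i1 : IntegrableOn (fun z => f z * u z * conj (deriv (fun z => φ z * P z) z)) Ω := by
    refine ((((bergmanFun_iff hΩ).1 hfu).2.integrable_mul (MemLp.star ((bergmanFun_iff hΩ).1
      ((hφ.mul hΩ hP).bergmanFun_deriv hΩ (hφ'.mul hP'))).2))).congr ?_
    refine Filter.Eventually.of_forall fun z => ?_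
    simp only [Pi.mul_apply, Pi.star_apply, RCLike.star_def]
    ring
  have i2 : IntegrableOn (fun z => f z * conj (deriv (fun z => φ z * Y z) z)) Ω :=
    ((bergmanFun_iff hΩ).1 hf).2.integrable_mul (MemLp.star ((bergmanFun_iff hΩ).1
      ((hφ.mul hΩ hY).bergmanFun_deriv hΩ (hφ'.mul hY'))).2)
  rw [← sub_eq_zero, ← integral_sub i1 i2, ← h1]
  refine setIntegral_congr_fun hΩ.measurableSet fun z hz => ?_
  have e : (fun z => conj (φ z * (P z * conj (u z) - Y z))) =
      fun z => u z * conj (φ z * P z) - conj (φ z * Y z) := by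
    ext z
    simp only [map_mul, map_sub, conj_conj]
    ring
  have hn := hφ.mul hΩ hP
  have d1 := (hn.conj hΩ).differentiableAt hΩ hz
  simp only
  rw [e, dbar_sub ((hu.mul hΩ (hn.conj hΩ)).differentiableAt hΩ hz)
    (((hφ.mul hΩ hY).conj hΩ).differentiableAt hΩ hz),
    dbar_mul (hu.differentiableAt hΩ hz) d1, deriv_holo (F := fun z => φ z * P z) hΩ
        (hφ'.mul hP') hz,
    deriv_holo (F := fun z => φ z * Y z) hΩ (hφ'.mul hY') hz, dbar_holo (hu'.differentiableAt
        (hΩ.mem_nhds hz))]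
  ring

end Transfer

section Pairing

variable {Ω : Set ℂ} {G : ℂ → ℂ} (hΩ : IsOpen Ω) (hb : Bornology.IsBounded Ω)

/-- The Bergman space as a module over the nice holomorphic functions. -/
def bergmanSpace : Submodule (holoAlg hΩ hb) (ℂ → ℂ) where
  carrier := {f | BergmanFun Ω f}
  add_mem' hf hg := (bergmanFun_iff hΩ).2 ⟨hf.1.add hg.1,
    ((bergmanFun_iff hΩ).1 hf).2.add ((bergmanFun_iff hΩ).1 hg).2⟩
  zero_mem' := (bergmanFun_iff hΩ).2 ⟨differentiableOn_const 0, MemLp.zero⟩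
  smul_mem' F _ hf := BergmanFun.nice_mul hΩ F.2.1 F.2.2 hf

instance : AddCommGroup (bergmanSpace hΩ hb) := Submodule.addCommGroup _

instance : Module (holoAlg hΩ hb) (bergmanSpace hΩ hb) := Submodule.module _

instance : SMul (holoAlg hΩ hb) (bergmanSpace hΩ hb) := SMulZeroClass.toSMul

instance : Module ℂ (bergmanSpace hΩ hb) := Submodule.module' _

instance : SMul ℂ (bergmanSpace hΩ hb) := SMulZeroClass.toSMul

theorem bergmanSpace_smul_apply (F : holoAlg hΩ hb) (f : bergmanSpace hΩ hb) (z : ℂ) :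
    (F • f).1 z = F.1 z * f.1 z := rfl

theorem bergmanSpace_const_smul_apply (c : ℂ) (f : bergmanSpace hΩ hb) (z : ℂ) :
    (c • f).1 z = c * f.1 z := rfl

/-- Nice holomorphic functions, seen in the Bergman space. -/
def toBergman : holoAlg hΩ hb →ₗ[ℂ] bergmanSpace hΩ hb where
  toFun F := ⟨F.1, F.2.1.bergmanFun hΩ hb F.2.2⟩
  map_add' _ _ := rfl
  map_smul' _ _ := rfl

theorem integrableOn_pairing (H : holoAlg hΩ hb) (f : bergmanSpace hΩ hb) :
    IntegrableOn (fun z => f.1 z * conj (deriv H.1 z)) Ω :=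
  ((bergmanFun_iff hΩ).1 f.2).2.integrable_mul (MemLp.star ((bergmanFun_iff hΩ).1
      (H.2.1.bergmanFun_deriv hΩ H.2.2)).2)

/-- The pairing `(H, f) ↦ ∫ f * conj H'`. -/
def dPair : holoAlg hΩ hb →ₛₗ[starRingEnd ℂ] bergmanSpace hΩ hb →ₗ[ℂ] ℂ :=
  LinearMap.mk₂'ₛₗ (starRingEnd ℂ) (RingHom.id ℂ)
    (fun H f => ∫ z in Ω, f.1 z * conj (deriv H.1 z))
    (fun H H' f => by
      rw [← integral_add (integrableOn_pairing hΩ hb H f) (integrableOn_pairing hΩ hb H' f)]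
      refine setIntegral_congr_fun hΩ.measurableSet fun z hz => ?_
      have h : deriv (H + H').1 z = deriv H.1 z + deriv H'.1 z :=
        deriv_add (H.2.2.differentiableAt (hΩ.mem_nhds hz))
          (H'.2.2.differentiableAt (hΩ.mem_nhds hz))
      simp only [h, map_add]
      ring)
    (fun c H f => by
      rw [smul_eq_mul, ← integral_const_mul]
      refine setIntegral_congr_fun hΩ.measurableSet fun z hz => ?_
      have h : deriv (c • H).1 z = c * deriv H.1 z :=
        deriv_const_mul c (H.2.2.differentiableAt (hΩ.mem_nhds hz))
      simp only [h, map_mul]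
      ring)
    (fun H f f' => by
      rw [← integral_add (integrableOn_pairing hΩ hb H f) (integrableOn_pairing hΩ hb H f')]
      refine integral_congr_ae (Filter.Eventually.of_forall fun z => ?_)
      exact add_mul _ _ _)
    (fun c H f => by
      rw [smul_eq_mul, ← integral_const_mul]
      refine integral_congr_ae (Filter.Eventually.of_forall fun z => ?_)
      exact mul_assoc _ _ _)

theorem dPair_apply (H : holoAlg hΩ hb) (f : bergmanSpace hΩ hb) :
    dPair hΩ hb H f = ∫ z in Ω, f.1 z * conj (deriv H.1 z) := rfl

/-- A polynomial as a nice holomorphic function. -/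
def polyHolo : Polynomial ℂ →ₐ[ℂ] holoAlg hΩ hb := Polynomial.aeval (coordHolo hΩ hb)

theorem polyHolo_apply (p : Polynomial ℂ) (z : ℂ) : (polyHolo hΩ hb p).1 z = p.eval z :=
  aeval_coordHolo_apply hΩ hb p z

theorem dPair_transfer {P u Y : holoAlg hΩ hb}
    (h : Null Ω (fun z => P.1 z * conj (u.1 z) - Y.1 z)) (φ : holoAlg hΩ hb)
    (f : bergmanSpace hΩ hb) : dPair hΩ hb (φ * P) (u • f) = dPair hΩ hb (φ * Y) f := by
  rw [dPair_apply, dPair_apply]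
  refine Eq.trans ?_ (Null.integral_eq hΩ P.2.1 P.2.2 Y.2.1 Y.2.2 φ.2.1 φ.2.2 u.2.1 u.2.2 h f.2)
  refine integral_congr_ae (Filter.Eventually.of_forall fun z => ?_)
  simp only [bergmanSpace_smul_apply]
  rw [mul_comm (u.1 z)]
  rfl

theorem dPair_smul_eq_zero {P u Y : holoAlg hΩ hb}
    (h : Null Ω (fun z => P.1 z * conj (u.1 z) - Y.1 z)) (f : bergmanSpace hΩ hb) :
    dPair hΩ hb u (P • f) = 0 := by
  have hu := u.2.1.conj hΩ
  rw [dPair_apply, ← (h.2 (fun _ => 1) (nice_of_smooth hΩ hb contDiff_const) f.1 f.2).1]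
  refine setIntegral_congr_fun hΩ.measurableSet fun z hz => ?_
  simp only [one_mul, bergmanSpace_smul_apply]
  rw [dbar_sub ((P.2.1.mul hΩ hu).differentiableAt hΩ hz) (Y.2.1.differentiableAt hΩ hz),
    dbar_mul (P.2.1.differentiableAt hΩ hz) (hu.differentiableAt hΩ hz),
    deriv_holo hΩ u.2.2 hz, dbar_holo (P.2.2.differentiableAt (hΩ.mem_nhds hz)),
    dbar_holo (Y.2.2.differentiableAt (hΩ.mem_nhds hz))]
  ring

end Pairing

section Good

variable {Ω : Set ℂ} {G : ℂ → ℂ} (hΩ : IsOpen Ω) (hb : Bornology.IsBounded Ω)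

/-- Functions whose products with monomials are orthogonal to derivatives of holomorphic functions
vanishing to high order at the roots of `p` and to second order at `w`. -/
def Good (p : Polynomial ℂ) (w : ℂ) (κ : ℕ) (h : bergmanSpace hΩ hb) : Prop :=
  ∀ (b : ℕ) (F : holoAlg hΩ hb),
    dPair hΩ hb (F * polyHolo hΩ hb (p ^ (b + κ) * (Polynomial.X - Polynomial.C w) ^ 2))
      (polyHolo hΩ hb (Polynomial.X ^ b) • h) = 0

theorem holoAlg_mul_apply (F H : holoAlg hΩ hb) (z : ℂ) : (F * H).1 z = F.1 z * H.1 z := rfl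

theorem holoAlg_pow_apply (F : holoAlg hΩ hb) (n : ℕ) (z : ℂ) : (F ^ n).1 z = F.1 z ^ n := rfl

theorem Good.mono {p : Polynomial ℂ} {w : ℂ} {κ κ' : ℕ} {h : bergmanSpace hΩ hb}
    (hg : Good hΩ hb p w κ h) (hκ : κ ≤ κ') : Good hΩ hb p w κ' h := fun b F => by
  rw [← hg b (F * polyHolo hΩ hb (p ^ (κ' - κ))), mul_assoc, ← map_mul, ← mul_assoc, ← pow_add,
    show κ' - κ + (b + κ) = b + κ' by omega]

theorem deriv_mul_sq_eq_zero (F : holoAlg hΩ hb) {w : ℂ} (hw : w ∈ Ω) :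
    deriv (F * polyHolo hΩ hb ((Polynomial.X - Polynomial.C w) ^ 2)).1 w = 0 := by
  have h : (F * polyHolo hΩ hb ((Polynomial.X - Polynomial.C w) ^ 2)).1 =
      fun z => F.1 z * (z - w) ^ 2 := by
    ext z
    rw [holoAlg_mul_apply, polyHolo_apply]
    simp
  rw [h, deriv_fun_mul (F.2.2.differentiableAt (hΩ.mem_nhds hw)) (by fun_prop)]
  simp [deriv_fun_pow]

theorem good_bergmanKernel {p : Polynomial ℂ} (hG : Nice Ω G) (hG' : DifferentiableOn ℂ G Ω)
    (hU : Null Ω (fun z => p.eval z * conj z - G z)) {w : ℂ} (hw : w ∈ Ω) (k : bergmanSpace hΩ hb)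
    (hk : ∀ f, BergmanFun Ω f → f w = ∫ z in Ω, f z * conj (k.1 z)) : Good hΩ hb p w 0 k := by
  intro b F
  obtain ⟨Y, hY⟩ := exists_holoBdry_eq hΩ hb hG hG' hU b 0 b (by simp)
  have h1 := dPair_transfer hΩ hb (P := polyHolo hΩ hb (p ^ b))
    (u := polyHolo hΩ hb (Polynomial.X ^ b)) (Y := Y)
    (hY.congr hΩ fun z _ => by simp [polyHolo_apply])
    (F * polyHolo hΩ hb ((Polynomial.X - Polynomial.C w) ^ 2)) k
  rw [add_zero, mul_comm (p ^ b), map_mul (polyHolo hΩ hb), ← mul_assoc, h1, mul_right_comm,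
      dPair_apply]
  have h2 := hk _ (Nice.bergmanFun_deriv hΩ
    (F * Y * polyHolo hΩ hb ((Polynomial.X - Polynomial.C w) ^ 2)).2.1
    (F * Y * polyHolo hΩ hb ((Polynomial.X - Polynomial.C w) ^ 2)).2.2)
  rw [deriv_mul_sq_eq_zero hΩ hb _ hw] at h2
  rw [← map_zero (starRingEnd ℂ), h2, ← integral_conj]
  refine integral_congr_ae (Filter.Eventually.of_forall fun z => ?_)
  simp only [map_mul, conj_conj]
  ring

theorem dPair_sq_mul_one {p : Polynomial ℂ}
    (hp : ∀ f, BergmanFun Ω f → ∫ z in Ω, p.eval z * f z = 0) (ψ : holoAlg hΩ hb) :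
    dPair hΩ hb (ψ * polyHolo hΩ hb (p ^ 2)) (toBergman hΩ hb 1) = 0 := by
  set χ := ψ * polyHolo hΩ hb p
  have hχ : ∀ z, χ.1 z = ψ.1 z * p.eval z := fun z => by
    rw [holoAlg_mul_apply, polyHolo_apply]
  have e : (ψ * polyHolo hΩ hb (p ^ 2)).1 = fun z => p.eval z * χ.1 z := by
    ext z
    rw [holoAlg_mul_apply, polyHolo_apply, hχ, Polynomial.eval_pow]
    ring
  have hB : BergmanFun Ω (polyHolo hΩ hb p.derivative • toBergman hΩ hb ψ +
      (⟨_, χ.2.1.bergmanFun_deriv hΩ χ.2.2⟩ : bergmanSpace hΩ hb)).1 := Subtype.prop _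
  rw [dPair_apply, ← map_zero (starRingEnd ℂ), ← hp _ hB, ← integral_conj]
  refine setIntegral_congr_fun hΩ.measurableSet fun z hz => ?_
  rw [e, deriv_fun_mul p.differentiableAt (χ.2.2.differentiableAt (hΩ.mem_nhds hz)),
    Polynomial.deriv, hχ]
  have h1 : (toBergman hΩ hb 1).1 z = 1 := rfl
  have h2 : (polyHolo hΩ hb p.derivative • toBergman hΩ hb ψ +
      (⟨_, χ.2.1.bergmanFun_deriv hΩ χ.2.2⟩ : bergmanSpace hΩ hb)).1 z =
      (polyHolo hΩ hb p.derivative).1 z * ψ.1 z + deriv χ.1 z := rfl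
  rw [h1, h2, polyHolo_apply, one_mul]
  congr 1
  ring

theorem good_pow {p : Polynomial ℂ} (g : holoAlg hΩ hb)
    (hU : Null Ω (fun z => p.eval z * conj z - g.1 z))
    (hp : ∀ f, BergmanFun Ω f → ∫ z in Ω, p.eval z * f z = 0) (w : ℂ) (i : ℕ) :
    Good hΩ hb p w (p.natDegree * i + 2) (toBergman hΩ hb (g ^ i)) := by
  intro b F
  obtain ⟨Y, hY⟩ := exists_holoBdry_eq hΩ hb g.2.1 g.2.2 hU b i (b + p.natDegree * i) le_rfl
  have h1 := dPair_transfer hΩ hb (P := polyHolo hΩ hb (p ^ (b + p.natDegree * i)))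
    (u := polyHolo hΩ hb (Polynomial.X ^ b) * g ^ i) (Y := Y)
    (hY.congr hΩ fun z _ => by
      rw [holoAlg_mul_apply, holoAlg_pow_apply, polyHolo_apply, polyHolo_apply]
      simp)
    (F * polyHolo hΩ hb (p ^ 2 * (Polynomial.X - Polynomial.C w) ^ 2)) (toBergman hΩ hb 1)
  have e1 : polyHolo hΩ hb (Polynomial.X ^ b) • toBergman hΩ hb (g ^ i) =
      (polyHolo hΩ hb (Polynomial.X ^ b) * g ^ i) • toBergman hΩ hb 1 :=
    Subtype.ext (mul_one _).symm
  rw [e1, show p ^ (b + (p.natDegree * i + 2)) * (Polynomial.X - Polynomial.C w) ^ 2 =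
    p ^ 2 * (Polynomial.X - Polynomial.C w) ^ 2 * p ^ (b + p.natDegree * i) by ring,
    map_mul (polyHolo hΩ hb),
    ← mul_assoc, h1, mul_comm (p ^ 2), map_mul (polyHolo hΩ hb), ← mul_assoc,
    mul_right_comm]
  exact dPair_sq_mul_one hΩ hb hp _

end Good

section OrthDeriv

variable {Ω : Set ℂ} (hΩ : IsOpen Ω) (hb : Bornology.IsBounded Ω) {p : Polynomial ℂ}
  {g : holoAlg hΩ hb}

/-- `p` is an annihilating polynomial of minimal degree with roots in `Ω`, and `g` has the same
boundary values as `p * conj z`. -/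
structure IsSchottky (p : Polynomial ℂ) (g : holoAlg hΩ hb) : Prop where
  ne_zero : p ≠ 0
  natDegree_pos : 0 < p.natDegree
  root_mem : ∀ a, p.IsRoot a → a ∈ Ω
  integral_eq_zero : ∀ f, BergmanFun Ω f → ∫ z in Ω, p.eval z * f z = 0
  natDegree_le : ∀ r ≠ 0, (∀ f, BergmanFun Ω f → ∫ z in Ω, Polynomial.eval z r * f z = 0) →
    p.natDegree ≤ r.natDegree
  null : Null Ω (fun z => p.eval z * conj z - g.1 z)

/-- The monomials in `z` and `g`. -/
def gMon (g : holoAlg hΩ hb) (b i : ℕ) : holoAlg hΩ hb := polyHolo hΩ hb (Polynomial.X ^ b) * g ^ i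

theorem gMon_apply (b i : ℕ) (z : ℂ) : (gMon hΩ hb g b i).1 z = z ^ b * g.1 z ^ i := by
  rw [gMon, holoAlg_mul_apply, holoAlg_pow_apply, polyHolo_apply]
  simp

variable {hΩ hb}

theorem IsSchottky.dPair_gMon (hp : IsSchottky hΩ hb p g) {b i N : ℕ}
    (h : b + p.natDegree * i ≤ N) (f : bergmanSpace hΩ hb) :
    dPair hΩ hb (gMon hΩ hb g b i) (polyHolo hΩ hb (p ^ N) • f) = 0 := by
  obtain ⟨Y, hY⟩ := exists_holoBdry_eq hΩ hb g.2.1 g.2.2 hp.null b i N h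
  exact dPair_smul_eq_zero hΩ hb (Y := Y) (hY.congr hΩ fun z _ => by
    rw [gMon_apply, polyHolo_apply, Polynomial.eval_pow]) f

theorem IsSchottky.division (hp : IsSchottky hΩ hb p g) (N : ℕ) (f : bergmanSpace hΩ hb) :
    ∃ q ∈ Polynomial.degreeLT ℂ (p.natDegree * N), ∃ f₁ : bergmanSpace hΩ hb,
      f = toBergman hΩ hb (polyHolo hΩ hb q) + polyHolo hΩ hb (p ^ N) • f₁ := by
  obtain ⟨q, hq, f₁, hf₁, h⟩ := exists_division (Ω := Ω) (S := BergmanFun Ω)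
    (fun f hf w hw => hf.dslope hΩ hb hw)
    (fun f hf c => (c • (⟨f, hf⟩ : bergmanSpace hΩ hb)).2) (pow_ne_zero N hp.ne_zero)
    (fun a ha => hp.root_mem a (Polynomial.IsRoot.def.2 (by
      have h1 := ha.eq_zero
      rw [Polynomial.eval_pow] at h1
      exact (pow_eq_zero_iff'.1 h1).1))) f.2
  refine ⟨q, ?_, ⟨f₁, hf₁⟩, Subtype.ext (funext fun z => ?_)⟩
  · rw [Polynomial.mem_degreeLT, mul_comm, ← Polynomial.natDegree_pow,
      ← Polynomial.degree_eq_natDegree (pow_ne_zero N hp.ne_zero)]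
    exact hq
  · rw [h, ← polyHolo_apply hΩ hb q, ← polyHolo_apply hΩ hb (p ^ N)]
    rfl

theorem eqOn_zero_of_integral_mul_conj (hΩ : IsOpen Ω) {f : ℂ → ℂ} (hf : BergmanFun Ω f)
    (h : ∫ z in Ω, f z * conj (f z) = 0) : EqOn f 0 Ω := by
  have e : ∫ z in Ω, f z * conj (f z) = ∫ z in Ω, ((‖f z‖ ^ 2 : ℝ) : ℂ) :=
    integral_congr_ae (Filter.Eventually.of_forall fun z => by
      simp only [mul_conj, Complex.normSq_eq_norm_sq])
  rw [e, integral_complex_ofReal, ofReal_eq_zero, integral_eq_zero_iff_of_nonneg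
    (fun z => by positivity) hf.2] at h
  have h2 : f =ᵐ[volume.restrict Ω] 0 := by
    filter_upwards [h] with z hz
    simpa using hz
  exact Measure.eqOn_open_of_ae_eq h2 hΩ hf.1.continuousOn continuousOn_const

theorem IsSchottky.eq_const (hp : IsSchottky hΩ hb p g) (hc : IsPreconnected Ω) {N : ℕ}
    {ι : Type*} [Fintype ι] {b i : ι → ℕ} (hN : ∀ x, b x + p.natDegree * i x ≤ N) (β : ι → ℂ)
    (h : ∀ q ∈ Polynomial.degreeLT ℂ (p.natDegree * N),
      dPair hΩ hb (∑ x, β x • gMon hΩ hb g (b x) (i x)) (toBergman hΩ hb (polyHolo hΩ hb q)) = 0) :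
    ∃ c : ℂ, ∀ z ∈ Ω, ∑ x, β x * (z ^ b x * g.1 z ^ i x) = c := by
  set H := ∑ x, β x • gMon hΩ hb g (b x) (i x) with hH
  have hHz : ∀ z, H.1 z = ∑ x, β x * (z ^ b x * g.1 z ^ i x) := fun z => by
    rw [hH, AddSubmonoidClass.coe_finsetSum, Finset.sum_apply]
    exact Finset.sum_congr rfl fun x _ => by rw [← gMon_apply hΩ hb]; rfl
  set H' : bergmanSpace hΩ hb := ⟨_, H.2.1.bergmanFun_deriv hΩ H.2.2⟩ with hH'
  obtain ⟨q, hq, f, hf⟩ := hp.division N H'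
  have h1 : dPair hΩ hb H H' = 0 := by
    rw [hf, map_add, h q hq, zero_add, hH, map_sum, LinearMap.sum_apply]
    refine Finset.sum_eq_zero fun x _ => ?_
    rw [LinearMap.map_smulₛₗ, LinearMap.smul_apply, hp.dPair_gMon (hN x), smul_zero]
  have h2 : EqOn (deriv H.1) 0 Ω := eqOn_zero_of_integral_mul_conj hΩ H'.2 h1
  rcases Ω.eq_empty_or_nonempty with h0 | ⟨z₀, hz₀⟩
  · exact ⟨0, fun z hz => absurd hz (by rw [h0]; exact notMem_empty z)⟩
  · refine ⟨H.1 z₀, fun z hz => ?_⟩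
    rw [← hHz]
    exact hΩ.is_const_of_deriv_eq_zero hc H.2.2 h2 hz hz₀

theorem IsSchottky.coeff_eq_zero (hp : IsSchottky hΩ hb p g) {A : ℕ}
    {β : Fin (A + 1) × Fin p.natDegree → ℂ} {c : ℂ}
    (h : ∀ z ∈ Ω, ∑ x, β x * (z ^ (x.1 : ℕ) * g.1 z ^ (x.2 : ℕ)) = c)
    (x : Fin (A + 1) × Fin p.natDegree) (hx : (x.1 : ℕ) ≠ 0 ∨ (x.2 : ℕ) ≠ 0) : β x = 0 := by
  set q : ℕ → Polynomial ℂ := fun i => if hi : i < p.natDegree then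
    ∑ b : Fin (A + 1), Polynomial.C (β (b, ⟨i, hi⟩)) * Polynomial.X ^ (b : ℕ) -
      (if i = 0 then Polynomial.C c else 0) else 0 with hq
  have h1 : ∀ z ∈ Ω, ∑ i ∈ Finset.range p.natDegree, (q i).eval z * g.1 z ^ i = 0 := by
    intro z hz
    rw [Finset.sum_range]
    have e : ∀ i : Fin p.natDegree, (q i).eval z * g.1 z ^ (i : ℕ) =
        ∑ b : Fin (A + 1), β (b, i) * (z ^ (b : ℕ) * g.1 z ^ (i : ℕ)) -
          if (i : ℕ) = 0 then c else 0 := by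
      intro i
      simp only [hq, dif_pos i.2, Polynomial.eval_sub, sub_mul, Polynomial.eval_finsetSum,
        Finset.sum_mul]
      congr 1
      · refine Finset.sum_congr rfl fun b _ => ?_
        simp [mul_assoc]
      · split_ifs with hi
        · simp [hi]
        · simp
    simp_rw [e]
    rw [Finset.sum_sub_distrib, ← Fintype.sum_prod_type_right', h z hz, sub_eq_zero]
    have := hp.natDegree_pos
    rw [Finset.sum_eq_single (⟨0, this⟩ : Fin p.natDegree)]
    · simp
    · intro i _ hi
      rw [if_neg fun h => hi (Fin.ext h)]
    · simp
  have h2 := eq_zero_of_sum_eq_zero hΩ hb hp.ne_zero hp.root_mem hp.natDegree_le g.2.1 g.2.2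
    hp.null h1 x.2.2
  have h3 := congrArg (fun r => Polynomial.coeff r (x.1 : ℕ)) h2
  simp only [hq, dif_pos x.2.2, Polynomial.coeff_sub, Polynomial.finsetSum_coeff,
    Polynomial.coeff_C_mul, Polynomial.coeff_X_pow, Polynomial.coeff_zero] at h3
  rw [Finset.sum_eq_single x.1] at h3
  · have h4 : (if (x.2 : ℕ) = 0 then Polynomial.C c else 0).coeff (x.1 : ℕ) = 0 := by
      rcases hx with hx | hx
      · split_ifs
        · exact Polynomial.coeff_C_of_ne_zero hx
        · rfl
      · rw [if_neg hx, Polynomial.coeff_zero]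
    rw [h4] at h3
    simpa using h3
  · intro b _ hb'
    rw [if_neg fun h => hb' (Fin.ext h.symm), mul_zero]
  · simp

end OrthDeriv

section FiniteDim

variable {Ω : Set ℂ} (hΩ : IsOpen Ω) (hb : Bornology.IsBounded Ω) {p : Polynomial ℂ}
  {g : holoAlg hΩ hb}

/-- The linear map taking a polynomial to its pairings with the monomials in `z` and `g`. -/
def momentMap (d : ℕ) (g : holoAlg hΩ hb) (A n : ℕ) :
    Polynomial.degreeLT ℂ n →ₗ[ℂ] (Fin (A + 1) × Fin d → ℂ) :=
  LinearMap.pi fun x => dPair hΩ hb (gMon hΩ hb g x.1 x.2) ∘ₗ toBergman hΩ hb ∘ₗ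
    (polyHolo hΩ hb).toLinearMap ∘ₗ (Polynomial.degreeLT ℂ n).subtype

instance (n : ℕ) : FiniteDimensional ℂ (Polynomial.degreeLT ℂ n) :=
  (Polynomial.degreeLTEquiv ℂ n).symm.finiteDimensional

theorem finrank_degreeLT (n : ℕ) : Module.finrank ℂ (Polynomial.degreeLT ℂ n) = n := by
  rw [(Polynomial.degreeLTEquiv ℂ n).finrank_eq, Module.finrank_fin_fun]

variable {hΩ hb}

theorem IsSchottky.finrank_ker (hp : IsSchottky hΩ hb p g) (hc : IsPreconnected Ω) (A : ℕ) :
    Module.finrank ℂ (momentMap hΩ hb p.natDegree g A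
      (p.natDegree * (A + p.natDegree * p.natDegree))).ker + (A + 1) * p.natDegree ≤
      p.natDegree * (A + p.natDegree * p.natDegree) + 1 := by
  set T := momentMap hΩ hb p.natDegree g A (p.natDegree * (A + p.natDegree * p.natDegree)) with hT
  set x₀ : Fin (A + 1) × Fin p.natDegree := (0, ⟨0, hp.natDegree_pos⟩) with hx₀
  have h1 := T.finrank_range_add_finrank_ker
  rw [finrank_degreeLT] at h1
  have h2 := Subspace.finrank_add_finrank_dualAnnihilator_eq T.range
  rw [Module.finrank_fintype_fun_eq_card, Fintype.card_prod, Fintype.card_fin,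
    Fintype.card_fin] at h2
  have h3 : Module.finrank ℂ T.range.dualAnnihilator ≤ 1 := by
    refine le_of_le_of_eq ?_ (Module.finrank_self ℂ)
    refine LinearMap.finrank_le_finrank_of_injective
      (f := Module.Dual.eval ℂ _ (Pi.single x₀ 1) ∘ₗ T.range.dualAnnihilator.subtype)
      ((injective_iff_map_eq_zero _).2 fun φ hφ => ?_)
    have h0 : φ.1 (Pi.single x₀ 1) = 0 := hφ
    have hsum : ∀ v : Fin (A + 1) × Fin p.natDegree → ℂ,
        φ.1 v = ∑ x, φ.1 (Pi.single x 1) * v x := by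
      intro v
      rw [LinearMap.pi_apply_eq_sum_univ]
      refine Finset.sum_congr rfl fun x _ => ?_
      rw [smul_eq_mul, mul_comm]
      congr 2
      ext y
      simp [Pi.single_apply, eq_comm]
    obtain ⟨c, hc⟩ := hp.eq_const hc (b := fun x : Fin (A + 1) × Fin p.natDegree => (x.1 : ℕ))
      (i := fun x => (x.2 : ℕ)) (N := A + p.natDegree * p.natDegree)
      (fun x => Nat.add_le_add (Nat.lt_succ_iff.1 x.1.2) (Nat.mul_le_mul_left _ x.2.2.le))
      (fun x => conj (φ.1 (Pi.single x 1))) (fun q hq => by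
        have h4 := (Submodule.mem_dualAnnihilator _).1 φ.2 _ ⟨⟨q, hq⟩, rfl⟩
        rw [hsum] at h4
        rw [← h4, map_sum, LinearMap.sum_apply]
        refine Finset.sum_congr rfl fun x _ => ?_
        rw [LinearMap.map_smulₛₗ, LinearMap.smul_apply, conj_conj, smul_eq_mul]
        rfl)
    refine Subtype.ext (LinearMap.ext fun v => ?_)
    rw [hsum]
    refine Finset.sum_eq_zero fun x _ => ?_
    by_cases hx : x = x₀
    · rw [hx, h0, zero_mul]
    · have h5 := hp.coeff_eq_zero hc x (by
        by_contra! h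
        exact hx (Prod.ext (Fin.ext h.1) (Fin.ext h.2)))
      rw [(map_eq_zero _).1 h5, zero_mul]
  omega

variable (hΩ hb)

/-- The Bergman functions orthogonal to all derivatives of nice holomorphic functions. -/
def orthDeriv : Submodule ℂ (bergmanSpace hΩ hb) := ⨅ H, (dPair hΩ hb H).ker

theorem mem_orthDeriv {f : bergmanSpace hΩ hb} :
    f ∈ orthDeriv hΩ hb ↔ ∀ H, dPair hΩ hb H f = 0 := by
  simp [orthDeriv, Submodule.mem_iInf]

/-- Multiplication by a nice holomorphic function. -/
def mulBergman (F : holoAlg hΩ hb) : bergmanSpace hΩ hb →ₗ[ℂ] bergmanSpace hΩ hb where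
  toFun f := F • f
  map_add' := smul_add F
  map_smul' c f := Subtype.ext (funext fun z => mul_left_comm (F.1 z) c (f.1 z))

variable {hΩ hb}

theorem IsSchottky.exists_ne_zero_mem_range (hp : IsSchottky hΩ hb p g) (hc : IsPreconnected Ω)
    {V : Type*} [AddCommGroup V] [Module ℂ V] [FiniteDimensional ℂ V]
    (L : V →ₗ[ℂ] bergmanSpace hΩ hb) (hL : ∀ x, L x ∈ orthDeriv hΩ hb)
    (hV : p.natDegree ^ 3 + 1 < Module.finrank ℂ V) (A : ℕ) :
    (mulBergman hΩ hb (polyHolo hΩ hb (p ^ A))).range.comap L ≠ ⊥ := by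
  intro hbot
  set N := A + p.natDegree * p.natDegree with hN
  set T := momentMap hΩ hb p.natDegree g A (p.natDegree * N) with hT
  have hk : Module.finrank ℂ T.ker + (A + 1) * p.natDegree ≤ p.natDegree * N + 1 :=
    hp.finrank_ker hc A
  set Q := (mulBergman hΩ hb (polyHolo hΩ hb (p ^ N))).range with hQ
  set S : T.ker →ₗ[ℂ] (bergmanSpace hΩ hb ⧸ Q) := Q.mkQ ∘ₗ toBergman hΩ hb ∘ₗ
    (polyHolo hΩ hb).toLinearMap ∘ₗ (Polynomial.degreeLT ℂ (p.natDegree * N)).subtype ∘ₗ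
    T.ker.subtype with hS
  have hinj : Function.Injective (Q.mkQ ∘ₗ L) := by
    refine (injective_iff_map_eq_zero _).2 fun x hx => ?_
    have h1 : L x ∈ Q := (Submodule.Quotient.mk_eq_zero Q).1 hx
    obtain ⟨f, hf⟩ := h1
    refine (Submodule.mem_bot ℂ).1 (hbot ▸ ?_)
    refine Submodule.mem_comap.2 ⟨polyHolo hΩ hb (p ^ (p.natDegree * p.natDegree)) • f, ?_⟩
    rw [← hf]
    change polyHolo hΩ hb (p ^ A) • _ • f = polyHolo hΩ hb (p ^ N) • f
    rw [smul_smul, ← map_mul, ← pow_add]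
  have hrange : (Q.mkQ ∘ₗ L).range ≤ S.range := by
    rintro _ ⟨x, rfl⟩
    obtain ⟨q, hq, f, hf⟩ := hp.division N (L x)
    refine ⟨⟨⟨q, hq⟩, ?_⟩, ?_⟩
    · rw [LinearMap.mem_ker]
      ext y
      have h1 := (mem_orthDeriv hΩ hb).1 (hL x) (gMon hΩ hb g y.1 y.2)
      rw [hf, map_add, hp.dPair_gMon (Nat.add_le_add (Nat.lt_succ_iff.1 y.1.2)
        (Nat.mul_le_mul_left _ y.2.2.le)), add_zero] at h1
      exact h1
    · change Q.mkQ (toBergman hΩ hb (polyHolo hΩ hb q)) = Q.mkQ (L x)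
      rw [hf, map_add]
      have h1 : Q.mkQ (polyHolo hΩ hb (p ^ N) • f) = 0 :=
        (Submodule.Quotient.mk_eq_zero Q).2 ⟨f, rfl⟩
      rw [h1, add_zero]
  have h1 := LinearMap.finrank_range_of_inj hinj
  have h2 := Submodule.finrank_mono hrange
  have h3 := S.finrank_range_le
  have h4 : p.natDegree * N = A * p.natDegree + p.natDegree ^ 3 := by rw [hN]; ring
  have h5 : (A + 1) * p.natDegree = A * p.natDegree + p.natDegree := by ring
  omega

end FiniteDim

section Relation

variable {Ω : Set ℂ} {hΩ : IsOpen Ω} {hb : Bornology.IsBounded Ω} {p : Polynomial ℂ}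
  {g : holoAlg hΩ hb}

theorem eqOn_zero_of_forall_pow_dvd (hΩ : IsOpen Ω) (hc : IsPreconnected Ω) {f : ℂ → ℂ}
    (hf : DifferentiableOn ℂ f Ω) {a : ℂ} (ha : a ∈ Ω)
    (h : ∀ n : ℕ, ∃ F, DifferentiableOn ℂ F Ω ∧ ∀ z ∈ Ω, f z = (z - a) ^ n * F z) :
    EqOn f 0 Ω := by
  have hfa : AnalyticAt ℂ f a := hf.analyticAt (hΩ.mem_nhds ha)
  have h1 : analyticOrderAt f a = ⊤ := by
    refine ENat.eq_top_iff_forall_ge.2 fun n => ?_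
    obtain ⟨F, hF, hfF⟩ := h n
    exact (natCast_le_analyticOrderAt hfa).2 ⟨F, hF.analyticAt (hΩ.mem_nhds ha),
      Filter.eventually_of_mem (hΩ.mem_nhds ha) hfF⟩
  exact (hf.analyticOnNhd hΩ).eqOn_zero_of_preconnected_of_eventuallyEq_zero hc ha
    (analyticOrderAt_eq_top.1 h1)

theorem IsSchottky.exists_eqOn_zero (hp : IsSchottky hΩ hb p g) (hc : IsPreconnected Ω)
    {V : Type*} [AddCommGroup V] [Module ℂ V] [FiniteDimensional ℂ V]
    (L : V →ₗ[ℂ] bergmanSpace hΩ hb) (hL : ∀ x, L x ∈ orthDeriv hΩ hb)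
    (hV : p.natDegree ^ 3 + 1 < Module.finrank ℂ V) : ∃ x ≠ 0, EqOn (L x).1 0 Ω := by
  set S : ℕ → Submodule ℂ V :=
    fun A => (mulBergman hΩ hb (polyHolo hΩ hb (p ^ A))).range.comap L with hS
  have hanti : Antitone S := by
    refine antitone_nat_of_succ_le fun A => Submodule.comap_mono ?_
    rintro _ ⟨f, rfl⟩
    refine ⟨polyHolo hΩ hb p • f, ?_⟩
    change polyHolo hΩ hb (p ^ A) • _ • f = polyHolo hΩ hb (p ^ (A + 1)) • f
    rw [smul_smul, ← map_mul, ← pow_succ]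
  obtain ⟨n, hn⟩ := IsArtinian.monotone_stabilizes (⟨fun A => OrderDual.toDual (S A), hanti⟩ :
    ℕ →o (Submodule ℂ V)ᵒᵈ)
  obtain ⟨x, hx, hx0⟩ := Submodule.exists_mem_ne_zero_of_ne_bot
    (hp.exists_ne_zero_mem_range hc L hL hV n)
  have hxA : ∀ A, x ∈ S A := fun A => by
    rcases le_total n A with h | h
    · have h1 : S n = S A := hn A h
      exact h1 ▸ hx
    · exact hanti h hx
  refine ⟨x, hx0, ?_⟩
  obtain ⟨a, ha⟩ := IsAlgClosed.exists_root p
    (ne_of_gt (Polynomial.natDegree_pos_iff_degree_pos.1 hp.natDegree_pos))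
  refine eqOn_zero_of_forall_pow_dvd hΩ hc (L x).2.1 (hp.root_mem a ha) fun A => ?_
  obtain ⟨f, hf⟩ := hxA A
  obtain ⟨r, hr⟩ := Polynomial.dvd_iff_isRoot.2 ha
  refine ⟨fun z => r.eval z ^ A * f.1 z, (r.differentiable.differentiableOn.pow A).mul f.2.1,
    fun z _ => ?_⟩
  rw [← hf]
  change (polyHolo hΩ hb (p ^ A)).1 z * f.1 z = _
  rw [polyHolo_apply, Polynomial.eval_pow, hr, Polynomial.eval_mul]
  simp [mul_pow, mul_assoc]

theorem Good.mem_orthDeriv (hp : IsSchottky hΩ hb p g) {w : ℂ} (hw : w ∈ Ω) (N : ℕ)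
    {f : bergmanSpace hΩ hb}
    (h1 : ∀ F : holoAlg hΩ hb,
      dPair hΩ hb (F * polyHolo hΩ hb (p ^ N * (Polynomial.X - Polynomial.C w) ^ 2)) f = 0)
    (h2 : ∀ j < p.natDegree * N + 2, dPair hΩ hb (polyHolo hΩ hb (Polynomial.X ^ j)) f = 0) :
    f ∈ orthDeriv hΩ hb := by
  rw [_root_.mem_orthDeriv]
  intro H
  have hne : p ^ N * (Polynomial.X - Polynomial.C w) ^ 2 ≠ 0 :=
    mul_ne_zero (pow_ne_zero _ hp.ne_zero) (pow_ne_zero _ (Polynomial.X_sub_C_ne_zero w))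
  obtain ⟨q, hq, F, hF⟩ := holo_division hΩ hb hne (fun a ha => by
    have h := ha.eq_zero
    rw [Polynomial.eval_mul, mul_eq_zero, Polynomial.eval_pow, Polynomial.eval_pow] at h
    rcases h with h | h
    · exact hp.root_mem a (pow_eq_zero_iff'.1 h).1
    · have := (pow_eq_zero_iff'.1 h).1
      rw [Polynomial.eval_sub, Polynomial.eval_X, Polynomial.eval_C, sub_eq_zero] at this
      exact this ▸ hw) H
  have e : H = polyHolo hΩ hb q +
      F * polyHolo hΩ hb (p ^ N * (Polynomial.X - Polynomial.C w) ^ 2) := by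
    refine Subtype.ext (funext fun z => ?_)
    rw [hF]
    change _ = (polyHolo hΩ hb q).1 z + F.1 z * (polyHolo hΩ hb _).1 z
    rw [polyHolo_apply, polyHolo_apply, mul_comm]
  have hdeg : q.natDegree < p.natDegree * N + 2 := by
    rcases eq_or_ne q 0 with h0 | h0
    · rw [h0, Polynomial.natDegree_zero]
      omega
    · refine lt_of_lt_of_le (Polynomial.natDegree_lt_natDegree h0 hq)
        (Polynomial.natDegree_mul_le.trans ?_)
      rw [Polynomial.natDegree_pow, Polynomial.natDegree_pow, Polynomial.natDegree_X_sub_C,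
        mul_comm]
  rw [e, map_add, LinearMap.add_apply, h1, add_zero, q.as_sum_range' _ hdeg, map_sum, map_sum,
    LinearMap.sum_apply]
  refine Finset.sum_eq_zero fun j hj => ?_
  rw [← Polynomial.C_mul_X_pow_eq_monomial, Polynomial.C_mul', map_smul (polyHolo hΩ hb),
    LinearMap.map_smulₛₗ, LinearMap.smul_apply, h2 j (Finset.mem_range.1 hj), smul_zero]

theorem IsSchottky.exists_relation (hp : IsSchottky hΩ hb p g) (hc : IsPreconnected Ω) {w : ℂ}
    (hw : w ∈ Ω) {κ : ℕ} {h : bergmanSpace hΩ hb} (hh : Good hΩ hb p w κ h) :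
    ∃ c : Polynomial ℂ, c ≠ 0 ∧ ∃ r : Fin p.natDegree → Polynomial ℂ, ∀ z ∈ Ω,
      c.eval z * h.1 z = ∑ i, (r i).eval z * g.1 z ^ (i : ℕ) := by
  set d := p.natDegree with hd
  set κ' := κ + (d * d + 2) with hκ'
  set B := d ^ 3 + d * κ' + 3 with hB
  set gen : Fin (d + 1) → bergmanSpace hΩ hb :=
    Fin.snoc (fun i : Fin d => toBergman hΩ hb (g ^ (i : ℕ))) h with hgen
  have hgood : ∀ j, Good hΩ hb p w κ' (gen j) := by
    intro j
    refine Fin.lastCases ?_ (fun i => ?_) j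
    · rw [hgen, Fin.snoc_last]
      exact hh.mono hΩ hb (Nat.le_add_right _ _)
    · rw [hgen, Fin.snoc_castSucc]
      refine (good_pow hΩ hb g hp.null hp.integral_eq_zero w i).mono hΩ hb ?_
      exact (Nat.add_le_add_right (Nat.mul_le_mul_left _ i.2.le) 2).trans (Nat.le_add_left _ _)
  set L : (Fin (d + 1) × Fin (B + 1) → ℂ) →ₗ[ℂ] bergmanSpace hΩ hb :=
    Fintype.linearCombination ℂ (fun y : Fin (d + 1) × Fin (B + 1) =>
      polyHolo hΩ hb (Polynomial.X ^ (y.2 : ℕ)) • gen y.1) with hL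
  set T : (Fin (d + 1) × Fin (B + 1) → ℂ) →ₗ[ℂ] (Fin (d * (B + κ') + 2) → ℂ) :=
    LinearMap.pi fun j => dPair hΩ hb (polyHolo hΩ hb (Polynomial.X ^ (j : ℕ))) ∘ₗ L with hT
  have hrank : d ^ 3 + 1 < Module.finrank ℂ T.ker := by
    have h1 := T.finrank_range_add_finrank_ker
    have h2 := T.range.finrank_le
    rw [Module.finrank_fin_fun] at h2
    rw [Module.finrank_fintype_fun_eq_card, Fintype.card_prod, Fintype.card_fin,
      Fintype.card_fin] at h1
    have h3 : (d + 1) * (B + 1) = d * (B + κ') + d + 1 + d ^ 3 + 3 := by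
      rw [hB]
      ring
    omega
  obtain ⟨x, hx, hx0⟩ := hp.exists_eqOn_zero hc (L ∘ₗ T.ker.subtype) (fun x => by
    refine Good.mem_orthDeriv hp hw (B + κ') (fun F => ?_) (fun j hj => ?_)
    · change dPair hΩ hb _ (L x.1) = 0
      rw [hL, Fintype.linearCombination_apply, map_sum]
      refine Finset.sum_eq_zero fun y _ => ?_
      have h1 := (hgood y.1).mono hΩ hb (Nat.le_add_left κ' (B - y.2)) y.2 F
      rw [show (y.2 : ℕ) + (B - y.2 + κ') = B + κ' by omega] at h1
      rw [map_smul, h1, smul_zero]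
    · exact congrFun (LinearMap.mem_ker.1 x.2) ⟨j, hj⟩) hrank
  set r : Fin (d + 1) → Polynomial ℂ :=
    fun j => ∑ b : Fin (B + 1), Polynomial.C (x.1 (j, b)) * Polynomial.X ^ (b : ℕ) with hr
  have hrel : ∀ z ∈ Ω, ∑ i : Fin d, (r i.castSucc).eval z * g.1 z ^ (i : ℕ) +
      (r (Fin.last d)).eval z * h.1 z = 0 := by
    intro z hz
    have h1 : (L x.1).1 z = 0 := hx0 hz
    have h2 : (L x.1).1 z = ∑ j, (r j).eval z * (gen j).1 z := by
      rw [hL, Fintype.linearCombination_apply, AddSubmonoidClass.coe_finsetSum, Finset.sum_apply,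
        Fintype.sum_prod_type]
      refine Finset.sum_congr rfl fun j _ => ?_
      rw [hr, Polynomial.eval_finsetSum, Finset.sum_mul]
      refine Finset.sum_congr rfl fun b _ => ?_
      rw [bergmanSpace_const_smul_apply, bergmanSpace_smul_apply, polyHolo_apply,
        Polynomial.eval_mul, Polynomial.eval_C, mul_assoc]
    rw [h2, Fin.sum_univ_castSucc] at h1
    simp only [hgen, Fin.snoc_castSucc, Fin.snoc_last] at h1
    exact h1
  have hcoeff : ∀ j b, (r j).coeff (b : Fin (B + 1)) = x.1 (j, b) := by
    intro j b
    simp only [hr, Polynomial.finsetSum_coeff, Polynomial.coeff_C_mul, Polynomial.coeff_X_pow]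
    rw [Finset.sum_eq_single b]
    · simp
    · intro b' _ h
      rw [if_neg fun h' => h (Fin.ext h'.symm), mul_zero]
    · simp
  have hlast : r (Fin.last d) ≠ 0 := by
    intro h0
    have h1 : ∀ i : Fin d, r i.castSucc = 0 := fun i => by
      have h2 := eq_zero_of_sum_eq_zero hΩ hb hp.ne_zero hp.root_mem hp.natDegree_le g.2.1 g.2.2
        hp.null (q := fun i => if hi : i < d then r (Fin.castSucc ⟨i, hi⟩) else 0)
        (fun z hz => by
          rw [← hrel z hz, h0, Polynomial.eval_zero, zero_mul, add_zero, Finset.sum_range]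
          exact Finset.sum_congr rfl fun i _ => by rw [dif_pos i.2]) i.2
      simpa only [dif_pos i.2] using h2
    refine hx (Subtype.ext (funext fun y => ?_))
    rw [← Prod.mk.eta (p := y), ← hcoeff,
      show r y.1 = 0 from Fin.lastCases h0 h1 y.1, Polynomial.coeff_zero]
    rfl
  refine ⟨r (Fin.last d), hlast, fun i => -r i.castSucc, fun z hz => ?_⟩
  rw [eq_neg_of_add_eq_zero_right (hrel z hz), ← Finset.sum_neg_distrib]
  exact Finset.sum_congr rfl fun i _ => by rw [Polynomial.eval_neg, neg_mul]

end Relation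

section Algebraic

variable {Ω : Set ℂ}

/-- Polynomials as functions on `Ω`. -/
def polyFun (Ω : Set ℂ) : Polynomial ℂ →+* (Ω → ℂ) := RingHom.pi fun z => Polynomial.evalRingHom z.1

theorem eval_equivMvPolynomial (z y : ℂ) (Q : Polynomial (Polynomial ℂ)) :
    MvPolynomial.eval ![z, y] (Polynomial.Bivariate.equivMvPolynomial ℂ Q) =
      Polynomial.eval₂ (Polynomial.evalRingHom z) y Q := by
  have h : (MvPolynomial.eval ![z, y]).comp
      (Polynomial.Bivariate.equivMvPolynomial ℂ).toRingEquiv.toRingHom =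
      Polynomial.eval₂RingHom (Polynomial.evalRingHom z) y := by
    ext <;> simp
  exact congrArg (fun φ => φ Q) h

theorem exists_mvPolynomial {h : ℂ → ℂ}
    (hh : letI := (polyFun Ω).toAlgebra; IsAlgebraic (Polynomial ℂ) (fun z : Ω => h z)) :
    ∃ P : MvPolynomial (Fin 2) ℂ, P ≠ 0 ∧ ∀ z ∈ Ω, MvPolynomial.eval ![z, h z] P = 0 := by
  let := (polyFun Ω).toAlgebra
  obtain ⟨Q, hQ, hQ0⟩ := hh
  refine ⟨Polynomial.Bivariate.equivMvPolynomial ℂ Q,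
    (map_ne_zero_iff _ (Polynomial.Bivariate.equivMvPolynomial ℂ).injective).2 hQ, fun z hz => ?_⟩
  have h1 : Polynomial.eval₂ (Polynomial.evalRingHom z) (h z) Q = 0 := by
    have h2 := congrFun hQ0 ⟨z, hz⟩
    rw [Polynomial.aeval_def] at h2
    have h3 := Polynomial.hom_eval₂ Q (polyFun Ω) (Pi.evalRingHom _ ⟨z, hz⟩) (fun z : Ω => h z)
    exact h3.symm.trans h2
  rw [eval_equivMvPolynomial, h1]

theorem isAlgebraic_of_relation {d : ℕ} {G h : ℂ → ℂ} {c₀ c : Polynomial ℂ} (hc₀ : c₀ ≠ 0)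
    (hc : c ≠ 0) {r₀ r : Fin d → Polynomial ℂ}
    (hG : ∀ z ∈ Ω, c₀.eval z * G z ^ d = ∑ i, (r₀ i).eval z * G z ^ (i : ℕ))
    (hh : ∀ z ∈ Ω, c.eval z * h z = ∑ i, (r i).eval z * G z ^ (i : ℕ)) :
    letI := (polyFun Ω).toAlgebra; IsAlgebraic (Polynomial ℂ) (fun z : Ω => h z) := by
  let := (polyFun Ω).toAlgebra
  have hsm : ∀ (a : Polynomial ℂ) (f : Ω → ℂ), a • f = fun z => a.eval z.1 * f z := fun a f => by
    rw [Algebra.smul_def]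
    rfl
  have hGa : IsAlgebraic (Polynomial ℂ) (fun z : Ω => G z) := by
    refine ⟨Polynomial.C c₀ * Polynomial.X ^ d -
      ∑ i : Fin d, Polynomial.C (r₀ i) * Polynomial.X ^ (i : ℕ), fun h0 => hc₀ ?_, ?_⟩
    · have h1 := congrArg (fun q => Polynomial.coeff q d) h0
      simp only [Polynomial.coeff_sub, Polynomial.coeff_C_mul_X_pow, Polynomial.finsetSum_coeff,
        if_true, Polynomial.coeff_zero] at h1
      rwa [Finset.sum_eq_zero fun i _ => if_neg i.2.ne', sub_zero] at h1
    · ext z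
      simp only [map_sub, map_mul, map_pow, map_sum, Polynomial.aeval_C, Polynomial.aeval_X]
      simp only [← Algebra.smul_def, hsm, Pi.sub_apply, Pi.pow_apply, Finset.sum_apply,
        Pi.zero_apply]
      rw [hG z z.2, sub_self]
  refine IsAlgebraic.of_smul (mem_nonZeroDivisors_of_ne_zero hc) ?_
  have e : c • (fun z : Ω => h z) = ∑ i, r i • (fun z : Ω => G z) ^ (i : ℕ) := by
    ext z
    simp only [hsm, Finset.sum_apply, Pi.pow_apply]
    exact hh z z.2
  rw [e]
  exact Subalgebra.sum_mem (Subalgebra.algebraicClosure (Polynomial ℂ) (Ω → ℂ)) fun i _ =>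
    Subalgebra.smul_mem _ (Subalgebra.pow_mem _ hGa _) _

end Algebraic

end Auxiliary

/-- the Bergman kernel of a quadrature domain of finite area is an algebraic
function of `z` for each fixed `w`. -/
theorem stmt_5 (Ω : Set ℂ) (hΩ : IsFinConnDomain Ω) (hA : volume Ω < ⊤)
    (hq : IsQuadratureDomain Ω)
    (K : ℂ → ℂ → ℂ)
    (hK1 : ∀ w ∈ Ω, BergmanFun Ω (fun z => K z w))
    (hK2 : ∀ f : ℂ → ℂ, BergmanFun Ω f → ∀ w ∈ Ω, f w = ∫ z in Ω, f z * conj (K z w)) :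
    ∀ w ∈ Ω, ∃ P : MvPolynomial (Fin 2) ℂ, P ≠ 0 ∧
      ∀ z ∈ Ω, MvPolynomial.eval ![z, K z w] P = 0 := by
  intro w hw
  have hc := hΩ.2.1.isPreconnected
  have hb := isBounded_of_quadrature hΩ.1 hA hq
  obtain ⟨p, hp0, hpd, hpr, hpa, hpm⟩ := exists_annihilator hΩ.1 hb ⟨w, hw⟩ hq
  obtain ⟨G, hG', hG, hU⟩ := exists_schottky hΩ.1 hb p hpa
  set g : holoAlg hΩ.1 hb := ⟨G, hG, hG'⟩
  have hp : IsSchottky hΩ.1 hb p g := ⟨hp0, hpd, hpr, hpa, hpm, hU⟩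
  obtain ⟨c₀, hc₀, r₀, h₀⟩ := hp.exists_relation hc hw
    (good_pow hΩ.1 hb g hU hpa w p.natDegree)
  obtain ⟨c, hc', r, h⟩ := hp.exists_relation hc hw
    (good_bergmanKernel hΩ.1 hb hG hG' hU hw ⟨_, hK1 w hw⟩ fun f hf => hK2 f hf w hw)
  exact exists_mvPolynomial (isAlgebraic_of_relation hc₀ hc' h₀ h)
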